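/- Assume m + p ≥ 2. Then there exists σ0 ∈ (2(1−p)/(m−1), ∞) such that for every σ ∈ (2(1−p)/(m−1), σ0): (i) every good profile with interface whose behavior at the origin is (B2) or (B3) has an interface of Type II; and (ii) there exists a good profile with interface of Type I whose behavior at the origin is (B1). -/

import Mathlib

open Real Filter Set Topology

noncomputable def alphaC (m p σ : ℝ) : ℝ := (σ + 2) / (σ * (m - 1) + 2 * (p - 1))

noncomputable def betaC (m p σ : ℝ) : ℝ := (m - p) / (σ * (m - 1) + 2 * (p - 1))

/-- The self-similar profile ODE (SSODE) at the point `ξ`. -/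
def SSODE (N : ℕ) (m p σ : ℝ) (f : ℝ → ℝ) (ξ : ℝ) : Prop :=
  deriv (deriv fun x => f x ^ m) ξ + ((N : ℝ) - 1) / ξ * deriv (fun x => f x ^ m) ξ
    - alphaC m p σ * f ξ + betaC m p σ * ξ * deriv f ξ + ξ ^ σ * f ξ ^ p = 0

/-- `f` is a profile with interface at `ξ0`. -/
def ProfileWithInterface (N : ℕ) (m p σ : ℝ) (f : ℝ → ℝ) (ξ0 : ℝ) : Prop :=
  0 < ξ0 ∧
  ContinuousOn f (Icc 0 ξ0) ∧
  (∀ ξ ∈ Ioo 0 ξ0, 0 < f ξ) ∧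
  ContDiffOn ℝ 2 f (Ioo 0 ξ0) ∧
  (∀ ξ ∈ Ioo 0 ξ0, SSODE N m p σ f ξ) ∧
  f ξ0 = 0 ∧
  Tendsto (fun ξ => deriv (fun x => f x ^ m) ξ) (𝓝[<] ξ0) (𝓝 0)

/-- Interface of Type I: `f(ξ) ~ (ξ0 - ξ)^(1/(m-1))` as `ξ → ξ0⁻`. -/
def TypeI (m : ℝ) (f : ℝ → ℝ) (ξ0 : ℝ) : Prop :=
  ∃ c, 0 < c ∧ Tendsto (fun ξ => f ξ * (ξ0 - ξ) ^ (-(1 / (m - 1)))) (𝓝[<] ξ0) (𝓝 c)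

/-- Interface of Type II: `f(ξ) ~ (ξ0 - ξ)^(1/(1-p))` as `ξ → ξ0⁻`. -/
def TypeII (p : ℝ) (f : ℝ → ℝ) (ξ0 : ℝ) : Prop :=
  ∃ c, 0 < c ∧ Tendsto (fun ξ => f ξ * (ξ0 - ξ) ^ (-(1 / (1 - p)))) (𝓝[<] ξ0) (𝓝 c)

/-- Behavior (B1) at the origin. -/
def BehB1 (N : ℕ) (m p σ : ℝ) (f : ℝ → ℝ) : Prop :=
  0 < f 0 ∧ Tendsto (fun ξ => (f ξ ^ (m - 1) - f 0 ^ (m - 1)) / ξ ^ 2)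
    (𝓝[>] 0) (𝓝 (alphaC m p σ * (m - 1) / (2 * m * (N : ℝ))))

/-- Behavior (B2) at the origin. -/
def BehB2 (N : ℕ) (m : ℝ) (f : ℝ → ℝ) : Prop :=
  f 0 = 0 ∧ Tendsto (fun ξ => f ξ * ξ ^ (-(2 / (m - 1)))) (𝓝[>] 0)
    (𝓝 (((m - 1) / (2 * m * (m * (N : ℝ) - (N : ℝ) + 2))) ^ (1 / (m - 1))))

/-- Behavior (B3) at the origin. -/
def BehB3 (m p σ : ℝ) (f : ℝ → ℝ) : Prop :=
  f 0 = 0 ∧ ∃ K, 0 < K ∧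
    Tendsto (fun ξ => f ξ * ξ ^ (-((σ + 2) / (m - p)))) (𝓝[>] 0) (𝓝 K)

/-- A good profile with interface at `ξ0`. -/
def GoodProfile (N : ℕ) (m p σ : ℝ) (f : ℝ → ℝ) (ξ0 : ℝ) : Prop :=
  ProfileWithInterface N m p σ f ξ0 ∧
  (BehB1 N m p σ f ∨ BehB2 N m f ∨ BehB3 m p σ f)

noncomputable def xiMax (m p σ : ℝ) : ℝ := (betaC m p σ ^ 2 / (4 * m)) ^ (1 / (σ - 2))

namespace SSP

/-- sign before a zero with positive derivative -/
lemma neg_before_zero {g : ℝ → ℝ} {d t : ℝ} (hg : HasDerivAt g d t) (h0 : g t = 0) (hd : 0 < d) :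
    ∀ᶠ s in 𝓝[<] t, g s < 0 := by
  have h1 := (hasDerivAt_iff_tendsto_slope.1 hg).eventually (lt_mem_nhds hd)
  have h2 : ∀ᶠ s in 𝓝[<] t, 0 < slope g t s :=
    h1.filter_mono (nhdsWithin_mono _ (fun s hs => ne_of_lt hs))
  filter_upwards [h2, self_mem_nhdsWithin] with s hs hst
  rw [slope_def_field, h0, sub_zero] at hs
  have : s - t < 0 := sub_neg.2 hst
  by_contra hcon
  push Not at hcon
  have := div_nonpos_of_nonneg_of_nonpos hcon this.le
  linarith

/-- Forward invariance with two barriers. -/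
lemma barrier2 {g₁ g₂ d₁ d₂ : ℝ → ℝ} {t₁ T : ℝ}
    (h₁ : ∀ t, t₁ ≤ t → t < T → HasDerivAt g₁ (d₁ t) t)
    (h₂ : ∀ t, t₁ ≤ t → t < T → HasDerivAt g₂ (d₂ t) t)
    (i₁ : 0 < g₁ t₁) (i₂ : 0 < g₂ t₁)
    (b₁ : ∀ t, t₁ ≤ t → t < T → g₁ t = 0 → 0 ≤ g₂ t → 0 < d₁ t)
    (b₂ : ∀ t, t₁ ≤ t → t < T → g₂ t = 0 → 0 ≤ g₁ t → 0 < d₂ t) :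
    ∀ t, t₁ ≤ t → t < T → 0 < g₁ t ∧ 0 < g₂ t := by
  intro t ht htT
  by_contra hcon
  let E : Set ℝ := {s | s ∈ Icc t₁ t ∧ min (g₁ s) (g₂ s) ≤ 0}
  have hc₁ : ContinuousOn g₁ (Icc t₁ t) := fun s hs =>
    (h₁ s hs.1 (hs.2.trans_lt htT)).continuousAt.continuousWithinAt
  have hc₂ : ContinuousOn g₂ (Icc t₁ t) := fun s hs =>
    (h₂ s hs.1 (hs.2.trans_lt htT)).continuousAt.continuousWithinAt
  have hE : IsClosed E :=
    (hc₁.inf hc₂).preimage_isClosed_of_isClosed isClosed_Icc isClosed_Iic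
  have hEne : E.Nonempty := ⟨t, ⟨ht, le_rfl⟩, by
    by_contra h
    push Not at h
    exact hcon ⟨(lt_min_iff.1 h).1, (lt_min_iff.1 h).2⟩⟩
  have hEb : BddBelow E := ⟨t₁, fun s hs => hs.1.1⟩
  set τ := sInf E with hτ
  have hτE : τ ∈ E := hE.csInf_mem hEne hEb
  have hτ1 : t₁ < τ := by
    rcases eq_or_lt_of_le hτE.1.1 with h | h
    · exfalso
      have := hτE.2
      rw [← h] at this
      have h3 := lt_min i₁ i₂
      linarith
    · exact h
  have hτT : τ < T := hτE.1.2.trans_lt htT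
  have hbefore : ∀ s, t₁ ≤ s → s < τ → 0 < g₁ s ∧ 0 < g₂ s := by
    intro s hs hsτ
    by_contra h
    have : s ∈ E := ⟨⟨hs, hsτ.le.trans hτE.1.2⟩, by
      by_contra h'
      push Not at h'
      exact h ⟨(lt_min_iff.1 h').1, (lt_min_iff.1 h').2⟩⟩
    exact absurd (csInf_le hEb this) (not_le.2 hsτ)
  have hev : ∀ᶠ s in 𝓝[<] τ, 0 < g₁ s ∧ 0 < g₂ s := by
    filter_upwards [Ioo_mem_nhdsLT hτ1] with s hs using hbefore s hs.1.le hs.2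
  have n₁ : 0 ≤ g₁ τ := ge_of_tendsto
    ((h₁ τ hτ1.le hτT).continuousAt.tendsto.mono_left nhdsWithin_le_nhds)
    (hev.mono fun s hs => hs.1.le)
  have n₂ : 0 ≤ g₂ τ := ge_of_tendsto
    ((h₂ τ hτ1.le hτT).continuousAt.tendsto.mono_left nhdsWithin_le_nhds)
    (hev.mono fun s hs => hs.2.le)
  rcases min_le_iff.1 hτE.2 with h | h
  · have e : g₁ τ = 0 := le_antisymm h n₁
    obtain ⟨s, hs1, hs2⟩ := ((neg_before_zero (h₁ τ hτ1.le hτT) e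
      (b₁ τ hτ1.le hτT e n₂)).and hev).exists
    linarith [hs2.1]
  · have e : g₂ τ = 0 := le_antisymm h n₂
    obtain ⟨s, hs1, hs2⟩ := ((neg_before_zero (h₂ τ hτ1.le hτT) e
      (b₂ τ hτ1.le hτT e n₁)).and hev).exists
    linarith [hs2.2]

lemma barrier {g d : ℝ → ℝ} {t₁ T : ℝ}
    (h : ∀ t, t₁ ≤ t → t < T → HasDerivAt g (d t) t) (i : 0 < g t₁)
    (b : ∀ t, t₁ ≤ t → t < T → g t = 0 → 0 < d t) :
    ∀ t, t₁ ≤ t → t < T → 0 < g t := by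
  intro t h1 h2
  exact (barrier2 (g₁ := g) (g₂ := fun _ => 1) (d₁ := d) (d₂ := fun _ => 0) h
    (fun t _ _ => hasDerivAt_const t 1) i one_pos (fun t a b' c _ => b t a b' c)
    (fun t _ _ e => absurd e one_ne_zero) t h1 h2).1

/-- monotonicity on an interval from the derivative sign -/
lemma mono_of_deriv {g d : ℝ → ℝ} {a b : ℝ} (hab : a ≤ b)
    (h : ∀ t, a ≤ t → t ≤ b → HasDerivAt g (d t) t)
    (hd : ∀ t, a ≤ t → t ≤ b → 0 ≤ d t) : g a ≤ g b := by
  have : MonotoneOn g (Icc a b) := by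
    refine monotoneOn_of_deriv_nonneg (convex_Icc a b)
      (fun t ht => (h t ht.1 ht.2).continuousAt.continuousWithinAt) ?_ ?_
    · intro t ht
      rw [interior_Icc] at ht
      exact (h t ht.1.le ht.2.le).differentiableAt.differentiableWithinAt
    · intro t ht
      rw [interior_Icc] at ht
      rw [(h t ht.1.le ht.2.le).deriv]
      exact hd t ht.1.le ht.2.le
  exact this (left_mem_Icc.2 hab) (right_mem_Icc.2 hab) hab

lemma anti_of_deriv {g d : ℝ → ℝ} {a b : ℝ} (hab : a ≤ b)
    (h : ∀ t, a ≤ t → t ≤ b → HasDerivAt g (d t) t)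
    (hd : ∀ t, a ≤ t → t ≤ b → d t ≤ 0) : g b ≤ g a := by
  have := mono_of_deriv (g := fun t => - g t) (d := fun t => - d t) hab
    (fun t h1 h2 => (h t h1 h2).neg) (fun t h1 h2 => by linarith [hd t h1 h2])
  simpa using this

noncomputable def psi (c β t : ℝ) : ℝ := c * Real.exp (-(t / β))

lemma psi_deriv (c β t : ℝ) : HasDerivAt (psi c β) (-(psi c β t / β)) t := by
  unfold psi
  have h : HasDerivAt (fun t : ℝ => -(t / β)) (-(1 / β)) t := ((hasDerivAt_id t).div_const β).neg
  have := (h.exp).const_mul c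
  refine this.congr_deriv ?_
  ring

lemma psi_pos {c β : ℝ} (hc : 0 < c) (t : ℝ) : 0 < psi c β t := by unfold psi; positivity
lemma psi_nonneg {c β : ℝ} (hc : 0 ≤ c) (t : ℝ) : 0 ≤ psi c β t := by unfold psi; positivity

lemma psi_anti {c β : ℝ} (hc : 0 ≤ c) (hβ : 0 < β) {s t : ℝ} (h : s ≤ t) :
    psi c β t ≤ psi c β s := by
  unfold psi
  gcongr

/-- The normalized three dimensional system. -/
structure Traj (m a b β θ κ c T : ℝ) (x Y : ℝ → ℝ) : Prop where
  xpos : ∀ t, t < T → 0 < x t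
  dx : ∀ t, t < T → HasDerivAt x (-((m - 1) / m * Y t)) t
  dY : ∀ t, t < T → HasDerivAt Y ((Y t ^ 2 - (psi c β t + a * m * x t) * Y t
      + m * (b * x t ^ 2 + κ * x t ^ θ)) / (m * x t)) t

/-- standing assumptions on the constants -/
structure Par (m a b β θ : ℝ) : Prop where
  hm : 1 < m
  ha : 0 < a
  hb : 1 ≤ b
  hβ : 1 ≤ β
  hθ0 : 0 ≤ θ
  hθ1 : θ < 1

lemma Traj.mono {m a b β θ κ c T T' : ℝ} {x Y : ℝ → ℝ} (h : Traj m a b β θ κ c T x Y)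
    (hT : T' ≤ T) : Traj m a b β θ κ c T' x Y :=
  ⟨fun t ht => h.xpos t (ht.trans_le hT), fun t ht => h.dx t (ht.trans_le hT),
    fun t ht => h.dY t (ht.trans_le hT)⟩

section
variable {m a b β θ κ c T : ℝ} {x Y : ℝ → ℝ}

lemma Traj.dy (P : Par m a b β θ) (h : Traj m a b β θ κ c T x Y) (t : ℝ) (ht : t < T) :
    HasDerivAt (fun t => Y t / x t) ((Y t / x t) ^ 2 - (psi c β t / (m * x t) + a) * (Y t / x t)
      + b + κ * x t ^ θ / x t ^ 2) t := by
  have hx := h.xpos t ht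
  have hm : 0 < m := by linarith [P.hm]
  have := (h.dY t ht).div (h.dx t ht) hx.ne'
  refine this.congr_deriv ?_
  field_simp
  ring

/-- `Y` is positive along trajectories defined down to `-∞`. -/
lemma Traj.Ypos (P : Par m a b β θ) (hc : 0 ≤ c) (hκ : 0 ≤ κ) (h : Traj m a b β θ κ c T x Y)
    (t : ℝ) (ht : t < T) : 0 < Y t := by
  have hm : 0 < m := by linarith [P.hm]
  by_contra hcon
  push Not at hcon
  have hneg : ∀ s, s ≤ t → Y s ≤ 0 := by
    intro s hs
    by_contra hs'
    push Not at hs'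
    have := barrier (g := Y) (t₁ := s) (T := T) (fun r _ hr => h.dY r hr) hs' (by
      intro r _ hr e
      have hx := h.xpos r hr
      have := Real.rpow_pos_of_pos hx θ
      have hb := P.hb
      rw [e]
      have : 0 < b * x r ^ 2 := by positivity
      have : 0 ≤ κ * x r ^ θ := by positivity
      apply div_pos _ (by positivity)
      nlinarith) t hs ht
    linarith
  have key : ∀ s, s ≤ t → arctan (Y s / x s) - s ≤ arctan (Y t / x t) - t := by
    intro s hs
    have hd := fun r (h1 : s ≤ r) (h2 : r ≤ t) => ((h.dy P r (h2.trans_lt ht)).arctan).sub (hasDerivAt_id r)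
    refine mono_of_deriv (g := fun s => arctan (Y s / x s) - s) hs hd ?_
    intro r h1 h2
    have hx := h.xpos r (h2.trans_lt ht)
    have hY := hneg r h2
    have hy : Y r / x r ≤ 0 := div_nonpos_of_nonpos_of_nonneg hY hx.le
    have h3 : 0 ≤ κ * x r ^ θ / x r ^ 2 := by
      have := Real.rpow_pos_of_pos hx θ
      positivity
    have h4 : 0 ≤ psi c β r / (m * x r) + a := by
      have := psi_nonneg (β := β) hc r
      have := P.ha
      positivity
    have hb := P.hb
    rw [sub_nonneg, one_div, inv_mul_eq_div, le_div_iff₀ (by positivity)]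
    nlinarith
  have h1 := key (t - 4) (by linarith)
  have h2 := Real.neg_pi_div_two_lt_arctan (Y (t-4) / x (t-4))
  have h3 := Real.arctan_lt_pi_div_two (Y t / x t)
  have h4 := Real.pi_lt_four
  linarith

lemma Traj.x_anti (P : Par m a b β θ) (hc : 0 ≤ c) (hκ : 0 ≤ κ) (h : Traj m a b β θ κ c T x Y)
    {s t : ℝ} (hst : s ≤ t) (ht : t < T) : x t ≤ x s := by
  refine anti_of_deriv hst (fun r _ h2 => h.dx r (h2.trans_lt ht)) ?_
  intro r _ h2
  have := h.Ypos P hc hκ r (h2.trans_lt ht)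
  have hm := P.hm
  have : 0 < (m - 1) / m * Y r := by
    apply mul_pos (div_pos _ _) this <;> linarith
  linarith

/-- The function `W = ψ + a x - Y` stays negative once it is nonpositive. -/
lemma Traj.W_neg (P : Par m a b β θ) (hc : 0 ≤ c) (hκ : 0 ≤ κ) (h : Traj m a b β θ κ c T x Y)
    {t₁ : ℝ} (h1 : psi c β t₁ + a * x t₁ - Y t₁ < 0) :
    ∀ t, t₁ ≤ t → t < T → psi c β t + a * x t - Y t < 0 := by
  intro t ht htT
  have hm := P.hm
  have hb := P.hb
  have hβ := P.hβ
  have := barrier (g := fun t => Y t - (psi c β t + a * x t)) (t₁ := t₁) (T := T)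
    (fun r _ hr => (h.dY r hr).sub ((psi_deriv c β r).add ((h.dx r hr).const_mul a)))
    (by linarith) (by
      intro r _ hr e
      have hx := h.xpos r hr
      have hp := psi_nonneg (β := β) hc r
      have eY : Y r = psi c β r + a * x r := by linarith
      have hr := Real.rpow_pos_of_pos hx θ
      have e2 : (Y r ^ 2 - (psi c β r + a * m * x r) * Y r + m * (b * x r ^ 2 + κ * x r ^ θ)) / (m * x r)
        - (-(psi c β r / β) + a * -((m - 1) / m * Y r))
        = psi c β r / β + b * x r + κ * x r ^ θ / x r := by
        rw [eY]
        field_simp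
        ring
      rw [e2]
      positivity) t ht htT
  linarith

end
end SSP

namespace SSP

/-- smallness of `δ`, largeness of `β` -/
structure Small (m a b β θ δ : ℝ) : Prop extends Par m a b β θ where
  hδ0 : 0 < δ
  hδ1 : δ ≤ 1
  hδa : a * m * δ ≤ 1 / 4
  hδm : m * δ ≤ 1 / 4
  hδb : 16 * m * b * δ ^ 2 ≤ 1
  hβδ : 2 < β * (m - 1) * δ
  hβθ : 256 * m < β * ((m - 1) * (1 - θ))

noncomputable def GG (θ x : ℝ) : ℝ := x ^ (1 - θ) / (1 + x ^ (1 - θ))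

noncomputable def SS (m β θ c : ℝ) (x t : ℝ) : ℝ :=
  1 / psi c β t + 8 / ((m - 1) * (1 - θ)) / β * GG θ x

lemma GG_nonneg {θ x : ℝ} (hx : 0 ≤ x) : 0 ≤ GG θ x := by unfold GG; positivity
lemma GG_le_one {θ x : ℝ} (hx : 0 ≤ x) : GG θ x ≤ 1 := by
  unfold GG
  rw [div_le_one (by positivity)]
  linarith

lemma GG_deriv {θ x : ℝ} (hx : 0 < x) :
    HasDerivAt (GG θ) ((1 - θ) * x ^ (-θ) / (1 + x ^ (1 - θ)) ^ 2) x := by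
  unfold GG
  have h := Real.hasDerivAt_rpow_const (x := x) (p := 1 - θ) (Or.inl hx.ne')
  have h2 := h.div (h.const_add 1) (by positivity)
  refine h2.congr_deriv ?_
  have : (1 - θ - 1) = -θ := by ring
  rw [this]
  ring

lemma GG_deriv_lower {θ b x : ℝ} (hx : 0 < x) (hb : 1 ≤ b) (h0 : 0 ≤ θ) (h1 : θ < 1) :
    (1 - θ) / 4 ≤ (1 - θ) * x ^ (-θ) / (1 + x ^ (1 - θ)) ^ 2 * (b * x ^ 2 + 1 * x ^ θ) := by
  have e1 : x ^ (-θ) * x ^ θ = 1 := by rw [← Real.rpow_add hx]; simp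
  have e2 : x ^ (-θ) * x ^ 2 = x ^ (2 - θ) := by
    rw [← Real.rpow_natCast x 2, ← Real.rpow_add hx]; congr 1; push_cast; ring
  have e3 : (x ^ (1 - θ)) ^ 2 = x ^ (2 - 2 * θ) := by
    rw [← Real.rpow_natCast, ← Real.rpow_mul hx.le]; congr 1; push_cast; ring
  have e4 : x ^ (2 - 2 * θ) ≤ 1 + x ^ (2 - θ) := by
    rcases le_total x 1 with h | h
    · have := Real.rpow_le_one hx.le h (z := 2 - 2 * θ) (by linarith)
      have := Real.rpow_pos_of_pos hx (2 - θ)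
      linarith
    · have := Real.rpow_le_rpow_of_exponent_le h (show 2 - 2 * θ ≤ 2 - θ by linarith)
      linarith
  have hz := Real.rpow_pos_of_pos hx (1 - θ)
  have hw := Real.rpow_pos_of_pos hx (2 - θ)
  have key : (1 + x ^ (1 - θ)) ^ 2 ≤ 4 * (b * x ^ (2 - θ) + 1) := by
    nlinarith [sq_nonneg (1 - x ^ (1 - θ))]
  have e5 : (1 - θ) * x ^ (-θ) / (1 + x ^ (1 - θ)) ^ 2 * (b * x ^ 2 + 1 * x ^ θ)
     = (1 - θ) * (b * x ^ (2 - θ) + 1) / (1 + x ^ (1 - θ)) ^ 2 := by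
    have e6 : x ^ (-θ) * (b * x ^ 2 + 1 * x ^ θ) = b * x ^ (2 - θ) + 1 := by
      rw [← e2]; linear_combination e1
    rw [div_mul_eq_mul_div, mul_assoc, e6]
  rw [e5, div_le_div_iff₀ (by norm_num) (by positivity)]
  have : 0 < 1 - θ := by linarith
  nlinarith

section
variable {m a b β θ c T δ : ℝ} {x Y : ℝ → ℝ}

/-- Lower region is forward invariant. -/
lemma Traj.lower (P : Small m a b β θ δ) (hc : 0 < c) (h : Traj m a b β θ 1 c T x Y) {t₁ : ℝ}
    (h1 : x t₁ < δ * psi c β t₁)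
    (h2 : m * (b * x t₁ ^ 2 + 1 * x t₁ ^ θ) < 2 * (psi c β t₁ * Y t₁)) :
    ∀ t, t₁ ≤ t → t < T → x t < δ * psi c β t ∧
      m * (b * x t ^ 2 + 1 * x t ^ θ) < 2 * (psi c β t * Y t) := by
  have hm := P.hm
  have hb := P.hb
  have hβ := P.hβ
  have hδ := P.hδ0
  have hθ := P.hθ0
  intro t ht htT
  have := barrier2 (g₁ := fun t => δ * psi c β t - x t)
    (g₂ := fun t => 2 * (psi c β t * Y t) - m * (b * x t ^ 2 + 1 * x t ^ θ)) (t₁ := t₁) (T := T)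
    (fun r _ hr => ((psi_deriv c β r).const_mul δ).sub (h.dx r hr))
    (fun r _ hr => (((psi_deriv c β r).mul (h.dY r hr)).const_mul 2).sub
      (((((h.dx r hr).pow 2).const_mul b).add
        (((h.dx r hr).rpow_const (p := θ) (Or.inl (h.xpos r hr).ne')).const_mul 1)).const_mul m))
    (by linarith) (by linarith) ?_ ?_ t ht htT
  · exact ⟨by linarith [this.1], by linarith [this.2]⟩
  · intro r _ hr e1 e2
    have hx := h.xpos r hr
    have hp := psi_pos (β := β) hc r
    have hxθ := Real.rpow_pos_of_pos hx θ
    have ex : x r = δ * psi c β r := by linarith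
    -- Y ≥ m b δ x / 2
    have hY : m * b * (δ * x r) ≤ 2 * Y r := by
      have : m * (b * x r ^ 2) ≤ 2 * (psi c β r * Y r) := by nlinarith
      have h3 : (m * b * (δ * x r)) * psi c β r ≤ (2 * Y r) * psi c β r := by
        calc (m * b * (δ * x r)) * psi c β r = m * (b * x r ^ 2) := by rw [ex]; ring
          _ ≤ _ := by linarith
      exact le_of_mul_le_mul_right h3 hp
    have h4 : (m - 1) / m * Y r ≥ (m - 1) * b * δ * x r / 2 := by
      rw [ge_iff_le, div_mul_eq_mul_div, le_div_iff₀ (by linarith)]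
      nlinarith
    have h5 : δ * (psi c β r / β) = x r / β := by rw [ex]; ring
    have h6 : x r / β < (m - 1) * b * δ * x r / 2 := by
      rw [div_lt_div_iff₀ (by linarith) (by norm_num)]
      have := P.hβδ
      have h7 : x r * 2 < x r * (β * (m - 1) * δ) := by nlinarith
      have h8 : x r * (β * (m - 1) * δ) * 1 ≤ x r * (β * (m - 1) * δ) * b := by gcongr
      nlinarith
    have : δ * -(psi c β r / β) = - (x r / β) := by rw [← h5]; ring
    rw [this]
    linarith
  · intro r _ hr e1 e2
    have hx := h.xpos r hr
    have hp := psi_pos (β := β) hc r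
    have hxθ := Real.rpow_pos_of_pos hx θ
    have hY := h.Ypos P.toPar hc.le zero_le_one r hr
    set R := m * (b * x r ^ 2 + 1 * x r ^ θ) with hR
    have hRpos : 0 < R := by positivity
    have eY : 2 * (psi c β r * Y r) = R := by linarith
    have hxp : x r ≤ δ * psi c β r := by linarith
    have hd : (2 * (-(psi c β r / β) * Y r + psi c β r *
        ((Y r ^ 2 - (psi c β r + a * m * x r) * Y r + m * (b * x r ^ 2 + 1 * x r ^ θ)) / (m * x r)))) -
        m * (b * (((2 : ℕ) : ℝ) * x r ^ (2 - 1) * -((m - 1) / m * Y r)) +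
          1 * (-((m - 1) / m * Y r) * θ * x r ^ (θ - 1)))
        = (2 * psi c β r / (m * x r)) * (Y r ^ 2 + R - psi c β r * Y r - a * m * x r * Y r
            - m * x r / β * Y r) +
        (m - 1) * Y r * (2 * b * x r + θ * x r ^ (θ - 1)) := by
      rw [← hR]
      field_simp
      push_cast
      ring
    refine lt_of_lt_of_eq ?_ hd.symm
    have h1 : 0 < Y r ^ 2 + R - psi c β r * Y r - a * m * x r * Y r - m * x r / β * Y r := by
      have i1 : a * m * x r * Y r ≤ R / 8 := by
        have : a * m * x r ≤ a * m * (δ * psi c β r) := by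
          have := P.ha
          gcongr
        have h3 : a * m * (δ * psi c β r) ≤ 1 / 4 * psi c β r := by
          rw [← mul_assoc]
          exact mul_le_mul_of_nonneg_right P.hδa hp.le
        calc a * m * x r * Y r ≤ 1 / 4 * psi c β r * Y r :=
              mul_le_mul_of_nonneg_right (this.trans h3) hY.le
          _ = R / 8 := by rw [← eY]; ring
      have i2 : m * x r / β * Y r ≤ R / 8 := by
        have h3 : m * x r / β ≤ m * x r := div_le_self (by positivity) hβ
        have h4 : m * x r ≤ 1 / 4 * psi c β r := by
          calc m * x r ≤ m * (δ * psi c β r) := by gcongr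
            _ = m * δ * psi c β r := by ring
            _ ≤ _ := mul_le_mul_of_nonneg_right P.hδm hp.le
        calc m * x r / β * Y r ≤ 1 / 4 * psi c β r * Y r :=
              mul_le_mul_of_nonneg_right (h3.trans h4) hY.le
          _ = R / 8 := by rw [← eY]; ring
      have := sq_nonneg (Y r)
      linarith
    have h2 : 0 ≤ 2 * b * x r + θ * x r ^ (θ - 1) := by
      have := Real.rpow_pos_of_pos hx (θ - 1)
      positivity
    have h3 : 0 < 2 * psi c β r / (m * x r) := by positivity
    have h4 : 0 ≤ (m - 1) * Y r := mul_nonneg (by linarith) hY.le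
    have := mul_pos h3 h1
    have := mul_nonneg h4 h2
    linarith

lemma SS_anti (P : Small m a b β θ δ) (hc : 0 < c) (h : Traj m a b β θ 1 c T x Y) {t₁ t₂ : ℝ}
    (h12 : t₁ ≤ t₂) (h2T : t₂ < T)
    (hl : ∀ t, t₁ ≤ t → t < T → m * (b * x t ^ 2 + 1 * x t ^ θ) < 2 * (psi c β t * Y t)) :
    SS m β θ c (x t₂) t₂ ≤ SS m β θ c (x t₁) t₁ := by
  have hm := P.hm
  have hb := P.hb
  have hβ := P.hβ
  have hθ0 := P.hθ0
  have hθ1 := P.hθ1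
  have hm1 : 0 < m - 1 := by linarith
  have ht1 : 0 < 1 - θ := by linarith
  unfold SS
  refine anti_of_deriv (g := fun t => 1 / psi c β t + 8 / ((m - 1) * (1 - θ)) / β * GG θ (x t)) h12
    (fun r h1 h2 => ((hasDerivAt_const r (1:ℝ)).div (psi_deriv c β r) (psi_pos hc r).ne').add
      (((GG_deriv (h.xpos r (h2.trans_lt h2T))).comp r (h.dx r (h2.trans_lt h2T))).const_mul _)) ?_
  intro r h1 h2
  have hr := h2.trans_lt h2T
  have hx := h.xpos r hr
  have hp := psi_pos (β := β) hc r
  have hlow := hl r h1 hr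
  have hG := GG_deriv_lower (b := b) hx hb hθ0 hθ1
  set D := (1 - θ) * x r ^ (-θ) / (1 + x r ^ (1 - θ)) ^ 2 with hD
  have hDpos : 0 ≤ D := by
    have := Real.rpow_pos_of_pos hx (-θ)
    positivity
  set Q := b * x r ^ 2 + 1 * x r ^ θ with hQ
  have hY := h.Ypos P.toPar hc.le zero_le_one r hr
  have h5 : D * (m * Q) ≤ D * (2 * (psi c β r * Y r)) := by gcongr
  have h6 : m * (1 - θ) / 4 ≤ 2 * D * psi c β r * Y r := by
    calc m * (1 - θ) / 4 = m * ((1 - θ) / 4) := by ring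
      _ ≤ m * (D * Q) := by gcongr
      _ ≤ _ := by linarith
  have e : (0 * psi c β r - 1 * -(psi c β r / β)) / psi c β r ^ 2 +
      8 / ((m - 1) * (1 - θ)) / β * (D * -((m - 1) / m * Y r))
      = (1 / (β * psi c β r)) * (1 - 8 * D * psi c β r * Y r / (m * (1 - θ))) := by
    field_simp
    ring
  rw [e]
  apply mul_nonpos_of_nonneg_of_nonpos (by positivity)
  rw [sub_nonpos, le_div_iff₀ (by positivity)]
  linarith

/-- trapping region: `Y < ψ / 2` is preserved -/
lemma Traj.upper (P : Small m a b β θ δ) (hc : 0 < c) (h : Traj m a b β θ 1 c T x Y) {t₁ : ℝ}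
    (ht₁ : t₁ < T)
    (h1 : x t₁ < δ * psi c β t₁)
    (h2 : m * (b * x t₁ ^ 2 + 1 * x t₁ ^ θ) < 2 * (psi c β t₁ * Y t₁))
    (h3 : 2 * Y t₁ < psi c β t₁)
    (h4 : 16 * m * SS m β θ c (x t₁) t₁ < 1 ∨ 16 * m * x t₁ ^ θ * SS m β θ c (x t₁) t₁ ^ 2 < 1) :
    ∀ t, t₁ ≤ t → t < T → 2 * Y t < psi c β t := by
  have hm := P.hm
  have hb := P.hb
  have hβ := P.hβ
  have hδ := P.hδ0
  have hθ0 := P.hθ0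
  have hθ1 := P.hθ1
  have hlow := h.lower P hc h1 h2
  have hm1 : 0 < m - 1 := by linarith
  have ht1 : 0 < 1 - θ := by linarith
  have hx16 : ∀ t, t₁ ≤ t → t < T → 16 * m * x t ^ θ < psi c β t ^ 2 := by
    intro t ht htT
    have hx := h.xpos t htT
    have hx1 := h.xpos t₁ ht₁
    have hp := psi_pos (β := β) hc t
    have hS := SS_anti P hc h ht htT (fun r h1 h2 => (hlow r h1 h2).2)
    have hG := GG_nonneg (θ := θ) hx.le
    have hSl : 1 / psi c β t ≤ SS m β θ c (x t) t := by
      unfold SS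
      have : 0 ≤ 8 / ((m - 1) * (1 - θ)) / β * GG θ (x t) := by positivity
      linarith
    have hle : 1 / psi c β t ≤ SS m β θ c (x t₁) t₁ := hSl.trans hS
    have hp' : 0 < 1 / psi c β t := by positivity
    rcases h4 with h4 | h4
    · have i1 : 16 * m * (1 / psi c β t) < 1 := by
        refine lt_of_le_of_lt ?_ h4
        gcongr
      have i2 : 16 * m < psi c β t := by
        rwa [mul_one_div, div_lt_one hp] at i1
      have i3 : 1 ≤ psi c β t := by linarith
      have i4 : x t ≤ psi c β t := by
        have := (hlow t ht htT).1
        have := P.hδ1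
        nlinarith
      have i5 : x t ^ θ ≤ psi c β t := by
        calc x t ^ θ ≤ psi c β t ^ θ := Real.rpow_le_rpow hx.le i4 hθ0
          _ ≤ psi c β t ^ (1:ℝ) := Real.rpow_le_rpow_of_exponent_le i3 hθ1.le
          _ = _ := Real.rpow_one _
      calc 16 * m * x t ^ θ ≤ 16 * m * psi c β t := by gcongr
        _ < psi c β t * psi c β t := by gcongr
        _ = _ := by ring
    · have i1 : 16 * m * x t ^ θ * (1 / psi c β t) ^ 2 < 1 := by
        refine lt_of_le_of_lt ?_ h4
        have hxx := h.x_anti P.toPar hc.le zero_le_one ht htT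
        have hxx2 : x t ^ θ ≤ x t₁ ^ θ := Real.rpow_le_rpow hx.le hxx hθ0
        gcongr
      rw [div_pow, one_pow, mul_one_div, div_lt_one (by positivity)] at i1
      exact i1
  intro t ht htT
  have := barrier (g := fun t => psi c β t - 2 * Y t) (t₁ := t₁) (T := T)
    (fun r _ hr => (psi_deriv c β r).sub ((h.dY r hr).const_mul 2)) (by linarith) ?_ t ht htT
  · linarith
  · intro r hr1 hr e
    have hx := h.xpos r hr
    have hp := psi_pos (β := β) hc r
    have eY : Y r = psi c β r / 2 := by linarith
    have h16 := hx16 r hr1 hr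
    have hxd := (hlow r hr1 hr).1
    have e2 : -(psi c β r / β) - 2 * ((Y r ^ 2 - (psi c β r + a * m * x r) * Y r +
        m * (b * x r ^ 2 + 1 * x r ^ θ)) / (m * x r))
        = (2 / (m * x r)) * (psi c β r ^ 2 / 4 + a * m * x r * psi c β r / 2 - m * b * x r ^ 2
          - m * x r ^ θ - m * x r * psi c β r / (2 * β)) := by
      rw [eY]
      field_simp
      ring
    rw [e2]
    apply mul_pos (by positivity)
    have j1 : m * b * x r ^ 2 ≤ psi c β r ^ 2 / 16 := by
      have : x r ^ 2 ≤ (δ * psi c β r) ^ 2 := by gcongr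
      calc m * b * x r ^ 2 ≤ m * b * (δ * psi c β r) ^ 2 := by gcongr
        _ = (16 * m * b * δ ^ 2) * psi c β r ^ 2 / 16 := by ring
        _ ≤ 1 * psi c β r ^ 2 / 16 := by
          have := P.hδb
          gcongr
        _ = _ := by ring
    have j2 : m * x r * psi c β r / (2 * β) ≤ psi c β r ^ 2 / 8 := by
      have k1 : m * x r * psi c β r / (2 * β) ≤ m * x r * psi c β r / 2 := by
        apply div_le_div_of_nonneg_left (by positivity) (by norm_num) (by linarith)
      have k2 : m * x r ≤ 1 / 4 * psi c β r := by
        have := P.hδm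
        nlinarith
      nlinarith
    have j3 : 0 ≤ a * m * x r * psi c β r / 2 := by
      have := P.ha
      positivity
    linarith

lemma psi_atBot {c β : ℝ} (hc : 0 < c) (hβ : 0 < β) : Tendsto (psi c β) atBot atTop := by
  unfold psi
  apply Tendsto.const_mul_atTop hc
  apply Real.tendsto_exp_atTop.comp
  apply tendsto_neg_atBot_atTop.comp
  exact tendsto_id.atBot_div_const hβ

/-- a trajectory which starts with `x < δ ψ` near `-∞` is trapped -/
lemma Traj.trapped (P : Small m a b β θ δ) (hc : 0 < c) (h : Traj m a b β θ 1 c T x Y) {t₀ : ℝ}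
    (ht₀ : t₀ < T) (h1 : ∀ t, t ≤ t₀ → x t < δ * psi c β t) :
    ∃ t₁, t₁ < T ∧ ∀ t, t₁ ≤ t → t < T → 2 * Y t < psi c β t := by
  have hm := P.hm
  have hb := P.hb
  have hβ := P.hβ
  have hδ := P.hδ0
  have ha := P.ha
  have hm1 : 0 < m - 1 := by linarith
  have ht1 : 0 < 1 - θ := by linarith [P.hθ1]
  have hY := h.Ypos P.toPar hc.le zero_le_one
  -- step a
  have ha : ∀ t, t < T → m * (b * x t ^ 2 + 1 * x t ^ θ) < 2 * (psi c β t * Y t) := by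
    intro t htT
    have : ∃ t₂, t₂ ≤ min t t₀ ∧ m * (b * x t₂ ^ 2 + 1 * x t₂ ^ θ) < 2 * (psi c β t₂ * Y t₂) := by
      by_contra hcon
      push Not at hcon
      set t₃ := min t t₀ with ht3
      have hT3 : t₃ < T := (min_le_left _ _).trans_lt htT
      have key : ∀ s, s ≤ t₃ → Y s / x s - 1 / 4 * s ≤ Y t₃ / x t₃ - 1 / 4 * t₃ := by
        intro s hs
        refine mono_of_deriv (g := fun s => Y s / x s - 1 / 4 * s) hs
          (fun r _ h2 => (h.dy P.toPar r (h2.trans_lt hT3)).sub ((hasDerivAt_id r).const_mul (1/4))) ?_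
        intro r _ h2
        have hr := h2.trans_lt hT3
        have hx := h.xpos r hr
        have hp := psi_pos (β := β) hc r
        have hxθ := Real.rpow_pos_of_pos hx θ
        have hYr := hY r hr
        have hlow := hcon r h2
        have hxd := h1 r (h2.trans (min_le_right _ _))
        set Q := b * x r ^ 2 + 1 * x r ^ θ with hQ
        have e : (Y r / x r) ^ 2 - (psi c β r / (m * x r) + a) * (Y r / x r) + b +
            1 * x r ^ θ / x r ^ 2 - 1 / 4 * 1 =
            (Y r / x r) ^ 2 + (m * Q - psi c β r * Y r - a * m * x r * Y r) / (m * x r ^ 2) - 1 / 4 := by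
          rw [hQ]
          field_simp
          ring
        rw [e]
        have i1 : a * m * x r * Y r ≤ m * Q / 8 := by
          have i2 : a * m * x r ≤ 1 / 4 * psi c β r := by
            have := P.hδa
            calc a * m * x r ≤ a * m * (δ * psi c β r) := by gcongr
              _ = a * m * δ * psi c β r := by ring
              _ ≤ _ := by gcongr
          calc a * m * x r * Y r ≤ 1 / 4 * psi c β r * Y r := by gcongr
            _ ≤ _ := by linarith
        have i3 : m * Q * (3 / 8) ≤ m * Q - psi c β r * Y r - a * m * x r * Y r := by linarith
        have i4 : (3 / 8 : ℝ) ≤ (m * Q - psi c β r * Y r - a * m * x r * Y r) / (m * x r ^ 2) := by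
          rw [le_div_iff₀ (by positivity)]
          have : m * x r ^ 2 ≤ m * Q := by
            have : x r ^ 2 ≤ Q := by rw [hQ]; nlinarith [sq_nonneg (x r)]
            gcongr
          linarith
        nlinarith [sq_nonneg (Y r / x r)]
      have hk := key (t₃ - 4 * (Y t₃ / x t₃) - 1) (by
        have := div_pos (hY t₃ hT3) (h.xpos t₃ hT3)
        linarith)
      have hlt : t₃ - 4 * (Y t₃ / x t₃) - 1 < T := by
        have := div_pos (hY t₃ hT3) (h.xpos t₃ hT3)
        linarith
      have := div_pos (hY _ hlt) (h.xpos _ hlt)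
      linarith
    obtain ⟨t₂, ht2, hl⟩ := this
    exact (h.lower P hc (h1 t₂ (ht2.trans (min_le_right _ _))) hl t (ht2.trans (min_le_left _ _)) htT).2
  -- step S
  have hlarge : ∀ᶠ t in atBot, 32 * m < psi c β t :=
    (psi_atBot hc (by linarith)).eventually_gt_atTop _
  obtain ⟨t₂, ht2⟩ := eventually_atBot.1 hlarge
  set t₃ := min t₂ t₀ with ht3
  have hT3 : t₃ < T := (min_le_right _ _).trans_lt ht₀
  have hex : ∃ t, t ≤ t₃ ∧ 2 * Y t < psi c β t := by
    by_contra hcon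
    push Not at hcon
    set k := 2 * (m - 1) with hk
    have key : ∀ s, s ≤ t₃ → Real.log (x t₃) + k * t₃ ≤ Real.log (x s) + k * s := by
      intro s hs
      refine anti_of_deriv (g := fun s => Real.log (x s) + k * s) hs
        (fun r _ h2 => ((h.dx r (h2.trans_lt hT3)).log (h.xpos r (h2.trans_lt hT3)).ne').add
          ((hasDerivAt_id r).const_mul k)) ?_
      intro r _ h2
      have hr := h2.trans_lt hT3
      have hx := h.xpos r hr
      have hxd := h1 r (h2.trans (min_le_right _ _))
      have hy := hcon r h2
      have i1 : k * x r ≤ (m - 1) / m * Y r := by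
        have hd : m * x r ≤ 1 / 4 * psi c β r := by
          have := P.hδm
          have := psi_pos (β := β) hc r
          nlinarith
        rw [div_mul_eq_mul_div, le_div_iff₀ (by linarith), hk]
        nlinarith
      have : -((m - 1) / m * Y r) / x r + k * 1 = (k * x r - (m - 1) / m * Y r) / x r := by
        field_simp
        ring
      rw [this]
      exact div_nonpos_of_nonpos_of_nonneg (by linarith) hx.le
    have hup : ∀ s, s ≤ t₃ → Real.log (x s) ≤ Real.log (δ * c) - s / β := by
      intro s hs
      have hx := h.xpos s (hs.trans_lt hT3)
      have := Real.log_le_log hx (h1 s (hs.trans (min_le_right _ _))).le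
      refine this.trans (le_of_eq ?_)
      unfold psi
      rw [← mul_assoc, Real.log_mul (by positivity) (by positivity), Real.log_exp]
      ring
    have hkβ : 0 < k - 1 / β := by
      have := P.hβδ
      have h5 : β * (m - 1) * δ ≤ β * (m - 1) * 1 := by
        have := P.hδ1
        gcongr
      rw [sub_pos, div_lt_iff₀ (by linarith)]
      nlinarith
    have hall : ∀ s, s ≤ t₃ → Real.log (x t₃) + k * t₃ - Real.log (δ * c) ≤ (k - 1 / β) * s := by
      intro s hs
      have := key s hs
      have := hup s hs
      have : s / β = 1 / β * s := by ring
      nlinarith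
    have htend : Tendsto (fun s => (k - 1 / β) * s) atBot atBot :=
      Tendsto.const_mul_atBot hkβ tendsto_id
    obtain ⟨s, hs1, hs2⟩ := ((htend.eventually_lt_atBot
      (Real.log (x t₃) + k * t₃ - Real.log (δ * c))).and (eventually_le_atBot t₃)).exists
    linarith [hall s hs2]
  obtain ⟨t, ht, hty⟩ := hex
  have htT := ht.trans_lt hT3
  refine ⟨t, htT, h.upper P hc htT (h1 t (ht.trans (min_le_right _ _))) (ha t htT) hty (Or.inl ?_)⟩
  have hp := ht2 t (ht.trans (min_le_left _ _))
  have hp0 := psi_pos (β := β) hc t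
  have hG := GG_le_one (θ := θ) (h.xpos t htT).le
  unfold SS
  have i1 : 1 / psi c β t < 1 / (32 * m) := by
    apply one_div_lt_one_div_of_lt _ hp
    linarith
  have i2 : 8 / ((m - 1) * (1 - θ)) / β * GG θ (x t) ≤ 1 / (32 * m) := by
    calc 8 / ((m - 1) * (1 - θ)) / β * GG θ (x t) ≤ 8 / ((m - 1) * (1 - θ)) / β * 1 := by gcongr
      _ = 8 / (β * ((m - 1) * (1 - θ))) := by field_simp
      _ ≤ 8 / (256 * m) := by
        have := P.hβθ
        gcongr
      _ = _ := by field_simp; norm_num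
  have i3 : 16 * m * (1 / (32 * m) + 1 / (32 * m)) = 1 := by field_simp; norm_num
  refine lt_of_lt_of_eq ?_ i3
  exact mul_lt_mul_of_pos_left (by linarith) (by linarith)

end
end SSP

namespace SSP

/-- convergence of a fast variable -/
lemma conv_fast {g R x Y q : ℝ → ℝ} {t₁ T m M A B : ℝ} (hT : t₁ < T) (hm : 1 < m)
    (xpos : ∀ t, t₁ ≤ t → t < T → 0 < x t)
    (dx : ∀ t, t₁ ≤ t → t < T → HasDerivAt x (-((m - 1) / m * Y t)) t)
    (Ypos : ∀ t, t₁ ≤ t → t < T → 0 < Y t)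
    (YM : ∀ t, t₁ ≤ t → t < T → Y t ≤ M)
    (hx0 : Tendsto x (𝓝[<] T) (𝓝 0))
    (hg : ∀ t, t₁ ≤ t → t < T → HasDerivAt g (R t / (m * x t)) t)
    (hR : Tendsto (fun t => R t - q (g t)) (𝓝[<] T) (𝓝 0))
    (hq : Continuous q) (hfin : {v | q v = 0}.Finite)
    (hA : ∀ t, t₁ ≤ t → t < T → A ≤ g t) (hB : ∀ t, t₁ ≤ t → t < T → g t ≤ B) :
    ∃ l, Tendsto g (𝓝[<] T) (𝓝 l) ∧ q l = 0 := by
  have hM : 0 < M := (Ypos t₁ le_rfl hT).trans_le (YM t₁ le_rfl hT)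
  have late : ∀ {P : ℝ → Prop}, (∀ᶠ t in 𝓝[<] T, P t) → ∃ s, t₁ ≤ s ∧ s < T ∧ ∀ t, s ≤ t → t < T → P t := by
    intro P hP
    obtain ⟨l, hl, hlP⟩ := (mem_nhdsLT_iff_exists_Ioo_subset' hT).1 hP
    have hlT : l < T := hl
    refine ⟨max t₁ ((l + T) / 2), le_max_left _ _, max_lt hT (by linarith), fun t h1 h2 => ?_⟩
    have := (le_max_right t₁ ((l + T) / 2)).trans h1
    exact hlP ⟨by linarith, h2⟩
  have hs : Dense {v | q v ≠ 0} := by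
    have := hfin.countable.dense_compl ℝ
    exact this
  have hconv : ∃ l, Tendsto g (𝓝[<] T) (𝓝 l) := by
    have hevA : ∀ᶠ t in 𝓝[<] T, A ≤ g t := by
      filter_upwards [Ico_mem_nhdsLT hT] with t ht using hA t ht.1 ht.2
    have hevB : ∀ᶠ t in 𝓝[<] T, g t ≤ B := by
      filter_upwards [Ico_mem_nhdsLT hT] with t ht using hB t ht.1 ht.2
    refine tendsto_of_no_upcrossings hs ?_ ⟨B, by simpa using hevB⟩ ⟨A, by simpa using hevA⟩
    intro a ha b hb hab ⟨f1, f2⟩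
    have ha' : q a ≠ 0 := ha
    have hev : ∀ᶠ t in 𝓝[<] T, |R t - q (g t)| < |q a| := by
      have := hR.abs
      rw [abs_zero] at this
      exact this.eventually (gt_mem_nhds (abs_pos.2 ha'))
    obtain ⟨s, hs1, hsT, hsP⟩ := late hev
    have hmemIco : ∀ᶠ t in 𝓝[<] T, t ∈ Ico s T := Ico_mem_nhdsLT hsT
    rcases lt_or_gt_of_ne ha' with h | h
    · obtain ⟨t, ht1, ht2⟩ := (f1.and_eventually hmemIco).exists
      have hbar := barrier (g := fun t => a - g t) (t₁ := t) (T := T)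
        (fun r h1 h2 => (hasDerivAt_const r a).sub (hg r (hs1.trans (ht2.1.trans h1)) h2)) (by linarith) (by
          intro r h1 h2 e
          have e' : g r = a := by linarith
          have h3 := hsP r (ht2.1.trans h1) h2
          rw [e', abs_of_neg h] at h3
          have h4 := (abs_lt.1 h3).2
          have hx := xpos r (hs1.trans (ht2.1.trans h1)) h2
          have : R r / (m * x r) < 0 := div_neg_of_neg_of_pos (by linarith) (by positivity)
          linarith)
      obtain ⟨t', h1, h2⟩ := (f2.and_eventually (Ico_mem_nhdsLT ht2.2)).exists
      have := hbar t' h2.1 h2.2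
      linarith
    · obtain ⟨t, ht1, ht2⟩ := (f2.and_eventually hmemIco).exists
      have hbar := barrier (g := fun t => g t - a) (t₁ := t) (T := T)
        (fun r h1 h2 => (hg r (hs1.trans (ht2.1.trans h1)) h2).sub (hasDerivAt_const r a)) (by linarith) (by
          intro r h1 h2 e
          have e' : g r = a := by linarith
          have h3 := hsP r (ht2.1.trans h1) h2
          rw [e', abs_of_pos h] at h3
          have h4 := (abs_lt.1 h3).1
          have hx := xpos r (hs1.trans (ht2.1.trans h1)) h2
          have : 0 < R r / (m * x r) := div_pos (by linarith) (by positivity)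
          linarith)
      obtain ⟨t', h1, h2⟩ := (f1.and_eventually (Ico_mem_nhdsLT ht2.2)).exists
      have := hbar t' h2.1 h2.2
      linarith
  obtain ⟨l, hl⟩ := hconv
  refine ⟨l, hl, ?_⟩
  by_contra hql
  have hRl : Tendsto R (𝓝[<] T) (𝓝 (q l)) := by
    have h1 : Tendsto (fun t => q (g t)) (𝓝[<] T) (𝓝 (q l)) := (hq.tendsto l).comp hl
    have := hR.add h1
    simpa using this
  have hlog : Tendsto (fun t => Real.log (x t)) (𝓝[<] T) atBot := by
    refine Real.tendsto_log_nhdsGT_zero.comp ?_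
    refine tendsto_nhdsWithin_iff.2 ⟨hx0, ?_⟩
    filter_upwards [Ico_mem_nhdsLT hT] with t ht using xpos t ht.1 ht.2
  rcases lt_or_gt_of_ne hql with h | h
  · obtain ⟨s, hs1, hsT, hsP⟩ := late (hRl.eventually (gt_mem_nhds (show q l < q l / 2 by linarith)))
    set k := (-(q l) / 2) / ((m - 1) * M) with hk
    have hm1 : 0 < m - 1 := by linarith
    have hk0 : 0 < k := by rw [hk]; apply div_pos (by linarith) (by positivity)
    have key : ∀ t, s ≤ t → t < T → g t - k * Real.log (x t) ≤ g s - k * Real.log (x s) := by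
      intro t h1 h2
      refine anti_of_deriv (g := fun t => g t - k * Real.log (x t)) h1 (fun r h3 h4 =>
        (hg r (hs1.trans h3) (h4.trans_lt h2)).sub (((dx r (hs1.trans h3) (h4.trans_lt h2)).log
          (xpos r (hs1.trans h3) (h4.trans_lt h2)).ne').const_mul k)) ?_
      intro r h3 h4
      have hr1 := hs1.trans h3
      have hr2 := h4.trans_lt h2
      have hx := xpos r hr1 hr2
      have hRr := hsP r h3 hr2
      have hY := YM r hr1 hr2
      have e : R r / (m * x r) - k * (-((m - 1) / m * Y r) / x r)
        = (R r + (-(q l) / 2) * (Y r / M)) / (m * x r) := by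
        rw [hk]; field_simp
        ring
      rw [e]
      apply div_nonpos_of_nonpos_of_nonneg _ (by positivity)
      have : Y r / M ≤ 1 := (div_le_one hM).2 hY
      have : (-(q l) / 2) * (Y r / M) ≤ (-(q l) / 2) * 1 := by
        apply mul_le_mul_of_nonneg_left this; linarith
      linarith
    have hbd : ∀ t, s ≤ t → t < T → (A - (g s - k * Real.log (x s))) / k ≤ Real.log (x t) := by
      intro t h1 h2
      rw [div_le_iff₀ hk0]
      have := key t h1 h2
      have := hA t (hs1.trans h1) h2
      linarith
    obtain ⟨t, h1, h2⟩ := ((hlog.eventually_lt_atBot ((A - (g s - k * Real.log (x s))) / k)).and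
      (Ico_mem_nhdsLT hsT)).exists
    have := hbd t h2.1 h2.2
    linarith
  · obtain ⟨s, hs1, hsT, hsP⟩ := late (hRl.eventually (lt_mem_nhds (show q l / 2 < q l by linarith)))
    set k := (q l / 2) / ((m - 1) * M) with hk
    have hm1 : 0 < m - 1 := by linarith
    have hk0 : 0 < k := by rw [hk]; apply div_pos (by linarith) (by positivity)
    have key : ∀ t, s ≤ t → t < T → g s + k * Real.log (x s) ≤ g t + k * Real.log (x t) := by
      intro t h1 h2
      refine mono_of_deriv (g := fun t => g t + k * Real.log (x t)) h1 (fun r h3 h4 =>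
        (hg r (hs1.trans h3) (h4.trans_lt h2)).add (((dx r (hs1.trans h3) (h4.trans_lt h2)).log
          (xpos r (hs1.trans h3) (h4.trans_lt h2)).ne').const_mul k)) ?_
      intro r h3 h4
      have hr1 := hs1.trans h3
      have hr2 := h4.trans_lt h2
      have hx := xpos r hr1 hr2
      have hRr := hsP r h3 hr2
      have hY := YM r hr1 hr2
      have e : R r / (m * x r) + k * (-((m - 1) / m * Y r) / x r)
        = (R r - (q l / 2) * (Y r / M)) / (m * x r) := by
        rw [hk]; field_simp
        ring
      rw [e]
      apply div_nonneg _ (by positivity)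
      have : Y r / M ≤ 1 := (div_le_one hM).2 hY
      have : (q l / 2) * (Y r / M) ≤ (q l / 2) * 1 := by
        apply mul_le_mul_of_nonneg_left this; linarith
      linarith
    have hbd : ∀ t, s ≤ t → t < T → ((g s + k * Real.log (x s)) - B) / k ≤ Real.log (x t) := by
      intro t h1 h2
      rw [div_le_iff₀ hk0]
      have := key t h1 h2
      have := hB t (hs1.trans h1) h2
      linarith
    obtain ⟨t, h1, h2⟩ := ((hlog.eventually_lt_atBot (((g s + k * Real.log (x s)) - B) / k)).and
      (Ico_mem_nhdsLT hsT)).exists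
    have := hbd t h2.1 h2.2
    linarith

/-- one-sided de l'Hopital -/
lemma lin_asym {z z' : ℝ → ℝ} {t₁ T k : ℝ} (hT : t₁ < T)
    (hz : ∀ t, t₁ ≤ t → t < T → HasDerivAt z (z' t) t) (hz0 : Tendsto z (𝓝[<] T) (𝓝 0))
    (hk : Tendsto z' (𝓝[<] T) (𝓝 (-k))) :
    Tendsto (fun t => z t / (T - t)) (𝓝[<] T) (𝓝 k) := by
  have hg : ∀ t : ℝ, HasDerivAt (fun t => T - t) (-1) t := fun t => by
    simpa using (hasDerivAt_id t).const_sub T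
  refine HasDerivAt.lhopital_zero_nhdsLT (f' := z') (g' := fun _ => -1) ?_ ?_ ?_ hz0 ?_ ?_
  · filter_upwards [Ico_mem_nhdsLT hT] with t ht using hz t ht.1 ht.2
  · exact Eventually.of_forall hg
  · exact Eventually.of_forall fun _ => by norm_num
  · have : Tendsto (fun t => T - t) (𝓝 T) (𝓝 (T - T)) := (hg T).continuousAt
    rw [sub_self] at this
    exact this.mono_left nhdsWithin_le_nhds
  · have := hk.div_const (-1)
    simpa using this

end SSP

namespace SSP
section
variable {m a b β θ κ c T δ : ℝ} {x Y : ℝ → ℝ}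

lemma psi_tendsto (c β T : ℝ) : Tendsto (psi c β) (𝓝[<] T) (𝓝 (psi c β T)) :=
  (psi_deriv c β T).continuousAt.tendsto.mono_left nhdsWithin_le_nhds

/-- scaling -/
lemma Traj.scale (h : Traj m a b β θ κ c T x Y) {μ : ℝ} (hμ : 0 < μ) :
    Traj m a b β θ (κ * μ ^ (2 - θ)) (μ * c) T (fun t => μ * x t) (fun t => μ * Y t) := by
  refine ⟨fun t ht => mul_pos hμ (h.xpos t ht), fun t ht => ?_, fun t ht => ?_⟩
  · refine ((h.dx t ht).const_mul μ).congr_deriv ?_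
    ring
  · refine ((h.dY t ht).const_mul μ).congr_deriv ?_
    have hx := h.xpos t ht
    have e1 : psi (μ * c) β t = μ * psi c β t := by unfold psi; ring
    have e2 : κ * μ ^ (2 - θ) * (μ * x t) ^ θ = μ ^ 2 * (κ * x t ^ θ) := by
      rw [Real.mul_rpow hμ.le hx.le]
      have : μ ^ (2 - θ) * μ ^ θ = μ ^ 2 := by
        rw [← Real.rpow_add hμ, ← Real.rpow_natCast]; congr 1; push_cast; ring
      linear_combination (κ * x t ^ θ) * this
    rw [e1, e2]
    have : m * (μ * x t) = μ * (m * x t) := by ring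
    rw [this]
    have h3 : (μ * Y t) ^ 2 - (μ * psi c β t + a * m * (μ * x t)) * (μ * Y t) +
      m * (b * (μ * x t) ^ 2 + μ ^ 2 * (κ * x t ^ θ)) = μ * (μ * (Y t ^ 2 - (psi c β t + a * m * x t) * Y t +
      m * (b * x t ^ 2 + κ * x t ^ θ))) := by ring
    rw [h3, mul_div_mul_left _ _ hμ.ne', mul_div_assoc]

/-- `Y` converges at extinction -/
lemma Traj.Y_conv (P : Par m a b β θ) (hc : 0 < c) (h : Traj m a b β θ 1 c T x Y)
    (hx0 : Tendsto x (𝓝[<] T) (𝓝 0)) {M t₁ : ℝ} (ht₁ : t₁ < T)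
    (hM : ∀ t, t₁ ≤ t → t < T → Y t ≤ M) :
    ∃ l, Tendsto Y (𝓝[<] T) (𝓝 l) ∧ l ^ 2 - psi c β T * l + m * (0:ℝ) ^ θ = 0 := by
  have hYp := h.Ypos P hc.le zero_le_one
  have hm := P.hm
  have hxθ : Tendsto (fun t => x t ^ θ) (𝓝[<] T) (𝓝 ((0:ℝ) ^ θ)) := by
    rcases eq_or_lt_of_le P.hθ0 with e | e
    · rw [← e]; simp
    · exact (Real.continuousAt_rpow_const 0 θ (Or.inr e.le)).tendsto.comp hx0
  refine conv_fast (R := fun t => Y t ^ 2 - (psi c β t + a * m * x t) * Y t + m * (b * x t ^ 2 + 1 * x t ^ θ))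
    (q := fun v => v ^ 2 - psi c β T * v + m * (0:ℝ) ^ θ) (A := 0) (B := M) (M := M) ht₁ hm
    (fun t _ h2 => h.xpos t h2) (fun t _ h2 => h.dx t h2) (fun t _ h2 => hYp t h2) hM hx0
    (fun t _ h2 => h.dY t h2) ?_ (by fun_prop) ?_ (fun t _ h2 => (hYp t h2).le) hM
  · have e : (fun t => Y t ^ 2 - (psi c β t + a * m * x t) * Y t + m * (b * x t ^ 2 + 1 * x t ^ θ) -
      (Y t ^ 2 - psi c β T * Y t + m * (0:ℝ) ^ θ)) = fun t => -(psi c β t - psi c β T + a * m * x t) * Y t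
        + m * (b * x t ^ 2 + (x t ^ θ - (0:ℝ) ^ θ)) := by
      funext t; ring
    rw [e]
    have l1 : Tendsto (fun t => -(psi c β t - psi c β T + a * m * x t)) (𝓝[<] T) (𝓝 0) := by
      have := (((psi_tendsto c β T).sub_const (psi c β T)).add (hx0.const_mul (a * m))).neg
      simpa using this
    have l2 : Tendsto (fun t => -(psi c β t - psi c β T + a * m * x t) * Y t) (𝓝[<] T) (𝓝 0) := by
      refine Tendsto.zero_mul_isBoundedUnder_le l1 ⟨M, ?_⟩
      simp only [eventually_map]
      filter_upwards [Ico_mem_nhdsLT ht₁] with t ht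
      simp only [Function.comp, Real.norm_eq_abs]
      rw [abs_of_pos (hYp t ht.2)]
      exact hM t ht.1 ht.2
    have l3 : Tendsto (fun t => m * (b * x t ^ 2 + (x t ^ θ - (0:ℝ) ^ θ))) (𝓝[<] T) (𝓝 0) := by
      have := (((hx0.pow 2).const_mul b).add (hxθ.sub_const ((0:ℝ) ^ θ))).const_mul m
      simpa using this
    simpa using l2.add l3
  · refine Set.Finite.subset (s := {(psi c β T + √(psi c β T ^ 2 - 4 * (m * (0:ℝ) ^ θ))) / 2,
      (psi c β T - √(psi c β T ^ 2 - 4 * (m * (0:ℝ) ^ θ))) / 2}) (by simp) ?_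
    intro v hv
    have hv' : v ^ 2 - psi c β T * v + m * (0:ℝ) ^ θ = 0 := hv
    have h0 : psi c β T ^ 2 - 4 * (m * (0:ℝ) ^ θ) = (2 * v - psi c β T) ^ 2 := by
      linear_combination (-4) * hv'
    rw [h0, Real.sqrt_sq_eq_abs]
    simp only [mem_insert_iff, mem_singleton_iff]
    rcases abs_choice (2 * v - psi c β T) with e | e <;> rw [e]
    · left; ring
    · right; ring

lemma Traj.typeI (P : Par m a b β θ) (h : Traj m a b β θ κ c T x Y)
    (hx0 : Tendsto x (𝓝[<] T) (𝓝 0)) {l : ℝ} (hl : Tendsto Y (𝓝[<] T) (𝓝 l)) :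
    Tendsto (fun t => x t / (T - t)) (𝓝[<] T) (𝓝 ((m - 1) / m * l)) :=
  lin_asym (sub_one_lt T) (fun t _ h2 => h.dx t h2) hx0 ((hl.const_mul _).neg)

/-- part (i) asymptotics -/
lemma Traj.typeII (P : Par m a b β θ) (hc : 0 < c) (h : Traj m a b β θ 1 c T x Y)
    (hx0 : Tendsto x (𝓝[<] T) (𝓝 0)) {t₁ : ℝ} (ht₁ : t₁ < T)
    (hM : ∀ t, t₁ ≤ t → t < T → 2 * Y t < psi c β t) :
    ∃ k, 0 < k ∧ Tendsto (fun t => x t ^ (1 - θ) / (T - t)) (𝓝[<] T) (𝓝 k) := by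
  have hm := P.hm
  have hβ := P.hβ
  have hm1 : 0 < m - 1 := by linarith
  have hYp := h.Ypos P hc.le zero_le_one
  have hψT := psi_pos (β := β) hc T
  have hYM : ∀ t, t₁ ≤ t → t < T → Y t ≤ psi c β t₁ := by
    intro t h1 h2
    have := hM t h1 h2
    have := psi_anti (β := β) hc.le (by linarith) h1
    have := hYp t h2
    linarith
  obtain ⟨l, hl, hql⟩ := h.Y_conv P hc hx0 ht₁ hYM
  have hl0 : 0 ≤ l := by
    refine ge_of_tendsto hl ?_
    filter_upwards [Ico_mem_nhdsLT ht₁] with t ht using (hYp t ht.2).le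
  have hl2 : 2 * l ≤ psi c β T := by
    refine le_of_tendsto_of_tendsto (hl.const_mul 2) (psi_tendsto c β T) ?_
    filter_upwards [Ico_mem_nhdsLT ht₁] with t ht using (hM t ht.1 ht.2).le
  rcases eq_or_lt_of_le P.hθ0 with e | hθ
  · rw [← e] at hql ⊢
    rw [Real.rpow_zero] at hql
    have hlpos : 0 < l := by
      rcases eq_or_lt_of_le hl0 with e | e
      · rw [← e] at hql; norm_num at hql; linarith
      · exact e
    refine ⟨(m - 1) / m * l, by positivity, ?_⟩
    simpa using h.typeI P hx0 hl
  · rw [Real.zero_rpow hθ.ne'] at hql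
    have hl00 : l = 0 := by
      have : l * (l - psi c β T) = 0 := by linear_combination hql
      rcases mul_eq_zero.1 this with e | e
      · exact e
      · linarith
    subst hl00
    -- the variable V
    have hθ1 := P.hθ1
    have dV : ∀ t, t < T → HasDerivAt (fun t => Y t * x t ^ (-θ))
        ((-(Y t * x t ^ (-θ)) * (psi c β t + a * m * x t - (1 + θ * (m - 1)) * Y t) + m
          + m * b * x t ^ (2 - θ)) / (m * x t)) t := by
      intro t ht
      have hx := h.xpos t ht
      refine ((h.dY t ht).mul ((h.dx t ht).rpow_const (p := -θ) (Or.inl hx.ne'))).congr_deriv ?_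
      have e1 : x t ^ (-θ - 1) = x t ^ (-θ) / x t := Real.rpow_sub_one hx.ne' _
      have e2 : x t ^ (2 - θ) = x t ^ (-θ) * x t ^ 2 := by
        rw [← Real.rpow_natCast (x t) 2, ← Real.rpow_add hx]; congr 1; push_cast; ring
      have e3 : x t ^ θ * x t ^ (-θ) = 1 := by rw [← Real.rpow_add hx]; simp
      rw [e1, e2]
      field_simp
      linear_combination m * e3
    have hxpow : ∀ {q : ℝ}, 0 < q → Tendsto (fun t => x t ^ q) (𝓝[<] T) (𝓝 0) := by
      intro q hq
      have := (Real.continuousAt_rpow_const 0 q (Or.inr hq.le)).tendsto.comp hx0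
      rwa [Real.zero_rpow hq.ne'] at this
    have lim1 : Tendsto (fun t => psi c β t + a * m * x t - (1 + θ * (m - 1)) * Y t) (𝓝[<] T)
        (𝓝 (psi c β T)) := by
      have := ((psi_tendsto c β T).add (hx0.const_mul (a * m))).sub (hl.const_mul (1 + θ * (m - 1)))
      simpa using this
    have lim2 : Tendsto (fun t => m + m * b * x t ^ (2 - θ)) (𝓝[<] T) (𝓝 m) := by
      have := ((hxpow (show 0 < 2 - θ by linarith)).const_mul (m * b)).const_add m
      simpa using this
    have ev : ∀ᶠ t in 𝓝[<] T, psi c β T / 2 < psi c β t + a * m * x t - (1 + θ * (m - 1)) * Y t ∧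
        m + m * b * x t ^ (2 - θ) < 2 * m :=
      (lim1.eventually (lt_mem_nhds (by linarith))).and (lim2.eventually (gt_mem_nhds (by linarith)))
    obtain ⟨s₀, hs₀, hsP⟩ := (mem_nhdsLT_iff_exists_Ioo_subset' ht₁).1 ev
    have hs₀' : s₀ < T := hs₀
    set s := max t₁ ((s₀ + T) / 2) with hs
    have hsT : s < T := max_lt ht₁ (by linarith)
    have hsP' : ∀ t, s ≤ t → t < T → psi c β T / 2 < psi c β t + a * m * x t - (1 + θ * (m - 1)) * Y t ∧
        m + m * b * x t ^ (2 - θ) < 2 * m := by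
      intro t h1 h2
      refine hsP ⟨?_, h2⟩
      have := (le_max_right t₁ ((s₀ + T) / 2)).trans h1
      linarith
    set B := Y s * x s ^ (-θ) + 1 + 4 * m / psi c β T with hB
    have hVp : ∀ t, t < T → 0 < Y t * x t ^ (-θ) := fun t ht =>
      mul_pos (hYp t ht) (Real.rpow_pos_of_pos (h.xpos t ht) _)
    have hB4 : 4 * m ≤ B * psi c β T := by
      have : 4 * m / psi c β T ≤ B := by
        have := hVp s hsT
        rw [hB]; linarith
      rwa [div_le_iff₀ hψT] at this
    have hVB : ∀ t, s ≤ t → t < T → 0 < B - Y t * x t ^ (-θ) := by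
      refine barrier (fun t _ h2 => (hasDerivAt_const t B).sub (dV t h2)) (by
        rw [hB]
        have : 0 < 4 * m / psi c β T := by positivity
        linarith) ?_
      intro t h1 h2 e
      obtain ⟨i1, i2⟩ := hsP' t h1 h2
      have e' : Y t * x t ^ (-θ) = B := by linarith
      rw [e']
      have hx := h.xpos t h2
      rw [zero_sub, neg_pos]
      apply div_neg_of_neg_of_pos _ (by positivity)
      have hBpos : 0 < B := by rw [← e']; exact hVp t h2
      have : B * (psi c β T / 2) < B * (psi c β t + a * m * x t - (1 + θ * (m - 1)) * Y t) :=
        mul_lt_mul_of_pos_left i1 hBpos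
      linarith
    obtain ⟨w, hw, hqw⟩ := conv_fast (g := fun t => Y t * x t ^ (-θ))
      (R := fun t => -(Y t * x t ^ (-θ)) * (psi c β t + a * m * x t - (1 + θ * (m - 1)) * Y t) + m
          + m * b * x t ^ (2 - θ)) (q := fun v => -v * psi c β T + m) (A := 0) (B := B) (M := psi c β t₁)
      hsT hm (fun t _ h2 => h.xpos t h2) (fun t _ h2 => h.dx t h2) (fun t _ h2 => hYp t h2)
      (fun t h1 h2 => hYM t ((le_max_left _ _).trans h1) h2) hx0 (fun t _ h2 => dV t h2) (by
        have e : (fun t => -(Y t * x t ^ (-θ)) * (psi c β t + a * m * x t - (1 + θ * (m - 1)) * Y t) + m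
          + m * b * x t ^ (2 - θ) - (-(Y t * x t ^ (-θ)) * psi c β T + m)) =
          fun t => -(psi c β t + a * m * x t - (1 + θ * (m - 1)) * Y t - psi c β T) * (Y t * x t ^ (-θ))
            + (m + m * b * x t ^ (2 - θ) - m) := by funext t; ring
        rw [e]
        have k1 : Tendsto (fun t => -(psi c β t + a * m * x t - (1 + θ * (m - 1)) * Y t - psi c β T))
            (𝓝[<] T) (𝓝 0) := by
          simpa using (lim1.sub_const (psi c β T)).neg
        have k2 : Tendsto (fun t => -(psi c β t + a * m * x t - (1 + θ * (m - 1)) * Y t - psi c β T) *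
            (Y t * x t ^ (-θ))) (𝓝[<] T) (𝓝 0) := by
          refine Tendsto.zero_mul_isBoundedUnder_le k1 ⟨B, ?_⟩
          simp only [eventually_map]
          filter_upwards [Ico_mem_nhdsLT hsT] with t ht
          simp only [Function.comp, Real.norm_eq_abs]
          rw [abs_of_pos (hVp t ht.2)]
          linarith [hVB t ht.1 ht.2]
        simpa using k2.add (lim2.sub_const m)) (by fun_prop) (by
        refine Set.Finite.subset (s := {m / psi c β T}) (by simp) ?_
        intro v hv
        have hv' : -v * psi c β T + m = 0 := hv
        simp only [mem_singleton_iff]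
        rw [eq_div_iff hψT.ne']
        linarith) (fun t _ h2 => (hVp t h2).le) (fun t h1 h2 => by linarith [hVB t h1 h2])
    have hw0 : 0 < w := by
      have : w = m / psi c β T := by
        rw [eq_div_iff hψT.ne']
        linarith
      rw [this]; positivity
    refine ⟨(1 - θ) * ((m - 1) / m * w), by
      have : 0 < 1 - θ := by linarith
      positivity, ?_⟩
    refine lin_asym (z' := fun t => -((1 - θ) * ((m - 1) / m * (Y t * x t ^ (-θ))))) ht₁ (fun t _ h2 => ?_)
      (hxpow (by linarith)) (((hw.const_mul _).const_mul _).neg)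
    refine ((h.dx t h2).rpow_const (p := 1 - θ) (Or.inl (h.xpos t h2).ne')).congr_deriv ?_
    have : (1 - θ - 1) = -θ := by ring
    rw [this]
    ring

end
end SSP

namespace SSP
section
variable {m a b β θ κ c T δ : ℝ} {x Y : ℝ → ℝ}

/-- no global trajectory with `W ≥ 0` -/
lemma no_global (P : Par m a b β θ) (hc : 0 ≤ c) (hq1 : (m - 1) * (1 - θ) ≤ 1)
    (h : ∀ T, Traj m a b β θ 1 c T x Y)
    (hW : ∀ t, 0 ≤ psi c β t + a * x t - Y t) : False := by
  have hm := P.hm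
  have hβ := P.hβ
  have hb := P.hb
  have ha := P.ha
  have hm1 : 0 < m - 1 := by linarith
  have hθ1 : 0 < 1 - θ := by linarith [P.hθ1]
  set q := (m - 1) * (1 - θ) with hq
  have hq0 : 0 < q := by positivity
  have hx : ∀ t, 0 < x t := fun t => (h (t + 1)).xpos t (by linarith)
  have hY : ∀ t, 0 < Y t := fun t => (h (t + 1)).Ypos P hc zero_le_one t (by linarith)
  set H := fun t => x t ^ (1 / (m - 1)) with hH
  have hHp : ∀ t, 0 < H t := fun t => Real.rpow_pos_of_pos (hx t) _
  set F := fun t => H t * (psi c β t + a * x t - Y t) with hF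
  have dF : ∀ t, HasDerivAt F (-(H t * (psi c β t / β + b * x t + x t ^ θ / x t))) t := by
    intro t
    have ht : t < t + 1 := by linarith
    have d1 := ((h (t + 1)).dx t ht).rpow_const (p := 1 / (m - 1)) (Or.inl (hx t).ne')
    have d2 := ((psi_deriv c β t).add (((h (t + 1)).dx t ht).const_mul a)).sub ((h (t + 1)).dY t ht)
    refine (d1.mul d2).congr_deriv ?_
    have hxt := hx t
    simp only [hH, Pi.add_apply, Pi.sub_apply]
    rw [Real.rpow_sub_one hxt.ne']
    field_simp
    ring
  have hFneg : ∀ t, -(H t * (psi c β t / β + b * x t + x t ^ θ / x t)) < 0 := by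
    intro t
    have := hHp t
    have := hx t
    have := psi_nonneg (β := β) hc t
    have := Real.rpow_pos_of_pos (hx t) θ
    rw [neg_lt_zero]
    positivity
  have hF0 : ∀ t, 0 ≤ F t := fun t => mul_nonneg (hHp t).le (hW t)
  have hFa : StrictAnti F := strictAnti_of_hasDerivAt_neg dF hFneg
  have hFp : ∀ t, 0 < F t := fun t => (hF0 (t + 1)).trans_lt (hFa (by linarith))
  set C := psi c β 0 + a * x 0 with hC
  have hCp : 0 < C := by
    have := psi_nonneg (β := β) hc 0
    have := hx 0
    positivity
  have hFC : ∀ t, 0 ≤ t → F t ≤ H t * C := by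
    intro t ht
    apply mul_le_mul_of_nonneg_left _ (hHp t).le
    have h1 := psi_anti (β := β) hc (by linarith) ht
    have h2 := (h (t + 1)).x_anti P hc zero_le_one ht (by linarith)
    have h3 := hY t
    have : a * x t ≤ a * x 0 := by gcongr
    linarith
  -- F^q decreases at a linear rate
  set k := q * (1 / C) ^ (1 - q) with hk
  have hkp : 0 < k := by positivity
  have key : ∀ t, 0 ≤ t → F t ^ q + k * t ≤ F 0 ^ q + k * 0 := by
    intro t ht
    refine anti_of_deriv (g := fun t => F t ^ q + k * t) ht (fun r _ _ =>
      ((dF r).rpow_const (p := q) (Or.inl (hFp r).ne')).add ((hasDerivAt_id r).const_mul k)) ?_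
    intro r h1 _
    have hxr := hx r
    have hFr := hFp r
    have hHr := hHp r
    have i0 : F r / C ≤ H r := by
      rw [div_le_iff₀ hCp]; exact hFC r h1
    have i1 : (F r / C) ^ (1 - q) ≤ H r ^ (1 - q) :=
      Real.rpow_le_rpow (by positivity) i0 (by linarith)
    have i2 : H r ^ (1 - q) = H r * (x r ^ θ / x r) := by
      simp only [hH]
      rw [← Real.rpow_mul hxr.le, ← Real.rpow_sub_one hxr.ne', ← Real.rpow_add hxr]
      congr 1
      rw [hq]
      field_simp
      ring
    have i3 : H r * (x r ^ θ / x r) ≤ H r * (psi c β r / β + b * x r + x r ^ θ / x r) := by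
      apply mul_le_mul_of_nonneg_left _ hHr.le
      have := psi_nonneg (β := β) hc r
      have : 0 ≤ psi c β r / β + b * x r := by positivity
      linarith
    have i4 : (F r / C) ^ (1 - q) * F r ^ (q - 1) = (1 / C) ^ (1 - q) := by
      rw [div_eq_mul_one_div, Real.mul_rpow hFr.le (by positivity)]
      have : F r ^ (1 - q) * F r ^ (q - 1) = 1 := by
        rw [← Real.rpow_add hFr]; simp
      linear_combination ((1 / C) ^ (1 - q)) * this
    have i5 : 0 < F r ^ (q - 1) := Real.rpow_pos_of_pos hFr _
    have i6 : (1 / C) ^ (1 - q) ≤ (H r * (psi c β r / β + b * x r + x r ^ θ / x r)) * F r ^ (q - 1) := by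
      rw [← i4]
      apply mul_le_mul_of_nonneg_right _ i5.le
      linarith
    have : k ≤ q * ((H r * (psi c β r / β + b * x r + x r ^ θ / x r)) * F r ^ (q - 1)) := by
      rw [hk]
      exact mul_le_mul_of_nonneg_left i6 hq0.le
    linarith
  have h1 := key ((F 0 ^ q + 1) / k) (by
    have := hFp 0
    positivity)
  have h2 := Real.rpow_pos_of_pos (hFp ((F 0 ^ q + 1) / k)) q
  rw [mul_div_cancel₀ _ hkp.ne'] at h1
  linarith

/-- the trapping region -/
def Trap (m b β θ δ c x Y t : ℝ) : Prop :=
  x < δ * psi c β t ∧ m * (b * x ^ 2 + 1 * x ^ θ) < 2 * (psi c β t * Y) ∧ 2 * Y < psi c β t ∧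
  (16 * m * SS m β θ c x t < 1 ∨ 16 * m * x ^ θ * SS m β θ c x t ^ 2 < 1)

lemma Traj.zero_trap (P : Small m a b β θ δ) (hc : 0 < c) (hθ : 0 < θ) (h : Traj m a b β θ 1 c T x Y)
    (hx0 : Tendsto x (𝓝[<] T) (𝓝 0)) (hY0 : Tendsto Y (𝓝[<] T) (𝓝 0)) :
    ∃ t, t < T ∧ Trap m b β θ δ c (x t) (Y t) t := by
  have hm := P.hm
  have hβ := P.hβ
  have hb := P.hb
  have ha := P.ha
  have hδ := P.hδ0
  have hm1 : 0 < m - 1 := by linarith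
  have hθ1 : 0 < 1 - θ := by linarith [P.hθ1]
  have hψT := psi_pos (β := β) hc T
  have hYp := h.Ypos P.toPar hc.le zero_le_one
  have hψ : ∀ t, t < T → psi c β T ≤ psi c β t := fun t ht => psi_anti hc.le (by linarith) ht.le
  have hxθ : Tendsto (fun t => x t ^ θ) (𝓝[<] T) (𝓝 0) := by
    have := (Real.continuousAt_rpow_const 0 θ (Or.inr hθ.le)).tendsto.comp hx0
    rwa [Real.zero_rpow hθ.ne'] at this
  set K := 1 / psi c β T + 8 / ((m - 1) * (1 - θ)) / β with hK
  have hK0 : 0 < K := by positivity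
  have ev1 : ∀ᶠ t in 𝓝[<] T, x t < δ * psi c β T := hx0.eventually (gt_mem_nhds (by positivity))
  have ev2 : ∀ᶠ t in 𝓝[<] T, Y t < psi c β T / 2 := hY0.eventually (gt_mem_nhds (by positivity))
  have ev3 : ∀ᶠ t in 𝓝[<] T, x t ^ θ < 1 / (16 * m * K ^ 2) := hxθ.eventually (gt_mem_nhds (by positivity))
  have ev : ∀ᶠ t in 𝓝[<] T, x t < δ * psi c β t ∧ 2 * Y t < psi c β t ∧
      16 * m * x t ^ θ * SS m β θ c (x t) t ^ 2 < 1 := by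
    filter_upwards [ev1, ev2, ev3, self_mem_nhdsWithin] with t h1 h2 h3 h4
    have h4' : t < T := h4
    have hx := h.xpos t h4'
    have i1 := hψ t h4'
    refine ⟨h1.trans_le (by gcongr), by linarith, ?_⟩
    have hG := GG_le_one (θ := θ) hx.le
    have hG0 := GG_nonneg (θ := θ) hx.le
    have hp := psi_pos (β := β) hc t
    have i2 : SS m β θ c (x t) t ≤ K := by
      unfold SS
      rw [hK]
      have j1 : 1 / psi c β t ≤ 1 / psi c β T := one_div_le_one_div_of_le hψT i1
      have j2 : 8 / ((m - 1) * (1 - θ)) / β * GG θ (x t) ≤ 8 / ((m - 1) * (1 - θ)) / β * 1 := by gcongr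
      linarith
    have i3 : 0 ≤ SS m β θ c (x t) t := by unfold SS; positivity
    have hxt := Real.rpow_pos_of_pos hx θ
    calc 16 * m * x t ^ θ * SS m β θ c (x t) t ^ 2 ≤ 16 * m * x t ^ θ * K ^ 2 := by gcongr
      _ = (16 * m * K ^ 2) * x t ^ θ := by ring
      _ < (16 * m * K ^ 2) * (1 / (16 * m * K ^ 2)) := by gcongr
      _ = 1 := by field_simp
  obtain ⟨s₀, hs₀, hsP⟩ := (mem_nhdsLT_iff_exists_Ioo_subset' (sub_one_lt T)).1 ev
  have hs₀' : s₀ < T := hs₀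
  set s := (s₀ + T) / 2 with hs
  have hs1 : s₀ < s := by rw [hs]; linarith
  have hsT : s < T := by rw [hs]; linarith
  by_contra hcon
  push Not at hcon
  have hlow : ∀ t, s ≤ t → t < T → 2 * (psi c β t * Y t) ≤ m * (b * x t ^ 2 + 1 * x t ^ θ) := by
    intro t h1 h2
    by_contra h3
    push Not at h3
    have h4 := hsP ⟨hs1.trans_le h1, h2⟩
    exact hcon t h2 ⟨h4.1, h3, h4.2.1, Or.inr h4.2.2⟩
  have hmono : ∀ t, s ≤ t → t < T → Y s ≤ Y t := by
    intro t h1 h2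
    refine mono_of_deriv h1 (fun r _ h4 => h.dY r (h4.trans_lt h2)) ?_
    intro r h3 h4
    have hr := h4.trans_lt h2
    have hx := h.xpos r hr
    have hYr := hYp r hr
    have hp := psi_pos (β := β) hc r
    have h5 := hlow r h3 hr
    have h6 := (hsP ⟨hs1.trans_le h3, hr⟩).1
    apply div_nonneg _ (by positivity)
    have i1 : a * m * x r ≤ 1 / 4 * psi c β r := by
      calc a * m * x r ≤ a * m * (δ * psi c β r) := by gcongr
        _ = a * m * δ * psi c β r := by ring
        _ ≤ _ := mul_le_mul_of_nonneg_right P.hδa hp.le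
    have i2 : a * m * x r * Y r ≤ 1 / 4 * psi c β r * Y r := mul_le_mul_of_nonneg_right i1 hYr.le
    have i3 : 0 ≤ psi c β r * Y r := by positivity
    have i4 := sq_nonneg (Y r)
    linarith
  have : Y s ≤ 0 := by
    refine ge_of_tendsto hY0 ?_
    filter_upwards [Ico_mem_nhdsLT hsT] with t ht using hmono t ht.1 ht.2
  linarith [hYp s hsT]

/-- extra constants for the first regime -/
structure Small2 (m a b β θ δ g M : ℝ) : Prop extends Small m a b β θ δ where
  hg : 0 < g
  hbg : b = g * (a - g)
  hMa : a * m ≤ M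
  hM4 : 4 * m ≤ M
  hMg : 2 / 3 * m * b / M < g / 2
  hMδ : 3 * M * δ ≤ 1
  hgδ : 2 * g * δ ≤ 1
  hβM : 1 < β * ((m - 1) / m * (2 / 3 * m * b / (1 / δ + M)))

/-- monotonicity when there is no reaction -/
lemma Traj.y_lt (P : Par m a b β θ) {g : ℝ} (hg : 0 < g) (hbg : b = g * (a - g)) (hc : 0 < c)
    (h : Traj m a b β θ 0 c T x Y) (hev : ∀ᶠ t in atBot, Y t < g * x t) :
    ∀ t, t < T → Y t / x t < g := by
  intro t ht
  obtain ⟨s, hs⟩ := eventually_atBot.1 hev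
  have hmin : min s t < T := (min_le_right _ _).trans_lt ht
  have hm := P.hm
  have := barrier (g := fun t => g - Y t / x t) (t₁ := min s t) (T := T)
    (fun r _ h2 => (hasDerivAt_const r g).sub (h.dy P r h2)) (by
      rw [sub_pos, div_lt_iff₀ (h.xpos _ hmin)]
      exact hs _ (min_le_left _ _)) (by
      intro r _ h2 e
      have e' : Y r / x r = g := by linarith
      have hx := h.xpos r h2
      have hp := psi_pos (β := β) hc r
      rw [e', hbg]
      have : 0 < psi c β r / (m * x r) * g := by positivity
      have e3 : 0 - (g ^ 2 - (psi c β r / (m * x r) + a) * g + g * (a - g) + 0 * x r ^ θ / x r ^ 2) =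
        psi c β r / (m * x r) * g := by ring
      rw [e3]
      exact this) t (min_le_right _ _) ht
  linarith

lemma regime1 {g M : ℝ} (P : Small2 m a b β θ δ g M) (hc : 0 < c)
    (h : ∀ T, Traj m a b β θ 0 c T x Y)
    (hev1 : ∀ᶠ t in atBot, Y t < g * x t) (hev2 : ∀ᶠ t in atBot, g / 2 * x t < Y t) :
    ∃ t, x t < δ * psi c β t ∧ m * (b * x t ^ 2) < 2 * (psi c β t * Y t) ∧ 2 * Y t < psi c β t := by
  have hm := P.hm
  have hβ := P.hβ
  have hb := P.hb
  have ha := P.ha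
  have hδ := P.hδ0
  have hg := P.hg
  have hm1 : 0 < m - 1 := by linarith
  have hM0 : 0 < M := by linarith [P.hM4]
  have hx : ∀ t, 0 < x t := fun t => (h (t + 1)).xpos t (by linarith)
  have hp := psi_pos (β := β) hc
  have hyg : ∀ t, Y t / x t < g := fun t =>
    (h (t + 1)).y_lt P.toPar hg P.hbg hc hev1 t (by linarith)
  set k := 2 / 3 * m * b with hk
  have hk0 : 0 < k := by positivity
  -- lower barrier
  have hylow : ∀ t, k / (psi c β t / x t + M) < Y t / x t := by
    intro t
    obtain ⟨s, hs⟩ := eventually_atBot.1 hev2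
    have dρ : ∀ r, HasDerivAt (fun r => psi c β r / x r)
        (psi c β r / x r * (-(1 / β) + (m - 1) / m * (Y r / x r))) r := by
      intro r
      have hxr := hx r
      refine ((psi_deriv c β r).div ((h (r + 1)).dx r (by linarith)) hxr.ne').congr_deriv ?_
      field_simp
      ring
    have := barrier (g := fun r => Y r / x r - k / (psi c β r / x r + M)) (t₁ := min s t) (T := t + 1)
      (fun r _ _ => ((h (r + 1)).dy P.toPar r (by linarith)).sub
        ((hasDerivAt_const r k).div ((dρ r).add_const M) (by
          have := hp r
          have := hx r
          positivity))) (by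
        have h1 := hs _ (min_le_left s t)
        have hx1 := hx (min s t)
        have hp1 := hp (min s t)
        rw [sub_pos]
        calc k / (psi c β (min s t) / x (min s t) + M) < k / M := by
              apply div_lt_div_of_pos_left hk0 hM0
              have : 0 < psi c β (min s t) / x (min s t) := by positivity
              linarith
          _ < g / 2 := P.hMg
          _ < Y (min s t) / x (min s t) := by rwa [lt_div_iff₀ hx1]) (by
        intro r _ _ e
        have hxr := hx r
        have hpr := hp r
        set ρ := psi c β r / x r with hρ
        have hρ0 : 0 < ρ := by positivity
        set y := Y r / x r with hy
        have ey : y = k / (ρ + M) := by linarith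
        have hy0 : 0 < y := by rw [ey]; positivity
        have eρ : psi c β r / (m * x r) = ρ / m := by rw [hρ]; field_simp
        have eyk : y * (ρ + M) = k := by rw [ey]; field_simp
        have e1 : (0 * (ρ + M) - k * (ρ * (-(1 / β) + (m - 1) / m * y))) / (ρ + M) ^ 2
          = - (y * (ρ / (ρ + M)) * (-(1 / β) + (m - 1) / m * y)) := by
          rw [← eyk]; field_simp; ring
        rw [e1, eρ]
        have i1 : ρ / (ρ + M) ≤ 1 := by rw [div_le_one (by positivity)]; linarith
        have i1' : 0 < ρ / (ρ + M) := by positivity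
        have i2 : y ≤ b / 6 := by
          rw [ey]
          calc k / (ρ + M) ≤ k / M := by
                apply div_le_div_of_nonneg_left hk0.le hM0; linarith
            _ ≤ k / (4 * m) := by
                apply div_le_div_of_nonneg_left hk0.le (by positivity) P.hM4
            _ = b / 6 := by rw [hk]; field_simp; norm_num
        have i3 : y * (ρ / m + a) ≤ 2 / 3 * b := by
          have : y * (ρ + a * m) ≤ y * (ρ + M) := by
            have := P.hMa
            gcongr
          rw [eyk, hk] at this
          have e4 : y * (ρ / m + a) = y * (ρ + a * m) / m := by field_simp
          rw [e4, div_le_iff₀ (by linarith)]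
          linarith
        have i4 : y * (ρ / (ρ + M)) * (1 / β) ≤ y := by
          have : 1 / β ≤ 1 := by rw [div_le_one (by linarith)]; exact hβ
          calc y * (ρ / (ρ + M)) * (1 / β) ≤ y * 1 * 1 := by gcongr
            _ = y := by ring
        have i5 : 0 ≤ y * (ρ / (ρ + M)) * ((m - 1) / m * y) := by positivity
        have i6 : 0 < y ^ 2 := by positivity
        have e7 : y ^ 2 - (ρ / m + a) * y + b + 0 * x r ^ θ / x r ^ 2 -
            -(y * (ρ / (ρ + M)) * (-(1 / β) + (m - 1) / m * y)) =
          y ^ 2 - y * (ρ / m + a) + b - y * (ρ / (ρ + M)) * (1 / β) +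
            y * (ρ / (ρ + M)) * ((m - 1) / m * y) := by ring
        rw [e7]
        linarith) t (min_le_right _ _) (by linarith)
    linarith
  -- growth of ρ
  have hgrow : ∃ t, x t < δ * psi c β t := by
    by_contra hcon
    push Not at hcon
    set η := (m - 1) / m * (k / (1 / δ + M)) - 1 / β with hη
    have hη0 : 0 < η := by
      have := P.hβM
      rw [hη, sub_pos, div_lt_iff₀ (by linarith)]
      linarith
    have key : ∀ t, 0 ≤ t → Real.log (x t) + t / β + η * t ≤ Real.log (x 0) + 0 / β + η * 0 := by
      intro t ht
      refine anti_of_deriv (g := fun t => Real.log (x t) + t / β + η * t) ht (fun r _ _ =>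
        ((((h (r + 1)).dx r (by linarith)).log (hx r).ne').add ((hasDerivAt_id r).div_const β)).add
          ((hasDerivAt_id r).const_mul η)) ?_
      intro r _ _
      have hxr := hx r
      have hpr := hp r
      have i1 : psi c β r / x r ≤ 1 / δ := by
        rw [div_le_div_iff₀ hxr hδ]
        linarith [hcon r]
      have i2 : k / (1 / δ + M) ≤ Y r / x r := by
        refine le_trans ?_ (hylow r).le
        apply div_le_div_of_nonneg_left hk0.le (by positivity)
        linarith
      have i3 : (m - 1) / m * (k / (1 / δ + M)) ≤ (m - 1) / m * (Y r / x r) := by gcongr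
      have e : -((m - 1) / m * Y r) / x r = - ((m - 1) / m * (Y r / x r)) := by ring
      rw [e, hη]
      linarith
    have hlow : ∀ t, Real.log (δ * c) - t / β ≤ Real.log (x t) := by
      intro t
      have := Real.log_le_log (mul_pos hδ (hp t)) (hcon t)
      refine le_trans (le_of_eq ?_) this
      unfold psi
      rw [← mul_assoc, Real.log_mul (x := δ * c) (by positivity) (by positivity), Real.log_exp]
      ring
    have htend : Tendsto (fun s => η * s) atTop atTop := Tendsto.const_mul_atTop hη0 tendsto_id
    obtain ⟨s, hs1, hs2⟩ := ((htend.eventually_gt_atTop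
      (Real.log (x 0) - Real.log (δ * c))).and (eventually_ge_atTop 0)).exists
    have h1 := key s hs2
    have h2 := hlow s
    norm_num at h1
    linarith
  obtain ⟨t, ht⟩ := hgrow
  have hxt := hx t
  have hpt := hp t
  have hρ : 1 / δ < psi c β t / x t := by
    rw [div_lt_div_iff₀ hδ hxt]; linarith
  have hρ0 : 0 < psi c β t / x t := by positivity
  refine ⟨t, ht, ?_, ?_⟩
  · have i1 := hylow t
    have i2 : 3 * M ≤ 1 / δ := by rw [le_div_iff₀ hδ]; exact P.hMδ
    rw [div_lt_div_iff₀ (by positivity) hxt] at i1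
    have e : psi c β t = psi c β t / x t * x t := by field_simp
    set ρ := psi c β t / x t with hρd
    have hYp : 0 < Y t := (h (t + 1)).Ypos P.toPar hc.le le_rfl t (by linarith)
    have i3 : Y t * (ρ + M) ≤ Y t * (4 / 3 * ρ) := by
      apply mul_le_mul_of_nonneg_left _ hYp.le
      linarith
    have i4 : k * x t * x t < Y t * (4 / 3 * ρ) * x t := mul_lt_mul_of_pos_right (by linarith) hxt
    rw [e]
    rw [hk] at i4
    nlinarith
  · have i1 := hyg t
    have i2 : 2 * g ≤ 1 / δ := by rw [le_div_iff₀ hδ]; exact P.hgδ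
    have i3 : 2 * (Y t / x t) < psi c β t / x t := by linarith
    rw [← mul_div_assoc, div_lt_div_iff_of_pos_right hxt] at i3
    exact i3

end
end SSP

namespace SSP

/-- relations between the constants -/
structure Con (n m p σ α β γ θ a b : ℝ) : Prop where
  hm : 1 < m
  hβ : 0 < β
  hα : α = γ * β
  hγβ : 2 - (m - 1) * γ = -(1 / β)
  hθ : (m - 1) * θ = m + p - 2
  hσ : σ + 2 = γ * (m - p)
  ha : a = 2 * m * γ + n - 2
  hb : b = m * γ * (m * γ + n - 2)

/-- solution of the generalized equation in terms of `u = f^m` -/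
structure USol (n m p σ α β ε κ R : ℝ) (u v : ℝ → ℝ) : Prop where
  upos : ∀ ξ, 0 < ξ → ξ < R → 0 < u ξ
  du : ∀ ξ, 0 < ξ → ξ < R → HasDerivAt u (v ξ) ξ
  dv : ∀ ξ, 0 < ξ → ξ < R → HasDerivAt v (-((n - 1) / ξ * v ξ) + ε * α * u ξ ^ (1 / m)
    - ε * β * ξ * (1 / m * u ξ ^ (1 / m - 1) * v ξ) - κ * ξ ^ σ * u ξ ^ (p / m)) ξ

noncomputable def xx (m γ : ℝ) (u : ℝ → ℝ) (t : ℝ) : ℝ :=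
  Real.exp ((m - 1) / m * Real.log (u (Real.exp t)) - γ * (m - 1) * t)

noncomputable def YY (m γ : ℝ) (u v : ℝ → ℝ) (t : ℝ) : ℝ :=
  xx m γ u t * (m * γ - Real.exp t * v (Real.exp t) / u (Real.exp t))

lemma xx_pos (m γ : ℝ) (u : ℝ → ℝ) (t : ℝ) : 0 < xx m γ u t := Real.exp_pos _

lemma USol.traj {n m p σ α β ε κ R γ θ a b : ℝ} {u v : ℝ → ℝ} (C : Con n m p σ α β γ θ a b)
    (hR : 0 < R) (h : USol n m p σ α β ε κ R u v) :
    Traj m a b β θ κ (ε * β) (Real.log R) (xx m γ u) (YY m γ u v) := by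
  have hm := C.hm
  have hm0 : 0 < m := by linarith
  have hβ := C.hβ
  have base : ∀ t, t < Real.log R → 0 < Real.exp t ∧ Real.exp t < R := fun t ht =>
    ⟨Real.exp_pos t, (Real.lt_log_iff_exp_lt hR).1 ht⟩
  have dx : ∀ t, t < Real.log R → HasDerivAt (xx m γ u) (-((m - 1) / m * YY m γ u v t)) t := by
    intro t ht
    obtain ⟨h1, h2⟩ := base t ht
    have hu := h.upos _ h1 h2
    have d1 : HasDerivAt (fun t => u (Real.exp t)) (v (Real.exp t) * Real.exp t) t :=
      (h.du _ h1 h2).comp t (Real.hasDerivAt_exp t)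
    have d2 := (((d1.log hu.ne').const_mul ((m - 1) / m)).sub
      ((hasDerivAt_id t).const_mul (γ * (m - 1)))).exp
    refine d2.congr_deriv ?_
    have e0 : Real.exp (((fun y => (m - 1) / m * Real.log (u (Real.exp y))) - fun y => γ * (m - 1) * id y) t)
      = xx m γ u t := rfl
    rw [e0]
    unfold YY
    field_simp
    ring
  refine ⟨fun t _ => xx_pos _ _ _ _, dx, ?_⟩
  intro t ht
  obtain ⟨h1, h2⟩ := base t ht
  have hu := h.upos _ h1 h2
  have d1 : HasDerivAt (fun t => u (Real.exp t)) (v (Real.exp t) * Real.exp t) t :=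
    (h.du _ h1 h2).comp t (Real.hasDerivAt_exp t)
  have d2 := (h.dv _ h1 h2).comp t (Real.hasDerivAt_exp t)
  have d3 := (dx t ht).mul ((hasDerivAt_const t (m * γ)).sub
    (((Real.hasDerivAt_exp t).mul d2).div d1 hu.ne'))
  refine d3.congr_deriv ?_
  have hxp := xx_pos m γ u t
  set ξ := Real.exp t with hξ
  have eU : u ξ = Real.exp (Real.log (u ξ)) := (Real.exp_log hu).symm
  -- algebraic relations
  have e1 : xx m γ u t * (ξ ^ 2 * u ξ ^ (1 / m - 1)) = Real.exp (-(t / β)) := by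
    rw [Real.rpow_def_of_pos hu, hξ, ← Real.exp_nat_mul, ← Real.exp_add]
    unfold xx
    rw [← Real.exp_add, ← hξ]
    congr 1
    have : t / β = - (2 - (m - 1) * γ) * t := by rw [C.hγβ]; ring
    rw [this]
    field_simp
    push_cast
    ring
  have e2 : xx m γ u t ^ θ = xx m γ u t ^ 2 * (ξ ^ 2 * ξ ^ σ * (u ξ ^ (p / m) / u ξ)) := by
    rw [← Real.rpow_sub_one hu.ne', Real.rpow_def_of_pos hu, Real.rpow_def_of_pos hxp, hξ,
      ← Real.exp_mul, ← Real.exp_nat_mul, ← Real.exp_add, ← Real.exp_add]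
    unfold xx
    rw [← Real.exp_nat_mul, ← Real.exp_add, ← hξ, Real.log_exp]
    congr 1
    have h3 := C.hθ
    have h4 : σ = γ * (m - p) - 2 := by linarith [C.hσ]
    rw [h4]
    have : ((m - 1) / m * Real.log (u ξ) - γ * (m - 1) * t) * θ =
      ((m - 1) * θ) * (Real.log (u ξ) / m - γ * t) := by field_simp
    rw [this, h3]
    field_simp
    push_cast
    ring
  have e3 : u ξ ^ (1 / m) = u ξ ^ (1 / m - 1) * u ξ := by
    rw [Real.rpow_sub_one hu.ne']; field_simp
  have e4 : psi (ε * β) β t = ε * β * (xx m γ u t * (ξ ^ 2 * u ξ ^ (1 / m - 1))) := by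
    rw [e1]; rfl
  simp only [Function.comp]
  rw [e2, e4, e3, C.ha, C.hb, C.hα]
  simp only [YY, ← hξ, Pi.sub_apply, Pi.mul_apply, Pi.div_apply, Function.comp]
  set X := xx m γ u t
  set z := u ξ ^ (1 / m - 1)
  set z2 := u ξ ^ (p / m)
  set z3 := ξ ^ σ
  have hξ0 : ξ ≠ 0 := h1.ne'
  field_simp
  ring

end SSP

namespace SSP

lemma constants (m p : ℝ) (N : ℕ) (hm : 1 < m) (_hp0 : 0 < p) (hp1 : p < 1) (hN : 1 ≤ N)
    (hmp : 2 ≤ m + p) :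
    ∃ σ0 : ℝ, 2 * (1 - p) / (m - 1) < σ0 ∧
      ∀ σ : ℝ, 2 * (1 - p) / (m - 1) < σ → σ < σ0 →
        ∃ γ θ a b δ M : ℝ, Con (N : ℝ) m p σ (alphaC m p σ) (betaC m p σ) γ θ a b ∧
          Small2 m a b (betaC m p σ) θ δ (m * γ) M ∧ (m - 1) * (1 - θ) = 1 - p ∧ 0 < γ ∧
          γ = (σ + 2) / (m - p) := by
  have hm1 : 0 < m - 1 := by linarith
  have hmp' : 0 < m - p := by linarith
  have hp' : 0 < 1 - p := by linarith
  have hN' : (1:ℝ) ≤ N := by exact_mod_cast hN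
  obtain ⟨σc, hσc⟩ : ∃ z : ℝ, z = 2 * (1 - p) / (m - 1) := ⟨_, rfl⟩
  have hσc0 : 0 < σc := by rw [hσc]; positivity
  have hσcm : σc * (m - 1) = 2 * (1 - p) := by rw [hσc]; field_simp
  obtain ⟨Γ, hΓ⟩ : ∃ z : ℝ, z = (σc + 3) / (m - p) := ⟨_, rfl⟩
  have hΓ0 : 0 < Γ := by rw [hΓ]; positivity
  obtain ⟨A, hA⟩ : ∃ z : ℝ, z = 2 * m * Γ + N := ⟨_, rfl⟩
  have hA0 : 0 < A := by rw [hA]; positivity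
  obtain ⟨B, hB⟩ : ∃ z : ℝ, z = m * Γ * (m * Γ + N) := ⟨_, rfl⟩
  have hB0 : 0 < B := by rw [hB]; positivity
  obtain ⟨M, hM⟩ : ∃ z : ℝ, z = A * m + 4 * m + m * B := ⟨_, rfl⟩
  have hM0 : 0 < M := by rw [hM]; positivity
  obtain ⟨K, hK⟩ : ∃ z : ℝ, z = 1 + 4 * (A * m) + 4 * m + 16 * m * B + 3 * M + 2 * (m * Γ) := ⟨_, rfl⟩
  have hK0 : 0 < K := by rw [hK]; positivity
  obtain ⟨δ, hδ⟩ : ∃ z : ℝ, z = 1 / K := ⟨_, rfl⟩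
  have hδ0 : 0 < δ := by rw [hδ]; positivity
  have hle : ∀ z, z ≤ K → z * δ ≤ 1 := by
    intro z hz
    rw [hδ, mul_one_div, div_le_one hK0]; exact hz
  have q1 : 0 < A * m := by positivity
  have q2 : 0 < 16 * m * B := by positivity
  have q3 : 0 < m * Γ := by positivity
  have hm0 : 0 < m := by linarith
  obtain ⟨z3, hz3⟩ : ∃ z : ℝ, z = (m - 1) / m * (2 / 3 * m * 1 / (1 / δ + M)) := ⟨_, rfl⟩
  have hz30 : 0 < z3 := by rw [hz3]; positivity
  obtain ⟨βs, hβs⟩ : ∃ z : ℝ, z = 1 + 2 / ((m - 1) * δ) + 256 * m / (1 - p) + 1 / z3 := ⟨_, rfl⟩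
  have r1 : 0 < 2 / ((m - 1) * δ) := by positivity
  have r2 : 0 < 256 * m / (1 - p) := by positivity
  have r3 : 0 < 1 / z3 := by positivity
  have hβs0 : 0 < βs := by rw [hβs]; positivity
  rw [← hσc]
  refine ⟨σc + min 1 ((m - p) / ((m - 1) * βs)), by
    have : 0 < min 1 ((m - p) / ((m - 1) * βs)) := lt_min one_pos (by positivity)
    linarith, ?_⟩
  intro σ h1 h2
  have hσ1 : σ < σc + 1 := by
    have := min_le_left 1 ((m - p) / ((m - 1) * βs)); linarith
  have hσ2 : σ - σc < (m - p) / ((m - 1) * βs) := by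
    have := min_le_right 1 ((m - p) / ((m - 1) * βs)); linarith
  obtain ⟨L, hL⟩ : ∃ z : ℝ, z = σ * (m - 1) + 2 * (p - 1) := ⟨_, rfl⟩
  have hL' : L = (σ - σc) * (m - 1) := by rw [hL]; linear_combination hσcm
  have hL0 : 0 < L := by rw [hL']; apply mul_pos <;> linarith
  have hβL : betaC m p σ = (m - p) / L := by rw [hL]; rfl
  have hαL : alphaC m p σ = (σ + 2) / L := by rw [hL]; rfl
  have hββ : βs < betaC m p σ := by
    rw [hβL, lt_div_iff₀ hL0, hL']
    rw [lt_div_iff₀ (by positivity)] at hσ2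
    linarith
  generalize betaC m p σ = β at *
  obtain ⟨γ, hγ⟩ : ∃ z : ℝ, z = (σ + 2) / (m - p) := ⟨_, rfl⟩
  obtain ⟨θ, hθ⟩ : ∃ z : ℝ, z = (m + p - 2) / (m - 1) := ⟨_, rfl⟩
  have hγ0 : 0 < γ := by
    have : 0 < σ + 2 := by linarith
    rw [hγ]; positivity
  have hγΓ : γ ≤ Γ := by
    rw [hγ, hΓ, div_le_div_iff_of_pos_right hmp']; linarith
  have hθm : (m - 1) * θ = m + p - 2 := by rw [hθ]; field_simp
  have h1θ : (m - 1) * (1 - θ) = 1 - p := by linear_combination (-1) * hθm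
  have hg2 : 2 < m * γ := by
    rw [hγ, ← mul_div_assoc, lt_div_iff₀ hmp']
    have : 0 < m * σ := by
      have : 0 < σ := by linarith
      positivity
    linarith
  have hgΓ : m * γ ≤ m * Γ := by gcongr
  have hβ0 : 0 < β := hβs0.trans hββ
  have hb2 : 2 ≤ m * γ * (m * γ + N - 2) := by
    have : 2 * 1 ≤ m * γ * (m * γ + N - 2) := by gcongr; linarith
    linarith
  have hbB : m * γ * (m * γ + N - 2) ≤ B := by
    rw [hB]
    apply mul_le_mul hgΓ (by linarith) (by linarith) (by positivity)
  have haA : 2 * m * γ + N - 2 ≤ A := by rw [hA]; linarith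
  have ha0 : 0 < 2 * m * γ + N - 2 := by linarith
  refine ⟨γ, θ, 2 * m * γ + N - 2, m * γ * (m * γ + N - 2), δ, M, ?_, ?_, h1θ, hγ0, hγ⟩
  · refine ⟨hm, hβ0, ?_, ?_, hθm, ?_, rfl, rfl⟩
    · rw [hαL, hγ, hβL]; field_simp
    · rw [hβL, hγ, one_div_div]
      field_simp
      rw [hL]; ring
    · rw [hγ]; field_simp
  · obtain ⟨b, hb⟩ : ∃ z : ℝ, z = m * γ * (m * γ + N - 2) := ⟨_, rfl⟩
    obtain ⟨a, ha⟩ : ∃ z : ℝ, z = 2 * m * γ + N - 2 := ⟨_, rfl⟩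
    rw [← hb, ← ha]
    rw [← hb] at hb2 hbB
    rw [← ha] at haA ha0
    have hδ1 : δ ≤ 1 := by have := hle 1 (by rw [hK]; linarith); linarith
    have s1 := hle (4 * (A * m)) (by rw [hK]; linarith)
    have s2 := hle (4 * m) (by rw [hK]; linarith)
    have s3 := hle (16 * m * B) (by rw [hK]; linarith)
    have s4 := hle (3 * M) (by rw [hK]; linarith)
    have s5 := hle (2 * (m * Γ)) (by rw [hK]; linarith)
    have haδ : a * m * δ ≤ A * m * δ := by gcongr
    have hamM : a * m ≤ A * m := by gcongr
    have hmB : m * b ≤ m * B := by gcongr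
    have hmB0 : 0 < m * B := by positivity
    refine ⟨⟨⟨hm, ha0, by linarith, by linarith, ?_, ?_⟩, hδ0, hδ1, by linarith, by linarith, ?_, ?_, ?_⟩,
      by linarith, ?_, ?_, ?_, ?_, s4, ?_, ?_⟩
    · rw [hθ]; apply div_nonneg <;> linarith
    · rw [hθ, div_lt_one hm1]; linarith
    · have e1 : 16 * m * b * δ ^ 2 ≤ 16 * m * B * δ ^ 2 := by gcongr
      have e2 : 16 * m * B * δ ^ 2 = (16 * m * B * δ) * δ := by ring
      have e3 : (16 * m * B * δ) * δ ≤ 1 * 1 := by gcongr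
      linarith
    · have : 2 / ((m - 1) * δ) < β := by linarith
      rw [div_lt_iff₀ (by positivity)] at this
      linarith
    · rw [h1θ]
      have : 256 * m / (1 - p) < β := by linarith
      rwa [div_lt_iff₀ (by positivity)] at this
    · rw [hb, ha]; ring
    · linarith
    · linarith
    · have : 2 / 3 * m * b / M < 1 := by
        rw [div_lt_one hM0]
        linarith
      linarith
    · have : 2 * (m * γ) * δ ≤ 2 * (m * Γ) * δ := by gcongr
      linarith
    · have t1 : 1 / z3 < β := by linarith
      rw [div_lt_iff₀ hz30] at t1
      have t2 : z3 ≤ (m - 1) / m * (2 / 3 * m * b / (1 / δ + M)) := by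
        rw [hz3]; gcongr; linarith
      calc 1 < β * z3 := t1
        _ ≤ _ := by gcongr

/-- conversion of the asymptotics at the interface -/
lemma type_conv {f : ℝ → ℝ} {γ q k ξ0 : ℝ} (hξ0 : 0 < ξ0) (hq : 0 < q) (hk : 0 < k)
    (hf : ∀ ξ ∈ Ioo 0 ξ0, 0 < f ξ)
    (h : Tendsto (fun t => f (Real.exp t) ^ q * Real.exp (-(γ * q * t)) / (Real.log ξ0 - t))
      (𝓝[<] (Real.log ξ0)) (𝓝 k)) :
    ∃ c, 0 < c ∧ Tendsto (fun ξ => f ξ * (ξ0 - ξ) ^ (-(1 / q))) (𝓝[<] ξ0) (𝓝 c) := by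
  have hlog : Tendsto Real.log (𝓝[<] ξ0) (𝓝[<] (Real.log ξ0)) := by
    refine tendsto_nhdsWithin_iff.2 ⟨(Real.continuousAt_log hξ0.ne').tendsto.mono_left nhdsWithin_le_nhds, ?_⟩
    filter_upwards [Ioo_mem_nhdsLT hξ0] with ξ hξ using Real.log_lt_log hξ.1 hξ.2
  have h1 := h.comp hlog
  have h2 : Tendsto (fun ξ => (Real.log ξ0 - Real.log ξ) / (ξ0 - ξ)) (𝓝[<] ξ0) (𝓝 (ξ0⁻¹)) := by
    have := (hasDerivAt_iff_tendsto_slope.1 (Real.hasDerivAt_log hξ0.ne')).mono_left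
      (nhdsWithin_mono ξ0 (fun s (hs : s < ξ0) => ne_of_lt hs))
    refine this.congr ?_
    intro ξ
    rw [slope_def_field, ← neg_sub (Real.log ξ0), ← neg_sub ξ0, neg_div_neg_eq]
  have h3 : Tendsto (fun ξ => Real.exp (γ * q * Real.log ξ)) (𝓝[<] ξ0) (𝓝 (Real.exp (γ * q * Real.log ξ0))) := by
    have : ContinuousAt (fun ξ => Real.exp (γ * q * Real.log ξ)) ξ0 := by
      have := Real.continuousAt_log hξ0.ne'
      fun_prop
    exact this.tendsto.mono_left nhdsWithin_le_nhds
  set k' := k * ξ0⁻¹ * Real.exp (γ * q * Real.log ξ0) with hk'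
  have hk'0 : 0 < k' := by positivity
  have h4 : Tendsto (fun ξ => f ξ ^ q / (ξ0 - ξ)) (𝓝[<] ξ0) (𝓝 k') := by
    refine ((h1.mul h2).mul h3).congr' ?_
    filter_upwards [Ioo_mem_nhdsLT hξ0] with ξ hξ
    have a1 : Real.log ξ0 - Real.log ξ ≠ 0 := by
      have := Real.log_lt_log hξ.1 hξ.2; linarith
    have a2 : ξ0 - ξ ≠ 0 := by have := hξ.2; linarith
    simp only [Function.comp, Real.exp_log hξ.1]
    have e : Real.exp (-(γ * q * Real.log ξ)) * Real.exp (γ * q * Real.log ξ) = 1 := by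
      rw [← Real.exp_add]; simp
    field_simp
    linear_combination (f ξ ^ q) * e
  refine ⟨k' ^ (1 / q), Real.rpow_pos_of_pos hk'0 _, ?_⟩
  have h5 := h4.rpow_const (p := 1 / q) (Or.inl hk'0.ne')
  refine h5.congr' ?_
  filter_upwards [Ioo_mem_nhdsLT hξ0] with ξ hξ
  have hfξ := hf ξ hξ
  have a2 : 0 < ξ0 - ξ := by have := hξ.2; linarith
  rw [Real.div_rpow (by positivity) a2.le, ← Real.rpow_mul hfξ.le, mul_one_div_cancel hq.ne', Real.rpow_one,
    Real.rpow_neg a2.le, div_eq_mul_inv]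

end SSP

namespace SSP

lemma usol_of_profile {N : ℕ} {m p σ ξ0 : ℝ} {f : ℝ → ℝ} (hm : 1 < m)
    (h : ProfileWithInterface N m p σ f ξ0) :
    USol (N : ℝ) m p σ (alphaC m p σ) (betaC m p σ) 1 1 ξ0 (fun x => f x ^ m)
      (deriv fun x => f x ^ m) := by
  obtain ⟨h0, hc, hpos, hC, hode, -, -⟩ := h
  have hm0 : 0 < m := by linarith
  have hCu : ContDiffOn ℝ 2 (fun x => f x ^ m) (Ioo 0 ξ0) :=
    hC.rpow_const_of_ne (fun x hx => (hpos x hx).ne')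
  have hCv : ContDiffOn ℝ 1 (deriv fun x => f x ^ m) (Ioo 0 ξ0) :=
    hCu.deriv_of_isOpen isOpen_Ioo (by norm_num)
  refine ⟨fun ξ a b => Real.rpow_pos_of_pos (hpos ξ ⟨a, b⟩) _, ?_, ?_⟩
  · intro ξ a b
    exact ((hCu.differentiableOn (by norm_num)).differentiableAt (Ioo_mem_nhds a b)).hasDerivAt
  · intro ξ a b
    have hf := hpos ξ ⟨a, b⟩
    have d1 := ((hCv.differentiableOn (by norm_num)).differentiableAt (Ioo_mem_nhds a b)).hasDerivAt
    have d2 := ((hC.differentiableOn (by norm_num)).differentiableAt (Ioo_mem_nhds a b)).hasDerivAt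
    have d3 := d2.rpow_const (p := m) (Or.inl hf.ne')
    refine d1.congr_deriv ?_
    have e := hode ξ ⟨a, b⟩
    unfold SSODE at e
    have e1 : (f ξ ^ m) ^ (1 / m) = f ξ := by
      rw [← Real.rpow_mul hf.le, mul_one_div_cancel hm0.ne', Real.rpow_one]
    have e2 : (f ξ ^ m) ^ (p / m) = f ξ ^ p := by
      rw [← Real.rpow_mul hf.le]; congr 1; field_simp
    have e3 : 1 / m * (f ξ ^ m) ^ (1 / m - 1) * deriv (fun x => f x ^ m) ξ = deriv f ξ := by
      rw [d3.deriv, ← Real.rpow_mul hf.le]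
      have : f ξ ^ (m * (1 / m - 1)) * f ξ ^ (m - 1) = 1 := by
        rw [← Real.rpow_add hf]
        have : m * (1 / m - 1) + (m - 1) = 0 := by field_simp; ring
        rw [this, Real.rpow_zero]
      generalize f ξ ^ (m * (1 / m - 1)) = z at *
      field_simp
      linear_combination (deriv f ξ) * this
    simp only [e1, e2, e3]
    linear_combination e

lemma xx_rpow {m γ q : ℝ} (hm : 1 < m) {f : ℝ → ℝ} {t : ℝ} (hf : 0 < f (Real.exp t)) :
    xx m γ (fun x => f x ^ m) t ^ (q / (m - 1)) = f (Real.exp t) ^ q * Real.exp (-(γ * q * t)) := by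
  have hm1 : 0 < m - 1 := by linarith
  unfold xx
  rw [← Real.exp_mul, Real.log_rpow hf, Real.rpow_def_of_pos hf, ← Real.exp_add]
  congr 1
  field_simp
  ring

lemma xx_tendsto_zero {m γ ξ0 : ℝ} (hm : 1 < m) {f : ℝ → ℝ} (h0 : 0 < ξ0)
    (hc : ContinuousOn f (Icc 0 ξ0)) (hpos : ∀ ξ ∈ Ioo 0 ξ0, 0 < f ξ) (hf0 : f ξ0 = 0) :
    Tendsto (xx m γ (fun x => f x ^ m)) (𝓝[<] (Real.log ξ0)) (𝓝 0) := by
  have hm1 : 0 < m - 1 := by linarith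
  have hexp : Tendsto Real.exp (𝓝[<] (Real.log ξ0)) (𝓝[<] ξ0) := by
    refine tendsto_nhdsWithin_iff.2 ⟨?_, ?_⟩
    · have := (Real.continuous_exp.tendsto (Real.log ξ0)).mono_left
        (nhdsWithin_le_nhds (s := Iio (Real.log ξ0)))
      rwa [Real.exp_log h0] at this
    · filter_upwards [self_mem_nhdsWithin] with t ht
      exact (Real.lt_log_iff_exp_lt h0).1 ht
  have hf : Tendsto f (𝓝[<] ξ0) (𝓝 0) := by
    have := (hc ξ0 ⟨h0.le, le_rfl⟩).tendsto
    rw [hf0] at this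
    refine this.mono_left ?_
    rw [← nhdsWithin_Ioo_eq_nhdsLT h0]
    exact nhdsWithin_mono _ Ioo_subset_Icc_self
  have h1 := (hf.comp hexp).rpow_const (p := m - 1) (Or.inr hm1.le)
  have h2 : Tendsto (fun t => Real.exp (-(γ * (m - 1) * t))) (𝓝[<] (Real.log ξ0))
      (𝓝 (Real.exp (-(γ * (m - 1) * Real.log ξ0)))) :=
    ((by fun_prop : Continuous fun t => Real.exp (-(γ * (m - 1) * t))).tendsto _).mono_left
      nhdsWithin_le_nhds
  have h3 := h1.mul h2
  rw [Real.zero_rpow hm1.ne', zero_mul] at h3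
  refine h3.congr' ?_
  filter_upwards [self_mem_nhdsWithin] with t ht
  have := xx_rpow (γ := γ) (q := m - 1) hm (hpos _ ⟨Real.exp_pos t, (Real.lt_log_iff_exp_lt h0).1 ht⟩)
  rw [div_self hm1.ne', Real.rpow_one] at this
  rw [this]; rfl

lemma exp_tendsto_right : Tendsto Real.exp atBot (𝓝[>] 0) :=
  tendsto_nhdsWithin_iff.2 ⟨Real.tendsto_exp_atBot, Eventually.of_forall fun t => Real.exp_pos t⟩

theorem part_one {N : ℕ} {m p σ γ θ a b δ M : ℝ} (hp1 : p < 1) (hN : 1 ≤ N)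
    (C : Con (N : ℝ) m p σ (alphaC m p σ) (betaC m p σ) γ θ a b)
    (S : Small2 m a b (betaC m p σ) θ δ (m * γ) M) (hθ : (m - 1) * (1 - θ) = 1 - p)
    (hγ : γ = (σ + 2) / (m - p)) (f : ℝ → ℝ) (ξ0 : ℝ) (hP : ProfileWithInterface N m p σ f ξ0)
    (hB : BehB2 N m f ∨ BehB3 m p σ f) : TypeII p f ξ0 := by
  have hm := C.hm
  have hm1 : 0 < m - 1 := by linarith
  have hβ := C.hβ
  have hU := usol_of_profile hm hP
  obtain ⟨h0, hc, hpos, hC, hode, hf0, -⟩ := hP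
  have hT := hU.traj C h0
  rw [one_mul] at hT
  have hx0 := xx_tendsto_zero (γ := γ) hm h0 hc hpos hf0
  have hposev : ∀ᶠ t in atBot, 0 < f (Real.exp t) := by
    filter_upwards [eventually_lt_atBot (Real.log ξ0)] with t ht
    exact hpos _ ⟨Real.exp_pos t, (Real.lt_log_iff_exp_lt h0).1 ht⟩
  have hev : ∀ᶠ t in atBot, xx m γ (fun x => f x ^ m) t < δ * psi (betaC m p σ) (betaC m p σ) t := by
    rcases hB with ⟨-, hB⟩ | ⟨-, K, hK, hB⟩
    · have h1 := ((hB.comp exp_tendsto_right).rpow_const (p := m - 1) (Or.inr hm1.le))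
      have hN' : (1:ℝ) ≤ N := by exact_mod_cast hN
      have hq : 0 < m * (N:ℝ) - N + 2 := by nlinarith
      have hm0 : 0 < m := by linarith
      rw [← Real.rpow_mul (by positivity), one_div_mul_cancel hm1.ne', Real.rpow_one] at h1
      have hlt : (m - 1) / (2 * m * (m * (N:ℝ) - N + 2)) < δ * betaC m p σ := by
        have e1 : 2 / (m - 1) < δ * betaC m p σ := by
          rw [div_lt_iff₀ hm1]; linarith [S.hβδ]
        refine lt_trans ?_ e1
        rw [div_lt_div_iff₀ (by positivity) hm1]
        have : m + 1 ≤ m * (N:ℝ) - N + 2 := by nlinarith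
        have : 2 * m * (m + 1) ≤ 2 * m * (m * (N:ℝ) - N + 2) := by gcongr
        nlinarith
      filter_upwards [h1.eventually_lt_const hlt, hposev] with t h2 h3
      have h4 := xx_rpow (γ := γ) (q := m - 1) hm h3
      rw [div_self hm1.ne', Real.rpow_one] at h4
      rw [h4]
      simp only [Function.comp] at h2
      rw [Real.mul_rpow h3.le (by positivity), ← Real.rpow_mul (by positivity)] at h2
      have e2 : -(2 / (m - 1)) * (m - 1) = -2 := by field_simp
      rw [e2, ← Real.exp_mul] at h2
      have e3 : Real.exp (-(γ * (m - 1) * t)) = Real.exp (t * (-2)) * Real.exp (-(t / betaC m p σ)) := by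
        rw [← Real.exp_add]; congr 1
        have := C.hγβ
        have e4 : γ * (m - 1) = 2 + 1 / betaC m p σ := by linarith
        rw [e4]; ring
      rw [e3, ← mul_assoc]
      unfold psi
      rw [← mul_assoc]
      exact mul_lt_mul_of_pos_right h2 (Real.exp_pos _)
    · have h1 := ((hB.comp exp_tendsto_right).rpow_const (p := m - 1) (Or.inr hm1.le))
      have h2 := (psi_atBot hβ hβ).const_mul_atTop S.hδ0
      filter_upwards [h1.eventually_lt_const (lt_add_one _), hposev,
        h2.eventually_gt_atTop (K ^ (m - 1) + 1)] with t h2 h3 h5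
      have h4 := xx_rpow (γ := γ) (q := m - 1) hm h3
      rw [div_self hm1.ne', Real.rpow_one] at h4
      rw [h4]
      simp only [Function.comp] at h2
      rw [Real.mul_rpow h3.le (by positivity), ← Real.rpow_mul (by positivity), ← Real.exp_mul, ← hγ] at h2
      have e3 : t * (-γ * (m - 1)) = -(γ * (m - 1) * t) := by ring
      rw [e3] at h2
      linarith
  obtain ⟨t0, ht0⟩ := eventually_atBot.1 hev
  obtain ⟨t1, ht1, hM⟩ := Traj.trapped S.toSmall hβ hT
    (t₀ := min t0 (Real.log ξ0 - 1)) ((min_le_right _ _).trans_lt (by linarith))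
    (fun t ht => ht0 t (ht.trans (min_le_left _ _)))
  obtain ⟨k, hk, hlim⟩ := Traj.typeII S.toPar hβ hT hx0 ht1 hM
  have hq : 0 < 1 - p := by linarith
  refine type_conv (γ := γ) (q := 1 - p) h0 hq hk hpos (hlim.congr' ?_)
  filter_upwards [self_mem_nhdsWithin] with t ht
  have := xx_rpow (γ := γ) (q := 1 - p) hm (hpos _ ⟨Real.exp_pos t, (Real.lt_log_iff_exp_lt h0).1 ht⟩)
  rw [← this]
  have e : 1 - θ = (1 - p) / (m - 1) := by rw [← hθ]; field_simp
  rw [e]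

end SSP

namespace SSP

/-- the Volterra right-hand side, inner integral -/
noncomputable def vin (g : ℝ → ℝ → ℝ → ℝ → ℝ) (u : ℝ → ℝ) (η : ℝ) : ℝ :=
  ∫ ζ in (0:ℝ)..1, g η ζ (u (η * ζ)) (u η)

lemma vin_cont {S : Type*} [TopologicalSpace S] {G : S → ℝ → ℝ → ℝ → ℝ → ℝ}
    (hG : Continuous fun z : S × ℝ × ℝ × ℝ × ℝ => G z.1 z.2.1 z.2.2.1 z.2.2.2.1 z.2.2.2.2)
    {U : S → ℝ → ℝ} (hU : Continuous (Function.uncurry U)) :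
    Continuous (fun z : S × ℝ => vin (G z.1) (U z.1) z.2) := by
  unfold vin
  refine intervalIntegral.continuous_parametric_intervalIntegral_of_continuous' (μ := MeasureTheory.volume)
    (f := fun (z : S × ℝ) ζ => G z.1 z.2 ζ (U z.1 (z.2 * ζ)) (U z.1 z.2)) ?_ 0 1
  have h1 : Continuous fun w : (S × ℝ) × ℝ => U w.1.1 (w.1.2 * w.2) :=
    hU.comp (by fun_prop : Continuous fun w : (S × ℝ) × ℝ => (w.1.1, w.1.2 * w.2))
  have h2 : Continuous fun w : (S × ℝ) × ℝ => U w.1.1 w.1.2 :=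
    hU.comp (by fun_prop : Continuous fun w : (S × ℝ) × ℝ => (w.1.1, w.1.2))
  exact hG.comp (by fun_prop : Continuous fun w : (S × ℝ) × ℝ =>
    (w.1.1, w.1.2, w.2, U w.1.1 (w.1.2 * w.2), U w.1.1 w.1.2))

lemma vout_cont {S : Type*} [TopologicalSpace S] {G : S → ℝ → ℝ → ℝ → ℝ → ℝ}
    (hG : Continuous fun z : S × ℝ × ℝ × ℝ × ℝ => G z.1 z.2.1 z.2.2.1 z.2.2.2.1 z.2.2.2.2)
    {U : S → ℝ → ℝ} (hU : Continuous (Function.uncurry U)) :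
    Continuous (fun z : S × ℝ => ∫ η in (0:ℝ)..z.2, vin (G z.1) (U z.1) η) := by
  refine intervalIntegral.continuous_parametric_intervalIntegral_of_continuous (μ := MeasureTheory.volume)
    (f := fun (z : S × ℝ) η => vin (G z.1) (U z.1) η) ?_ continuous_snd
  exact (vin_cont hG hU).comp (by fun_prop : Continuous fun w : (S × ℝ) × ℝ => (w.1.1, w.2))

lemma vin_cont' {g : ℝ → ℝ → ℝ → ℝ → ℝ}
    (hg : Continuous fun z : ℝ × ℝ × ℝ × ℝ => g z.1 z.2.1 z.2.2.1 z.2.2.2)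
    {u : ℝ → ℝ} (hu : Continuous u) : Continuous (vin g u) := by
  have := vin_cont (S := Unit) (G := fun _ => g) (by fun_prop) (U := fun _ => u) (by
    exact hu.comp continuous_snd)
  exact this.comp (by fun_prop : Continuous fun η : ℝ => ((), η))

/-- Lipschitz hypothesis -/
def VLip (g : ℝ → ℝ → ℝ → ℝ → ℝ) (R K : ℝ) : Prop :=
  ∀ η ∈ Icc 0 R, ∀ ζ ∈ Icc (0:ℝ) 1, ∀ p q p' q' D : ℝ, |p - p'| ≤ D → |q - q'| ≤ D →
    |g η ζ p q - g η ζ p' q'| ≤ K * D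

lemma vest {g : ℝ → ℝ → ℝ → ℝ → ℝ}
    (hg : Continuous fun z : ℝ × ℝ × ℝ × ℝ => g z.1 z.2.1 z.2.2.1 z.2.2.2)
    {R K : ℝ} (hK : 0 < K) (hL : VLip g R K) {u₁ u₂ : ℝ → ℝ} (h1 : Continuous u₁) (h2 : Continuous u₂)
    {D : ℝ} (hD : 0 ≤ D) (h : ∀ η ∈ Icc 0 R, |u₁ η - u₂ η| ≤ D * Real.exp (2 * K * η)) :
    ∀ ξ ∈ Icc 0 R, |(∫ η in (0:ℝ)..ξ, vin g u₁ η) - ∫ η in (0:ℝ)..ξ, vin g u₂ η|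
      ≤ D / 2 * Real.exp (2 * K * ξ) := by
  intro ξ hξ
  have c1 := vin_cont' hg h1
  have c2 := vin_cont' hg h2
  have hin : ∀ η ∈ Icc 0 R, |vin g u₁ η - vin g u₂ η| ≤ K * (D * Real.exp (2 * K * η)) := by
    intro η hη
    unfold vin
    have i1 : Continuous fun ζ => g η ζ (u₁ (η * ζ)) (u₁ η) :=
      hg.comp (by fun_prop : Continuous fun ζ : ℝ => (η, ζ, u₁ (η * ζ), u₁ η))
    have i2 : Continuous fun ζ => g η ζ (u₂ (η * ζ)) (u₂ η) :=
      hg.comp (by fun_prop : Continuous fun ζ : ℝ => (η, ζ, u₂ (η * ζ), u₂ η))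
    rw [← intervalIntegral.integral_sub (i1.intervalIntegrable _ _) (i2.intervalIntegrable _ _)]
    have := intervalIntegral.norm_integral_le_of_norm_le_const (a := (0:ℝ)) (b := 1)
      (f := fun ζ => g η ζ (u₁ (η * ζ)) (u₁ η) - g η ζ (u₂ (η * ζ)) (u₂ η))
      (C := K * (D * Real.exp (2 * K * η))) (by
        intro ζ hζ
        rw [uIoc_of_le zero_le_one] at hζ
        rw [Real.norm_eq_abs]
        refine hL η hη ζ ⟨hζ.1.le, hζ.2⟩ _ _ _ _ _ ?_ (h η hη)
        have e : η * ζ ≤ η := mul_le_of_le_one_right hη.1 hζ.2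
        refine (h _ ⟨mul_nonneg hη.1 hζ.1.le, e.trans hη.2⟩).trans ?_
        gcongr)
    simpa using this
  rw [← intervalIntegral.integral_sub (c1.intervalIntegrable _ _) (c2.intervalIntegrable _ _)]
  have e1 : ∫ η in (0:ℝ)..ξ, K * (D * Real.exp (2 * K * η)) =
      D / 2 * Real.exp (2 * K * ξ) - D / 2 := by
    have : ∀ η ∈ uIcc 0 ξ, HasDerivAt (fun η => D / 2 * Real.exp (2 * K * η))
        (K * (D * Real.exp (2 * K * η))) η := by
      intro η _
      have := (((hasDerivAt_id η).const_mul (2 * K)).exp).const_mul (D / 2)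
      refine this.congr_deriv ?_
      simp
      ring
    rw [intervalIntegral.integral_eq_sub_of_hasDerivAt this
      ((by fun_prop : Continuous fun η => K * (D * Real.exp (2 * K * η))).intervalIntegrable _ _)]
    simp
  have := intervalIntegral.norm_integral_le_of_norm_le (a := (0:ℝ)) (b := ξ) (μ := MeasureTheory.volume)
    (f := fun η => vin g u₁ η - vin g u₂ η) (g := fun η => K * (D * Real.exp (2 * K * η))) hξ.1
    (Eventually.of_forall fun η hη => by
      rw [Real.norm_eq_abs]
      exact hin η ⟨hη.1.le, hη.2.trans hξ.2⟩)
    ((by fun_prop : Continuous fun η => K * (D * Real.exp (2 * K * η))).intervalIntegrable _ _)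
  rw [e1, Real.norm_eq_abs] at this
  linarith

lemma vunique {g : ℝ → ℝ → ℝ → ℝ → ℝ}
    (hg : Continuous fun z : ℝ × ℝ × ℝ × ℝ => g z.1 z.2.1 z.2.2.1 z.2.2.2)
    {R K : ℝ} (hR : 0 ≤ R) (hK : 0 < K) (hL : VLip g R K) {u₁ u₂ : ℝ → ℝ} (h1 : Continuous u₁) (h2 : Continuous u₂)
    (e1 : ∀ ξ ∈ Icc 0 R, u₁ ξ = 1 + ∫ η in (0:ℝ)..ξ, vin g u₁ η)
    (e2 : ∀ ξ ∈ Icc 0 R, u₂ ξ = 1 + ∫ η in (0:ℝ)..ξ, vin g u₂ η) :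
    ∀ ξ ∈ Icc 0 R, u₁ ξ = u₂ ξ := by
  obtain ⟨x, hx, hmax⟩ := isCompact_Icc.exists_isMaxOn (nonempty_Icc.2 hR)
    (f := fun ξ => |u₁ ξ - u₂ ξ| * Real.exp (-(2 * K * ξ))) (by fun_prop)
  set D := |u₁ x - u₂ x| * Real.exp (-(2 * K * x)) with hD
  have hD0 : 0 ≤ D := by positivity
  have hb : ∀ η ∈ Icc 0 R, |u₁ η - u₂ η| ≤ D * Real.exp (2 * K * η) := by
    intro η hη
    have : |u₁ η - u₂ η| * Real.exp (-(2 * K * η)) ≤ D := hmax hη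
    rw [Real.exp_neg, ← div_eq_mul_inv, div_le_iff₀ (Real.exp_pos _)] at this
    exact this
  have h3 := vest hg hK hL h1 h2 hD0 hb x hx
  have h4 : (u₁ x - u₂ x) = (∫ η in (0:ℝ)..x, vin g u₁ η) - ∫ η in (0:ℝ)..x, vin g u₂ η := by
    rw [e1 x hx, e2 x hx]; ring
  rw [← h4] at h3
  have h5 : D ≤ D / 2 := by
    rw [hD, Real.exp_neg, ← div_eq_mul_inv, div_le_iff₀ (Real.exp_pos _)]
    rw [hD, Real.exp_neg, ← div_eq_mul_inv] at h3
    exact h3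
  have h6 : D = 0 := by linarith
  intro ξ hξ
  have := hb ξ hξ
  rw [h6, zero_mul] at this
  have := abs_nonpos_iff.1 this
  linarith

theorem volterra {G : ℝ → ℝ → ℝ → ℝ → ℝ → ℝ}
    (hG : Continuous fun z : ℝ × ℝ × ℝ × ℝ × ℝ => G z.1 z.2.1 z.2.2.1 z.2.2.2.1 z.2.2.2.2)
    {R K : ℝ} (hR : 0 ≤ R) (hK : 0 < K) (hL : ∀ s ∈ Icc (0:ℝ) 1, VLip (G s) R K) :
    ∃ U : ℝ → ℝ → ℝ, Continuous (Function.uncurry U) ∧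
      ∀ s ∈ Icc (0:ℝ) 1, ∀ ξ ∈ Icc 0 R, U s ξ = 1 + ∫ η in (0:ℝ)..ξ, vin (G s) (U s) η := by
  let ext (w : C(Icc (0:ℝ) 1 × Icc (0:ℝ) R, ℝ)) (s ξ : ℝ) : ℝ :=
    Real.exp (2 * K * ξ) * w (projIcc 0 1 zero_le_one s, projIcc 0 R hR ξ)
  have extc : ∀ w, Continuous (Function.uncurry (ext w)) := by
    intro w
    have : Continuous fun z : ℝ × ℝ => (projIcc (0:ℝ) 1 zero_le_one z.1, projIcc 0 R hR z.2) :=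
      (continuous_projIcc.comp continuous_fst).prodMk (continuous_projIcc.comp continuous_snd)
    have h2 := w.continuous.comp this
    have h3 : Continuous fun z : ℝ × ℝ => Real.exp (2 * K * z.2) := by fun_prop
    exact h3.mul h2
  let Φ (w : C(Icc (0:ℝ) 1 × Icc (0:ℝ) R, ℝ)) : C(Icc (0:ℝ) 1 × Icc (0:ℝ) R, ℝ) :=
    ⟨fun k => Real.exp (-(2 * K * (k.2 : ℝ))) *
      (1 + ∫ η in (0:ℝ)..(k.2 : ℝ), vin (G k.1) (ext w k.1) η), by
      have h1 := (vout_cont hG (extc w)).comp (by fun_prop : Continuous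
        fun k : Icc (0:ℝ) 1 × Icc (0:ℝ) R => ((k.1 : ℝ), (k.2 : ℝ)))
      have h2 : Continuous fun k : Icc (0:ℝ) 1 × Icc (0:ℝ) R => Real.exp (-(2 * K * (k.2 : ℝ))) := by
        fun_prop
      exact h2.mul (continuous_const.add h1)⟩
  have hsec : ∀ w s, Continuous (ext w s) := fun w s =>
    (extc w).comp (by fun_prop : Continuous fun ξ : ℝ => (s, ξ))
  have hGs : ∀ s, Continuous fun z : ℝ × ℝ × ℝ × ℝ => G s z.1 z.2.1 z.2.2.1 z.2.2.2 := fun s =>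
    hG.comp (by fun_prop : Continuous fun z : ℝ × ℝ × ℝ × ℝ => (s, z.1, z.2.1, z.2.2.1, z.2.2.2))
  have hc : ContractingWith (1/2) Φ := by
    refine ⟨by rw [div_lt_one] <;> norm_num, LipschitzWith.of_dist_le_mul fun w₁ w₂ => ?_⟩
    have hd : 0 ≤ dist w₁ w₂ := dist_nonneg
    rw [ContinuousMap.dist_le (by positivity)]
    intro k
    have h1 := vest (hGs k.1) hK (hL k.1 k.1.2) (hsec w₁ k.1) (hsec w₂ k.1) hd (by
      intro η hη
      simp only [ext]
      rw [← mul_sub, abs_mul, abs_of_pos (Real.exp_pos _), mul_comm]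
      gcongr
      have := ContinuousMap.dist_apply_le_dist (f := w₁) (g := w₂)
        (projIcc 0 1 zero_le_one (k.1:ℝ), projIcc 0 R hR η)
      rwa [Real.dist_eq] at this) k.2 k.2.2
    simp only [Φ, ContinuousMap.coe_mk, Real.dist_eq]
    rw [← mul_sub, abs_mul, abs_of_pos (Real.exp_pos _), add_sub_add_left_eq_sub]
    calc _ ≤ Real.exp (-(2 * K * (k.2 : ℝ))) * (dist w₁ w₂ / 2 * Real.exp (2 * K * (k.2:ℝ))) := by gcongr
      _ = dist w₁ w₂ / 2 * (Real.exp (-(2 * K * (k.2 : ℝ))) * Real.exp (2 * K * (k.2:ℝ))) := by ring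
      _ = dist w₁ w₂ / 2 := by rw [← Real.exp_add]; simp
      _ = _ := by simp; ring
  obtain ⟨w, hw⟩ : ∃ w, Φ w = w := ⟨_, hc.fixedPoint_isFixedPt⟩
  refine ⟨ext w, extc w, ?_⟩
  intro s hs ξ hξ
  have h1 : w (⟨s, hs⟩, ⟨ξ, hξ⟩) = Real.exp (-(2 * K * ξ)) *
      (1 + ∫ η in (0:ℝ)..ξ, vin (G s) (ext w s) η) := by
    conv_lhs => rw [← hw]
    rfl
  have h2 : ext w s ξ = Real.exp (2 * K * ξ) * w (⟨s, hs⟩, ⟨ξ, hξ⟩) := by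
    simp only [ext, projIcc_of_mem _ hs, projIcc_of_mem _ hξ]
  rw [h2, h1, ← mul_assoc, ← Real.exp_add]
  simp

end SSP

namespace SSP

/-- truncated power -/
noncomputable def tr (τ r x : ℝ) : ℝ := max x τ ^ r

lemma tr_cont {τ r : ℝ} (hτ : 0 < τ) : Continuous (tr τ r) := by
  unfold tr
  refine Continuous.rpow_const (by fun_prop) (fun x => Or.inl ?_)
  exact (hτ.trans_le (le_max_right _ _)).ne'

lemma tr_eq {τ r x : ℝ} (h : τ ≤ x) : tr τ r x = x ^ r := by unfold tr; rw [max_eq_left h]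

lemma tr_lip {τ r : ℝ} (hτ : 0 < τ) (hr0 : 0 ≤ r) (hr : r ≤ 1) (x y : ℝ) :
    |tr τ r x - tr τ r y| ≤ r * τ ^ (r - 1) * |x - y| := by
  unfold tr
  have h1 : |max x τ - max y τ| ≤ |x - y| := abs_max_sub_max_le_abs x y τ
  have h2 := Convex.norm_image_sub_le_of_norm_hasDerivWithin_le (f := fun x => x ^ r)
    (f' := fun x => r * x ^ (r - 1)) (C := r * τ ^ (r - 1)) (s := Ici τ) (x := max y τ) (y := max x τ)
    (fun z hz => (Real.hasDerivAt_rpow_const (Or.inl (hτ.trans_le hz).ne')).hasDerivWithinAt)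
    (fun z hz => by
      have hz0 : 0 < z := hτ.trans_le hz
      rw [Real.norm_eq_abs, abs_of_nonneg (by positivity)]
      have := Real.rpow_le_rpow_of_nonpos hτ hz (by linarith : r - 1 ≤ 0)
      gcongr) (convex_Ici τ) (mem_Ici.2 (le_max_right _ _)) (mem_Ici.2 (le_max_right _ _))
  rw [Real.norm_eq_abs, Real.norm_eq_abs] at h2
  refine h2.trans ?_
  gcongr

/-- the density -/
noncomputable def G0 (N : ℕ) (m p σ α β τ s η ζ x y : ℝ) : ℝ :=
  ζ ^ (N - 1) * ((1 - s) * (α + N * β) * tr τ (1 / m) x - s * (η * ζ) ^ σ * tr τ (p / m) x)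
    - (1 - s) * β * tr τ (1 / m) y

noncomputable def G1 (N : ℕ) (m p σ α β τ s η ζ x y : ℝ) : ℝ := η * G0 N m p σ α β τ s η ζ x y

lemma G0_cont (N : ℕ) {m p σ α β τ : ℝ} (hτ : 0 < τ) (hσ : 0 < σ) :
    Continuous fun z : ℝ × ℝ × ℝ × ℝ × ℝ =>
      G0 N m p σ α β τ z.1 z.2.1 z.2.2.1 z.2.2.2.1 z.2.2.2.2 := by
  unfold G0
  have h1 := tr_cont (r := 1 / m) hτ
  have h2 := tr_cont (r := p / m) hτ
  have h3 : Continuous fun z : ℝ × ℝ × ℝ × ℝ × ℝ => (z.2.1 * z.2.2.1) ^ σ :=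
    Continuous.rpow_const (by fun_prop) (fun _ => Or.inr hσ.le)
  fun_prop

lemma G1_cont (N : ℕ) {m p σ α β τ : ℝ} (hτ : 0 < τ) (hσ : 0 < σ) :
    Continuous fun z : ℝ × ℝ × ℝ × ℝ × ℝ =>
      G1 N m p σ α β τ z.1 z.2.1 z.2.2.1 z.2.2.2.1 z.2.2.2.2 := by
  unfold G1
  have := G0_cont N (m := m) (p := p) (α := α) (β := β) hτ hσ
  fun_prop

lemma G1_cont' (N : ℕ) {m p σ α β τ : ℝ} (hτ : 0 < τ) (hσ : 0 < σ) (s : ℝ) :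
    Continuous fun z : ℝ × ℝ × ℝ × ℝ =>
      G1 N m p σ α β τ s z.1 z.2.1 z.2.2.1 z.2.2.2 :=
  (G1_cont N hτ hσ).comp (by fun_prop :
    Continuous fun z : ℝ × ℝ × ℝ × ℝ => (s, z.1, z.2.1, z.2.2.1, z.2.2.2))

structure GP (m p σ α β : ℝ) : Prop where
  hm : 1 < m
  hp0 : 0 < p
  hp1 : p < 1
  hσ : 0 < σ
  hα : 0 < α
  hβ : 0 < β

lemma G1_lip (N : ℕ) {m p σ α β τ : ℝ} (P : GP m p σ α β) (hτ : 0 < τ) {R : ℝ} (hR : 0 ≤ R) :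
    ∃ K, 0 < K ∧ ∀ s ∈ Icc (0:ℝ) 1, VLip (G1 N m p σ α β τ s) R K := by
  obtain ⟨hm, hp0, hp1, hσ, hα, hβ⟩ := P
  have hm0 : 0 < m := by linarith
  set A := 1 / m * τ ^ (1 / m - 1) with hA
  set B := p / m * τ ^ (p / m - 1) with hB
  have hA0 : 0 ≤ A := by positivity
  have hB0 : 0 ≤ B := by positivity
  refine ⟨R * (((α + N * β) * A + R ^ σ * B) + β * A) + 1, by positivity, ?_⟩
  intro s hs η hη ζ hζ x y x' y' D hx hy
  have hD : 0 ≤ D := (abs_nonneg _).trans hx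
  have t1 : ∀ z z', |z - z'| ≤ D → |tr τ (1 / m) z - tr τ (1 / m) z'| ≤ A * D := fun z z' hz => by
    refine (tr_lip hτ (by positivity) (by rw [div_le_one hm0]; exact hm.le) z z').trans ?_
    gcongr
  have t2 : ∀ z z', |z - z'| ≤ D → |tr τ (p / m) z - tr τ (p / m) z'| ≤ B * D := fun z z' hz => by
    refine (tr_lip hτ (by positivity) (by rw [div_le_one hm0]; linarith) z z').trans ?_
    gcongr
  have e : G1 N m p σ α β τ s η ζ x y - G1 N m p σ α β τ s η ζ x' y' =
    η * (ζ ^ (N - 1) * ((1 - s) * (α + N * β) * (tr τ (1 / m) x - tr τ (1 / m) x')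
      - s * (η * ζ) ^ σ * (tr τ (p / m) x - tr τ (p / m) x'))
      - (1 - s) * β * (tr τ (1 / m) y - tr τ (1 / m) y')) := by
    unfold G1 G0; ring
  rw [e]
  have hs1 : 0 ≤ 1 - s := by linarith [hs.2]
  have hs1' : 1 - s ≤ 1 := by linarith [hs.1]
  have hη0 := hη.1
  have hζ0 := hζ.1
  have hηζ : (η * ζ) ^ σ ≤ R ^ σ := by
    apply Real.rpow_le_rpow (by positivity) _ hσ.le
    exact (mul_le_of_le_one_right hη.1 hζ.2).trans hη.2
  have hηζ0 : 0 ≤ (η * ζ) ^ σ := by positivity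
  have hζN : ζ ^ (N - 1) ≤ 1 := pow_le_one₀ hζ.1 hζ.2
  have b1 : |(1 - s) * (α + N * β) * (tr τ (1 / m) x - tr τ (1 / m) x')| ≤ 1 * (α + N * β) * (A * D) := by
    rw [abs_mul, abs_of_nonneg (by positivity)]
    have := t1 x x' hx
    gcongr
  have b2 : |s * (η * ζ) ^ σ * (tr τ (p / m) x - tr τ (p / m) x')| ≤ 1 * R ^ σ * (B * D) := by
    have hs0 := hs.1
    rw [abs_mul, abs_of_nonneg (by positivity)]
    have := t2 x x' hx
    have := hs.2
    gcongr
  have b3 : |(1 - s) * β * (tr τ (1 / m) y - tr τ (1 / m) y')| ≤ 1 * β * (A * D) := by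
    rw [abs_mul, abs_of_nonneg (by positivity)]
    have := t1 y y' hy
    gcongr
  have b4 := (abs_sub _ _).trans (add_le_add b1 b2)
  have b5 : |ζ ^ (N - 1) * ((1 - s) * (α + N * β) * (tr τ (1 / m) x - tr τ (1 / m) x')
      - s * (η * ζ) ^ σ * (tr τ (p / m) x - tr τ (p / m) x'))| ≤
      1 * (1 * (α + N * β) * (A * D) + 1 * R ^ σ * (B * D)) := by
    rw [abs_mul, abs_of_nonneg (by positivity)]
    gcongr
  have b6 := (abs_sub _ _).trans (add_le_add b5 b3)
  rw [abs_mul, abs_of_nonneg hη0]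
  have b7 := mul_le_mul hη.2 b6 (abs_nonneg _) hR
  refine b7.trans ?_
  linarith

/-- `u` solves the truncated Volterra equation on `[0,r]` -/
def VS (N : ℕ) (m p σ α β τ s r : ℝ) (u : ℝ → ℝ) : Prop :=
  Continuous u ∧ ∀ ξ ∈ Icc 0 r, u ξ = 1 + ∫ η in (0:ℝ)..ξ, vin (G1 N m p σ α β τ s) u η

lemma VS.u0 {N : ℕ} {m p σ α β τ s r : ℝ} {u : ℝ → ℝ} (h : VS N m p σ α β τ s r u) (hr : 0 ≤ r) :
    u 0 = 1 := by
  have := h.2 0 ⟨le_rfl, hr⟩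
  simpa using this

lemma vin_congr (N : ℕ) {m p σ α β τ τ' s r : ℝ} {u u' : ℝ → ℝ}
    (h : ∀ η ∈ Icc 0 r, τ ≤ u η ∧ τ' ≤ u η ∧ u' η = u η) {η : ℝ} (hη : η ∈ Icc 0 r) :
    vin (G1 N m p σ α β τ' s) u' η = vin (G1 N m p σ α β τ s) u η := by
  unfold vin
  refine intervalIntegral.integral_congr fun ζ hζ => ?_
  rw [uIcc_of_le zero_le_one] at hζ
  have h1 : η * ζ ∈ Icc 0 r :=
    ⟨mul_nonneg hη.1 hζ.1, (mul_le_of_le_one_right hη.1 hζ.2).trans hη.2⟩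
  obtain ⟨a1, a2, a3⟩ := h _ h1
  obtain ⟨b1, b2, b3⟩ := h _ hη
  simp only [G1, G0, a3, b3, tr_eq a1, tr_eq a2, tr_eq b1, tr_eq b2]

lemma VS.change {N : ℕ} {m p σ α β τ τ' s r : ℝ} {u : ℝ → ℝ} (h : VS N m p σ α β τ s r u)
    (h1 : ∀ η ∈ Icc 0 r, τ ≤ u η) (h2 : ∀ η ∈ Icc 0 r, τ' ≤ u η) : VS N m p σ α β τ' s r u := by
  refine ⟨h.1, fun ξ hξ => ?_⟩
  rw [h.2 ξ hξ]
  congr 1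
  refine intervalIntegral.integral_congr fun η hη => ?_
  rw [uIcc_of_le hξ.1] at hη
  exact (vin_congr (r := r) N (fun η hη => ⟨h1 η hη, h2 η hη, rfl⟩) ⟨hη.1, hη.2.trans hξ.2⟩).symm

lemma VS.unique {N : ℕ} {m p σ α β τ s r : ℝ} (P : GP m p σ α β) (hτ : 0 < τ) (hs : s ∈ Icc (0:ℝ) 1)
    (hr : 0 ≤ r) {u u' : ℝ → ℝ} (h : VS N m p σ α β τ s r u) (h' : VS N m p σ α β τ s r u') :
    ∀ ξ ∈ Icc 0 r, u ξ = u' ξ := by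
  obtain ⟨K, hK, hL⟩ := G1_lip N P hτ hr
  exact vunique (G1_cont' N hτ P.hσ s) hr hK (hL s hs) h.1 h'.1 h.2 h'.2

/-- scaled flux -/
noncomputable def QQ (N : ℕ) (m p σ α β τ s : ℝ) (u : ℝ → ℝ) (η : ℝ) : ℝ := vin (G0 N m p σ α β τ s) u η

lemma vin_eq (N : ℕ) (m p σ α β τ s : ℝ) (u : ℝ → ℝ) (η : ℝ) :
    vin (G1 N m p σ α β τ s) u η = η * QQ N m p σ α β τ s u η := by
  unfold QQ vin G1
  rw [intervalIntegral.integral_const_mul]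

lemma VS.du {N : ℕ} {m p σ α β τ s r : ℝ} {u : ℝ → ℝ} (hτ : 0 < τ) (hσ : 0 < σ)
    (h : VS N m p σ α β τ s r u) {ξ : ℝ} (h1 : 0 < ξ) (h2 : ξ < r) :
    HasDerivAt u (vin (G1 N m p σ α β τ s) u ξ) ξ := by
  have c := vin_cont' (G1_cont' N (m := m) (p := p) (α := α) (β := β) hτ hσ s) h.1
  have d := (intervalIntegral.integral_hasDerivAt_right (c.intervalIntegrable 0 ξ)
    (c.stronglyMeasurableAtFilter _ _) c.continuousAt).const_add 1
  refine d.congr_of_eventuallyEq ?_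
  filter_upwards [Ioo_mem_nhds h1 h2] with z hz
  exact h.2 z ⟨hz.1.le, hz.2.le⟩

lemma VS.dv {N : ℕ} (hN : 1 ≤ N) {m p σ α β τ s r : ℝ} {u : ℝ → ℝ} (hτ : 0 < τ) (hσ : 0 < σ)
    (h : VS N m p σ α β τ s r u) {ξ : ℝ} (h1 : 0 < ξ) (h2 : ξ < r) (h3 : τ < u ξ) :
    HasDerivAt (vin (G1 N m p σ α β τ s) u) (-(((N:ℝ) - 1) / ξ * vin (G1 N m p σ α β τ s) u ξ)
      + (1 - s) * α * u ξ ^ (1 / m)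
    - (1 - s) * β * ξ * (1 / m * u ξ ^ (1 / m - 1) * vin (G1 N m p σ α β τ s) u ξ)
    - s * ξ ^ σ * u ξ ^ (p / m)) ξ := by
  obtain ⟨k, rfl⟩ : ∃ k, N = k + 1 := ⟨N - 1, by omega⟩
  set H : ℝ → ℝ := fun r => (1 - s) * (α + ((k+1:ℕ):ℝ) * β) * tr τ (1 / m) (u r)
    - s * r ^ σ * tr τ (p / m) (u r) with hH
  have t1 : Continuous fun r => tr τ (1 / m) (u r) := (tr_cont hτ).comp h.1
  have t2 : Continuous fun r => tr τ (p / m) (u r) := (tr_cont hτ).comp h.1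
  have t3 : Continuous fun r : ℝ => r ^ σ := Continuous.rpow_const continuous_id (fun _ => Or.inr hσ.le)
  have hHc : Continuous H := by rw [hH]; fun_prop
  have key : ∀ z, 0 < z → vin (G1 (k+1) m p σ α β τ s) u z =
      (z ^ k)⁻¹ * (∫ r in (0:ℝ)..z, r ^ k * H r) - z * ((1 - s) * β * tr τ (1 / m) (u z)) := by
    intro z hz
    rw [vin_eq]
    unfold QQ vin
    have e1 : ∀ ζ, G0 (k+1) m p σ α β τ s z ζ (u (z * ζ)) (u z) =
        (z ^ k)⁻¹ * ((z * ζ) ^ k * H (z * ζ)) - (1 - s) * β * tr τ (1 / m) (u z) := by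
      intro ζ
      unfold G0
      simp only [hH, Nat.add_sub_cancel, mul_pow]
      field_simp
    simp only [e1]
    rw [intervalIntegral.integral_sub (Continuous.intervalIntegrable (by fun_prop) _ _)
      (Continuous.intervalIntegrable (by fun_prop) _ _), intervalIntegral.integral_const_mul,
      intervalIntegral.integral_comp_mul_left (fun r => r ^ k * H r) hz.ne']
    simp
    field_simp
  have hpc : Continuous fun r => r ^ k * H r := by fun_prop
  have d1 := intervalIntegral.integral_hasDerivAt_right (hpc.intervalIntegrable 0 ξ)
    (hpc.stronglyMeasurableAtFilter _ _) hpc.continuousAt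
  have d2 := (hasDerivAt_pow k ξ).inv (pow_pos h1 k).ne'
  have d0 := h.du hτ hσ h1 h2
  have hu0 : 0 < u ξ := hτ.trans h3
  have d3 : HasDerivAt (fun z => tr τ (1 / m) (u z))
      (vin (G1 (k+1) m p σ α β τ s) u ξ * (1 / m) * u ξ ^ (1 / m - 1)) ξ := by
    have := d0.rpow_const (p := 1 / m) (Or.inl hu0.ne')
    refine this.congr_of_eventuallyEq ?_
    filter_upwards [h.1.continuousAt.eventually (lt_mem_nhds h3)] with z hz
    exact tr_eq hz.le
  have d4 := (d2.mul d1).sub ((hasDerivAt_id ξ).mul (d3.const_mul ((1 - s) * β)))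
  have d5 := d4.congr_of_eventuallyEq (f₁ := vin (G1 (k+1) m p σ α β τ s) u) (by
    filter_upwards [lt_mem_nhds h1] with z hz
    rw [key z hz]; rfl)
  refine d5.congr_deriv ?_
  have k1 := key ξ h1
  set V := vin (G1 (k+1) m p σ α β τ s) u ξ
  have hI : (∫ r in (0:ℝ)..ξ, r ^ k * H r) = ξ ^ k * (V + ξ * ((1 - s) * β * tr τ (1 / m) (u ξ))) := by
    rw [k1]; field_simp; ring
  have hHξ : H ξ = (1 - s) * (α + ((k+1:ℕ):ℝ) * β) * u ξ ^ (1 / m) - s * ξ ^ σ * u ξ ^ (p / m) := by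
    simp only [hH, tr_eq h3.le]
  rw [hI, hHξ, tr_eq h3.le]
  push_cast
  simp only [Pi.inv_apply, id]
  rcases Nat.eq_zero_or_pos k with rfl | hk
  · simp; field_simp; ring
  · have : ξ ^ k = ξ ^ (k - 1) * ξ := by rw [← pow_succ]; congr 1; omega
    rw [this]
    field_simp
    ring

end SSP

namespace SSP

/-- abstract properties of the shooting family -/
structure Shoot (n m p σ α β : ℝ) (D : ℝ → ℝ → Prop) (u v : ℝ → ℝ → ℝ) : Prop where
  D0 : ∀ s ∈ Icc (0:ℝ) 1, ∃ r, 0 < r ∧ D s r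
  down : ∀ s ∈ Icc (0:ℝ) 1, ∀ r ξ, 0 ≤ ξ → ξ ≤ r → D s r → D s ξ
  openr : ∀ s ∈ Icc (0:ℝ) 1, ∀ r, 0 ≤ r → D s r → ∃ r', r < r' ∧ D s r'
  opens : ∀ s ∈ Icc (0:ℝ) 1, ∀ r, 0 < r → D s r → ∀ᶠ s' in 𝓝[Icc (0:ℝ) 1] s, D s' r
  contu : ∀ s ∈ Icc (0:ℝ) 1, ∀ r, 0 < r → D s r →
    Tendsto (fun s' => u s' r) (𝓝[Icc (0:ℝ) 1] s) (𝓝 (u s r))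
  contv : ∀ s ∈ Icc (0:ℝ) 1, ∀ r, 0 < r → D s r →
    Tendsto (fun s' => v s' r) (𝓝[Icc (0:ℝ) 1] s) (𝓝 (v s r))
  sol : ∀ s ∈ Icc (0:ℝ) 1, ∀ R, (∀ ξ, 0 < ξ → ξ < R → D s ξ) →
    USol n m p σ α β (1 - s) s R (u s) (v s)
  u0 : ∀ s ∈ Icc (0:ℝ) 1, u s 0 = 1
  uorig : ∀ s ∈ Icc (0:ℝ) 1, Tendsto (u s) (𝓝[>] 0) (𝓝 1)
  vorig : ∀ s ∈ Icc (0:ℝ) 1, Tendsto (fun ξ => v s ξ / ξ) (𝓝[>] 0) (𝓝 ((1 - s) * α / n))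
  ext : ∀ s ∈ Icc (0:ℝ) 1, ∀ ξ0 τ, 0 < ξ0 → 0 < τ → (∀ ξ, 0 < ξ → ξ < ξ0 → D s ξ) →
    (∀ ξ, 0 < ξ → ξ < ξ0 → τ < u s ξ) → D s ξ0
  zero : ∀ s ξ, ¬ D s ξ → u s ξ = 0

theorem shoot_exists {N : ℕ} (hN : 1 ≤ N) {m p σ α β : ℝ} (P : GP m p σ α β) :
    ∃ D u v, Shoot (N : ℝ) m p σ α β D u v := by
  classical
  have hσ := P.hσ
  have ex : ∀ τ : ℝ, ∃ U : ℝ → ℝ → ℝ, 0 < τ → Continuous (Function.uncurry U) ∧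
      ∀ s ∈ Icc (0:ℝ) 1, VS N m p σ α β τ s (1 / τ) (U s) := by
    intro τ
    by_cases hτ : 0 < τ
    · have hR : 0 ≤ 1 / τ := by positivity
      obtain ⟨K, hK, hL⟩ := G1_lip N P hτ hR
      obtain ⟨U, hU, hU2⟩ := volterra (G1_cont N (m := m) (p := p) (α := α) (β := β) hτ hσ) hR hK hL
      exact ⟨U, fun _ => ⟨hU, fun s hs =>
        ⟨hU.comp (by fun_prop : Continuous fun ξ : ℝ => (s, ξ)), hU2 s hs⟩⟩⟩
    · exact ⟨fun _ _ => 0, fun h => absurd h hτ⟩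
  choose U hU using ex
  let V (τ s ξ : ℝ) : ℝ := vin (G1 N m p σ α β τ s) (U τ s) ξ
  let Good (τ s r : ℝ) : Prop := 0 < τ ∧ τ < 1 ∧ r < 1 / τ ∧ ∀ η ∈ Icc 0 r, τ < U τ s η
  have Vcont : ∀ τ, 0 < τ → Continuous (Function.uncurry (V τ)) := fun τ hτ =>
    vin_cont (G1_cont N (m := m) (p := p) (α := α) (β := β) hτ hσ) (hU τ hτ).1
  have Qcont : ∀ τ, 0 < τ → ∀ s, Continuous (QQ N m p σ α β τ s (U τ s)) := fun τ hτ s => by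
    have h1 := vin_cont (G0_cont N (m := m) (p := p) (α := α) (β := β) hτ hσ) (hU τ hτ).1
    exact h1.comp (by fun_prop : Continuous fun ξ : ℝ => (s, ξ))
  have secc : ∀ τ, 0 < τ → ∀ s, Continuous (U τ s) := fun τ hτ s =>
    (hU τ hτ).1.comp (by fun_prop : Continuous fun ξ : ℝ => (s, ξ))
  have VSr : ∀ τ s r, Good τ s r → s ∈ Icc (0:ℝ) 1 → VS N m p σ α β τ s r (U τ s) := by
    intro τ s r hg hs
    have := (hU τ hg.1).2 s hs
    exact ⟨this.1, fun ξ hξ => this.2 ξ ⟨hξ.1, hξ.2.trans hg.2.2.1.le⟩⟩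
  have Gdown : ∀ τ s r ξ, ξ ≤ r → Good τ s r → Good τ s ξ := fun τ s r ξ h hg =>
    ⟨hg.1, hg.2.1, h.trans_lt hg.2.2.1, fun η hη => hg.2.2.2 η ⟨hη.1, hη.2.trans h⟩⟩
  have coh : ∀ τ τ' s r, s ∈ Icc (0:ℝ) 1 → 0 ≤ r → Good τ s r → 0 < τ' → τ' < 1 → r < 1 / τ' →
      (∀ η ∈ Icc 0 r, τ' < U τ s η) → (∀ η ∈ Icc 0 r, U τ' s η = U τ s η) ∧ Good τ' s r := by
    intro τ τ' s r hs hr hg h1 h1' h2 h3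
    have a1 := (VSr τ s r hg hs).change (τ' := τ') (fun η hη => (hg.2.2.2 η hη).le) (fun η hη => (h3 η hη).le)
    have a2 := (hU τ' h1).2 s hs
    have a3 := VS.unique P h1 hs hr ⟨a2.1, fun ξ hξ => a2.2 ξ ⟨hξ.1, hξ.2.trans h2.le⟩⟩ a1
    exact ⟨a3, h1, h1', h2, fun η hη => by rw [a3 η hη]; exact h3 η hη⟩
  have coh1 : ∀ τ τ' s r, s ∈ Icc (0:ℝ) 1 → 0 ≤ r → τ' ≤ τ → Good τ s r → Good τ' s r →
      (∀ η ∈ Icc 0 r, U τ' s η = U τ s η) := by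
    intro τ τ' s r hs hr hle hg hg'
    exact (coh τ τ' s r hs hr hg hg'.1 hg'.2.1 hg'.2.2.1
      (fun η hη => hle.trans_lt (hg.2.2.2 η hη))).1
  have coh2 : ∀ τ τ' s r, s ∈ Icc (0:ℝ) 1 → 0 ≤ r → Good τ s r → Good τ' s r →
      (∀ η ∈ Icc 0 r, U τ' s η = U τ s η) := by
    intro τ τ' s r hs hr hg hg'
    rcases le_total τ' τ with h | h
    · exact coh1 τ τ' s r hs hr h hg hg'
    · intro η hη
      exact (coh1 τ' τ s r hs hr h hg' hg η hη).symm
  have cohV : ∀ τ τ' s r, s ∈ Icc (0:ℝ) 1 → 0 ≤ r → Good τ s r → Good τ' s r →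
      (∀ η ∈ Icc 0 r, V τ' s η = V τ s η) := by
    intro τ τ' s r hs hr hg hg' η hη
    have h1 := coh2 τ τ' s r hs hr hg hg'
    exact vin_congr N (fun η hη => ⟨(hg.2.2.2 η hη).le, by
      rw [← h1 η hη]; exact (hg'.2.2.2 η hη).le, h1 η hη⟩) hη
  let D (s r : ℝ) : Prop := ∃ τ, Good τ s r
  let u (s ξ : ℝ) : ℝ := if h : D s ξ then U h.choose s ξ else 0
  let v (s ξ : ℝ) : ℝ := if h : D s ξ then V h.choose s ξ else 0
  have ueq : ∀ τ s ξ, s ∈ Icc (0:ℝ) 1 → 0 ≤ ξ → Good τ s ξ → u s ξ = U τ s ξ := by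
    intro τ s ξ hs hξ hg
    have hD : D s ξ := ⟨τ, hg⟩
    simp only [u, dif_pos hD]
    exact coh2 _ _ s ξ hs hξ hg hD.choose_spec ξ ⟨hξ, le_rfl⟩
  have veq : ∀ τ s ξ, s ∈ Icc (0:ℝ) 1 → 0 ≤ ξ → Good τ s ξ → v s ξ = V τ s ξ := by
    intro τ s ξ hs hξ hg
    have hD : D s ξ := ⟨τ, hg⟩
    simp only [v, dif_pos hD]
    exact cohV _ _ s ξ hs hξ hg hD.choose_spec ξ ⟨hξ, le_rfl⟩
  have U0 : ∀ τ s, 0 < τ → s ∈ Icc (0:ℝ) 1 → U τ s 0 = 1 := fun τ s hτ hs =>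
    ((hU τ hτ).2 s hs).u0 (by positivity)
  have G0' : ∀ τ s, 0 < τ → τ < 1 → s ∈ Icc (0:ℝ) 1 → Good τ s 0 := fun τ s hτ hτ1 hs =>
    ⟨hτ, hτ1, by positivity, fun η hη => by
      have : η = 0 := le_antisymm hη.2 hη.1
      rw [this, U0 τ s hτ hs]; exact hτ1⟩
  have Gopen : ∀ τ s r, 0 ≤ r → Good τ s r → ∃ r', r < r' ∧ Good τ s r' := by
    intro τ s r hr hg
    have h1 := (secc τ hg.1 s).continuousAt.eventually (lt_mem_nhds (hg.2.2.2 r ⟨hr, le_rfl⟩))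
    have h2 := h1.and (gt_mem_nhds hg.2.2.1)
    obtain ⟨e, he, h3⟩ := Metric.eventually_nhds_iff.1 h2
    refine ⟨r + e / 2, by linarith, hg.1, hg.2.1, ?_, ?_⟩
    · exact (h3 (y := r + e / 2) (by
        rw [Real.dist_eq, add_sub_cancel_left, abs_of_pos (by linarith)]; linarith)).2
    · intro η hη
      rcases le_or_gt η r with h | h
      · exact hg.2.2.2 η ⟨hη.1, h⟩
      · exact (h3 (y := η) (by rw [Real.dist_eq, abs_of_pos (by linarith)]; linarith [hη.2])).1
  have Gopens : ∀ τ s r, Good τ s r → ∀ᶠ s' in 𝓝 s, Good τ s' r := by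
    intro τ s r hg
    have := (isCompact_Icc (a := (0:ℝ)) (b := r)).eventually_forall_of_forall_eventually
      (x₀ := s) (P := fun s' η => τ < U τ s' η) (by
        intro η hη
        exact ((hU τ hg.1).1.continuousAt (x := (s, η))).eventually (lt_mem_nhds (hg.2.2.2 η hη)))
    filter_upwards [this] with s' hs'
    exact ⟨hg.1, hg.2.1, hg.2.2.1, hs'⟩
  have hh : (0:ℝ) < 1/2 := by norm_num
  have hh1 : (1/2:ℝ) < 1 := by norm_num
  refine ⟨D, u, v, ?_, ?_, ?_, ?_, ?_, ?_, ?_, ?_, ?_, ?_, ?_, ?_⟩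
  · intro s hs
    obtain ⟨r, hr, hg⟩ := Gopen (1/2) s 0 le_rfl (G0' (1/2) s hh hh1 hs)
    exact ⟨r, hr, _, hg⟩
  · rintro s - r ξ - h ⟨τ, hg⟩
    exact ⟨τ, Gdown τ s r ξ h hg⟩
  · rintro s - r hr ⟨τ, hg⟩
    obtain ⟨r', h1, h2⟩ := Gopen τ s r hr hg
    exact ⟨r', h1, τ, h2⟩
  · rintro s - r - ⟨τ, hg⟩
    exact nhdsWithin_le_nhds ((Gopens τ s r hg).mono fun s' h => ⟨τ, h⟩)
  · rintro s hs r hr ⟨τ, hg⟩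
    rw [ueq τ s r hs hr.le hg]
    have h1 : Continuous fun s' => U τ s' r :=
      (hU τ hg.1).1.comp (by fun_prop : Continuous fun s' : ℝ => (s', r))
    refine (h1.continuousAt.tendsto.mono_left nhdsWithin_le_nhds).congr' ?_
    filter_upwards [self_mem_nhdsWithin, nhdsWithin_le_nhds (Gopens τ s r hg)] with s' h2 h3
    exact (ueq τ s' r h2 hr.le h3).symm
  · rintro s hs r hr ⟨τ, hg⟩
    rw [veq τ s r hs hr.le hg]
    have h1 : Continuous fun s' => V τ s' r :=
      (Vcont τ hg.1).comp (by fun_prop : Continuous fun s' : ℝ => (s', r))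
    refine (h1.continuousAt.tendsto.mono_left nhdsWithin_le_nhds).congr' ?_
    filter_upwards [self_mem_nhdsWithin, nhdsWithin_le_nhds (Gopens τ s r hg)] with s' h2 h3
    exact (veq τ s' r h2 hr.le h3).symm
  · intro s hs R hR
    have loc : ∀ ξ, 0 < ξ → ξ < R → ∃ τ r, ξ < r ∧ Good τ s r ∧ u s ξ = U τ s ξ ∧ v s ξ = V τ s ξ ∧
        u s =ᶠ[𝓝 ξ] U τ s ∧ v s =ᶠ[𝓝 ξ] V τ s := by
      intro ξ h1 h2
      obtain ⟨τ, hg⟩ := hR ξ h1 h2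
      obtain ⟨r, hr, hg'⟩ := Gopen τ s ξ h1.le hg
      refine ⟨τ, r, hr, hg', ueq τ s ξ hs h1.le hg, veq τ s ξ hs h1.le hg, ?_, ?_⟩
      · filter_upwards [Ioo_mem_nhds h1 hr] with z hz
        exact ueq τ s z hs hz.1.le (Gdown τ s r z hz.2.le hg')
      · filter_upwards [Ioo_mem_nhds h1 hr] with z hz
        exact veq τ s z hs hz.1.le (Gdown τ s r z hz.2.le hg')
    refine ⟨?_, ?_, ?_⟩
    · intro ξ h1 h2
      obtain ⟨τ, r, hr, hg, e1, -⟩ := loc ξ h1 h2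
      rw [e1]
      exact hg.1.trans (hg.2.2.2 ξ ⟨h1.le, hr.le⟩)
    · intro ξ h1 h2
      obtain ⟨τ, r, hr, hg, e1, e2, e3, e4⟩ := loc ξ h1 h2
      rw [e2]
      exact ((VSr τ s r hg hs).du hg.1 hσ h1 hr).congr_of_eventuallyEq e3
    · intro ξ h1 h2
      obtain ⟨τ, r, hr, hg, e1, e2, e3, e4⟩ := loc ξ h1 h2
      rw [e1, e2]
      exact ((VSr τ s r hg hs).dv hN hg.1 hσ h1 hr (hg.2.2.2 ξ ⟨h1.le, hr.le⟩)).congr_of_eventuallyEq e4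
  · intro s hs
    rw [ueq (1/2) s 0 hs le_rfl (G0' (1/2) s hh hh1 hs)]
    exact U0 _ s hh hs
  · intro s hs
    obtain ⟨r, hr, hg⟩ := Gopen (1/2) s 0 le_rfl (G0' (1/2) s hh hh1 hs)
    have h1 := (secc _ hh s).continuousAt.tendsto.mono_left (nhdsWithin_le_nhds (a := 0) (s := Ioi 0))
    rw [U0 _ s hh hs] at h1
    refine h1.congr' ?_
    filter_upwards [Ioo_mem_nhdsGT hr] with z hz
    exact (ueq _ s z hs hz.1.le (Gdown _ s r z hz.2.le hg)).symm
  · intro s hs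
    obtain ⟨r, hr, hg⟩ := Gopen (1/2) s 0 le_rfl (G0' (1/2) s hh hh1 hs)
    have h1 := (Qcont _ hh s).continuousAt.tendsto.mono_left (nhdsWithin_le_nhds (a := 0) (s := Ioi 0))
    have h2 : QQ N m p σ α β (1/2) s (U (1/2) s) 0 = (1 - s) * α / N := by
      unfold QQ vin G0
      obtain ⟨k, rfl⟩ : ∃ k, N = k + 1 := ⟨N - 1, by omega⟩
      simp only [zero_mul, U0 _ s hh hs, Real.zero_rpow hσ.ne', tr_eq hh1.le, Real.one_rpow]
      rw [intervalIntegral.integral_sub (Continuous.intervalIntegrable (by fun_prop) _ _)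
        (Continuous.intervalIntegrable (by fun_prop) _ _), intervalIntegral.integral_mul_const,
        integral_pow]
      simp
      have : (k:ℝ) + 1 ≠ 0 := by positivity
      field_simp
      ring
    rw [h2] at h1
    refine h1.congr' ?_
    filter_upwards [Ioo_mem_nhdsGT hr] with z hz
    rw [veq _ s z hs hz.1.le (Gdown _ s r z hz.2.le hg)]
    simp only [V]
    rw [vin_eq, mul_div_cancel_left₀ _ hz.1.ne']
  · intro s hs ξ0 τ hξ0 hτ hD hlow
    set τ' := min (τ / 2) (min (1 / 2) (1 / (2 * ξ0))) with hτ'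
    have a0 : 0 < τ' := by rw [hτ']; positivity
    have a1 : τ' ≤ τ / 2 := min_le_left _ _
    have a2 : τ' ≤ 1 / 2 := (min_le_right _ _).trans (min_le_left _ _)
    have a3 : τ' ≤ 1 / (2 * ξ0) := (min_le_right _ _).trans (min_le_right _ _)
    have a4 : ξ0 < 1 / τ' := by
      rw [lt_div_iff₀ a0]
      rw [le_div_iff₀ (by positivity)] at a3
      nlinarith
    have b1 : ∀ ξ, 0 < ξ → ξ < ξ0 → τ < U τ' s ξ := by
      intro ξ h1 h2
      obtain ⟨τ1, hg⟩ := hD ξ h1 h2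
      have := coh τ1 τ' s ξ hs h1.le hg a0 (by linarith) (h2.trans a4) (by
        intro η hη
        rcases hη.1.eq_or_lt with h | h
        · rw [← h, U0 τ1 s hg.1 hs]; linarith
        · rw [← ueq τ1 s η hs h.le (Gdown τ1 s ξ η hη.2 hg)]
          have := hlow η h (hη.2.trans_lt h2)
          linarith)
      rw [this.1 ξ ⟨h1.le, le_rfl⟩, ← ueq τ1 s ξ hs h1.le hg]
      exact hlow ξ h1 h2
    have b2 : τ ≤ U τ' s ξ0 := by
      have h1 := (secc _ a0 s).continuousAt.tendsto.mono_left (nhdsWithin_le_nhds (a := ξ0) (s := Iio ξ0))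
      refine ge_of_tendsto h1 ?_
      filter_upwards [Ioo_mem_nhdsLT hξ0] with z hz
      exact (b1 z hz.1 hz.2).le
    refine ⟨τ', a0, by linarith, a4, ?_⟩
    intro η hη
    rcases hη.1.eq_or_lt with h | h
    · rw [← h, U0 τ' s a0 hs]; linarith
    · rcases hη.2.eq_or_lt with h' | h'
      · rw [h']; linarith
      · have := b1 η h h'; linarith
  · intro s ξ h
    simp only [u, dif_neg h]

end SSP

namespace SSP

lemma u_of_xx {m γ : ℝ} (hm : 1 < m) {u : ℝ → ℝ} {t : ℝ} (hu : 0 < u (Real.exp t)) :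
    u (Real.exp t) = xx m γ u t ^ (m / (m - 1)) * Real.exp (m * γ * t) := by
  have hm1 : 0 < m - 1 := by linarith
  unfold xx
  rw [← Real.exp_mul, ← Real.exp_add]
  conv_lhs => rw [← Real.exp_log hu]
  congr 1
  field_simp
  ring

lemma v_of_xx {m γ : ℝ} (hm : 1 < m) {u v : ℝ → ℝ} {t : ℝ} (hu : 0 < u (Real.exp t)) :
    v (Real.exp t) = (m * γ * u (Real.exp t) - YY m γ u v t * (xx m γ u t ^ (1 / (m - 1)) *
      Real.exp (m * γ * t))) * Real.exp (-t) := by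
  have hm1 : 0 < m - 1 := by linarith
  have h1 := u_of_xx (γ := γ) hm hu
  have hx := xx_pos m γ u t
  have h2 : xx m γ u t ^ (m / (m - 1)) = xx m γ u t ^ (1 / (m - 1)) * xx m γ u t := by
    rw [← Real.rpow_add_one hx.ne']; congr 1; field_simp; ring
  have h3 : xx m γ u t * (xx m γ u t ^ (1 / (m - 1)) * Real.exp (m * γ * t)) = u (Real.exp t) := by
    rw [h1, h2]; ring
  have h4 : YY m γ u v t * (xx m γ u t ^ (1 / (m - 1)) * Real.exp (m * γ * t)) =
      m * γ * u (Real.exp t) - Real.exp t * v (Real.exp t) := by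
    have : YY m γ u v t * (xx m γ u t ^ (1 / (m - 1)) * Real.exp (m * γ * t)) =
      (xx m γ u t * (xx m γ u t ^ (1 / (m - 1)) * Real.exp (m * γ * t))) *
        (m * γ - Real.exp t * v (Real.exp t) / u (Real.exp t)) := by unfold YY; ring
    rw [this, h3]; field_simp
  rw [h4, Real.exp_neg]
  have := (Real.exp_pos t).ne'
  field_simp
  ring

lemma exp_tendsto_left {ξ0 : ℝ} (h0 : 0 < ξ0) :
    Tendsto Real.exp (𝓝[<] (Real.log ξ0)) (𝓝[<] ξ0) := by
  refine tendsto_nhdsWithin_iff.2 ⟨?_, ?_⟩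
  · have := (Real.continuous_exp.tendsto (Real.log ξ0)).mono_left
      (nhdsWithin_le_nhds (s := Iio (Real.log ξ0)))
    rwa [Real.exp_log h0] at this
  · filter_upwards [self_mem_nhdsWithin] with t ht
    exact (Real.lt_log_iff_exp_lt h0).1 ht

lemma log_tendsto_left {ξ0 : ℝ} (hξ0 : 0 < ξ0) :
    Tendsto Real.log (𝓝[<] ξ0) (𝓝[<] (Real.log ξ0)) := by
  refine tendsto_nhdsWithin_iff.2
    ⟨(Real.continuousAt_log hξ0.ne').tendsto.mono_left nhdsWithin_le_nhds, ?_⟩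
  filter_upwards [Ioo_mem_nhdsLT hξ0] with ξ hξ using Real.log_lt_log hξ.1 hξ.2

/-- openness of the trap -/
lemma Trap.eventually {m b β θ δ t : ℝ} {l : Filter ℝ} {c x Y : ℝ → ℝ} {c0 x0 Y0 : ℝ}
    (hc : Tendsto c l (𝓝 c0)) (hx : Tendsto x l (𝓝 x0)) (hY : Tendsto Y l (𝓝 Y0))
    (hc0 : 0 < c0) (hx0 : 0 < x0) (h : Trap m b β θ δ c0 x0 Y0 t) :
    ∀ᶠ s in l, Trap m b β θ δ (c s) (x s) (Y s) t := by
  obtain ⟨h1, h2, h3, h4⟩ := h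
  have hψ : Tendsto (fun s => psi (c s) β t) l (𝓝 (psi c0 β t)) := by
    unfold psi; exact hc.mul_const _
  have hψ0 : psi c0 β t ≠ 0 := (psi_pos hc0 t).ne'
  have hxθ := hx.rpow_const (p := θ) (Or.inl hx0.ne')
  have hx1 := hx.rpow_const (p := 1 - θ) (Or.inl hx0.ne')
  have hSS : Tendsto (fun s => SS m β θ (c s) (x s) t) l (𝓝 (SS m β θ c0 x0 t)) := by
    unfold SS GG
    have := Real.rpow_pos_of_pos hx0 (1 - θ)
    exact (tendsto_const_nhds.div hψ hψ0).add (tendsto_const_nhds.mul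
      (hx1.div (tendsto_const_nhds.add hx1) (by positivity)))
  have e1 := hx.eventually_lt (tendsto_const_nhds.mul hψ) h1
  have e2 := (tendsto_const_nhds.mul ((tendsto_const_nhds.mul (hx.pow 2)).add
    (tendsto_const_nhds.mul hxθ))).eventually_lt (tendsto_const_nhds.mul (hψ.mul hY)) h2
  have e3 := (tendsto_const_nhds.mul hY).eventually_lt hψ h3
  have e4 : ∀ᶠ s in l, 16 * m * SS m β θ (c s) (x s) t < 1 ∨
      16 * m * x s ^ θ * SS m β θ (c s) (x s) t ^ 2 < 1 := by
    rcases h4 with h4 | h4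
    · exact ((tendsto_const_nhds.mul hSS).eventually_lt_const h4).mono fun s h => Or.inl h
    · exact (((tendsto_const_nhds.mul hxθ).mul (hSS.pow 2)).eventually_lt_const h4).mono
        fun s h => Or.inr h
  filter_upwards [e1, e2, e3, e4] with s a1 a2 a3 a4 using ⟨a1, a2, a3, a4⟩

section
variable {n m p σ α β γ θ a b δ M : ℝ} {D : ℝ → ℝ → Prop} {u v : ℝ → ℝ → ℝ}

lemma Shoot.traj (Sh : Shoot n m p σ α β D u v) (C : Con n m p σ α β γ θ a b) {s R : ℝ}
    (hs : s ∈ Icc (0:ℝ) 1) (hR : 0 < R) (h : ∀ ξ, 0 < ξ → ξ < R → D s ξ) :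
    Traj m a b β θ s ((1 - s) * β) (Real.log R) (xx m γ (u s)) (YY m γ (u s) (v s)) :=
  (Sh.sol s hs R h).traj C hR

lemma Shoot.traj' (Sh : Shoot n m p σ α β D u v) (C : Con n m p σ α β γ θ a b) {s t : ℝ}
    (hs : s ∈ Icc (0:ℝ) 1) (h : D s (Real.exp t)) :
    ∃ T, t < T ∧ Traj m a b β θ s ((1 - s) * β) T (xx m γ (u s)) (YY m γ (u s) (v s)) := by
  obtain ⟨r, hr, h1⟩ := Sh.openr s hs _ (Real.exp_pos t).le h
  have hr0 : 0 < r := (Real.exp_pos t).trans hr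
  exact ⟨Real.log r, (Real.lt_log_iff_exp_lt hr0).2 hr, Sh.traj C hs hr0 fun ξ h2 h3 =>
    Sh.down s hs r ξ h2.le h3.le h1⟩

lemma Shoot.upos (Sh : Shoot n m p σ α β D u v) {s ξ : ℝ}
    (hs : s ∈ Icc (0:ℝ) 1) (hξ : 0 < ξ) (h : D s ξ) : 0 < u s ξ := by
  obtain ⟨r, hr, h1⟩ := Sh.openr s hs _ hξ.le h
  exact (Sh.sol s hs r fun z h2 h3 => Sh.down s hs r z h2.le h3.le h1).upos ξ hξ hr

lemma Shoot.maximal (Sh : Shoot n m p σ α β D u v) {s : ℝ} (hs : s ∈ Icc (0:ℝ) 1) :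
    (∀ ξ, 0 < ξ → D s ξ) ∨ ∃ ξ0, 0 < ξ0 ∧ (∀ ξ, 0 < ξ → ξ < ξ0 → D s ξ) ∧ ¬ D s ξ0 := by
  by_cases hall : ∀ ξ, 0 < ξ → D s ξ
  · exact Or.inl hall
  right
  push Not at hall
  obtain ⟨r, hr, hDr⟩ := hall
  obtain ⟨r0, hr0, hD0⟩ := Sh.D0 s hs
  set A := {ξ | 0 < ξ ∧ D s ξ} with hA
  have hbdd : BddAbove A := ⟨r, fun ξ hξ => by
    by_contra hcon
    push Not at hcon
    exact hDr (Sh.down s hs ξ r hr.le hcon.le hξ.2)⟩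
  have hne : A.Nonempty := ⟨r0, hr0, hD0⟩
  have hpos : 0 < sSup A := hr0.trans_le (le_csSup hbdd ⟨hr0, hD0⟩)
  refine ⟨sSup A, hpos, ?_, ?_⟩
  · intro ξ h1 h2
    obtain ⟨z, hz, hz2⟩ := exists_lt_of_lt_csSup hne h2
    exact Sh.down s hs z ξ h1.le hz2.le hz.2
  · intro h
    obtain ⟨r', h1, h2⟩ := Sh.openr s hs _ hpos.le h
    have := le_csSup hbdd (show r' ∈ A from ⟨hpos.trans h1, h2⟩)
    linarith

lemma Shoot.x_zero (Sh : Shoot n m p σ α β D u v) (C : Con n m p σ α β γ θ a b)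
    (P : Par m a b β θ) (hγ : 0 < γ) {s ξ0 : ℝ} (hs : s ∈ Icc (0:ℝ) 1) (h0 : 0 < ξ0)
    (h1 : ∀ ξ, 0 < ξ → ξ < ξ0 → D s ξ) (h2 : ¬ D s ξ0) :
    Tendsto (xx m γ (u s)) (𝓝[<] (Real.log ξ0)) (𝓝 0) := by
  have hT := Sh.traj C hs h0 h1
  have hm := C.hm
  have hm1 : 0 < m - 1 := by linarith
  have hc : 0 ≤ (1 - s) * β := mul_nonneg (by linarith [hs.2]) C.hβ.le
  have key : ∀ e, 0 < e → ∃ t, t < Real.log ξ0 ∧ xx m γ (u s) t < e := by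
    intro e he
    by_contra hcon
    push Not at hcon
    have ho := (Sh.uorig s hs).eventually_const_lt (by norm_num : (1/2:ℝ) < 1)
    obtain ⟨r, hr, hr2⟩ := mem_nhdsGT_iff_exists_Ioo_subset.1 ho
    have hr : 0 < r := hr
    have hk : 0 < e ^ (m / (m - 1)) * Real.exp (m * γ * Real.log r) := by positivity
    refine h2 (Sh.ext s hs ξ0 (min (1/2) (e ^ (m / (m - 1)) * Real.exp (m * γ * Real.log r)) / 2) h0
      (by positivity) h1 ?_)
    intro ξ h3 h4
    have hmin : 0 < min (1/2) (e ^ (m / (m - 1)) * Real.exp (m * γ * Real.log r)) := by positivity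
    rcases lt_or_ge ξ r with h5 | h5
    · have : 1 / 2 < u s ξ := hr2 ⟨h3, h5⟩
      have := min_le_left (1/2) (e ^ (m / (m - 1)) * Real.exp (m * γ * Real.log r))
      linarith
    · have hu := Sh.upos hs h3 (h1 ξ h3 h4)
      have e1 := u_of_xx (γ := γ) hm (u := u s) (t := Real.log ξ) (by rwa [Real.exp_log h3])
      rw [Real.exp_log h3] at e1
      have e2 := hcon (Real.log ξ) (Real.log_lt_log h3 h4)
      have e3 := Real.log_le_log hr h5
      have : e ^ (m / (m - 1)) * Real.exp (m * γ * Real.log r) ≤ u s ξ := by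
        rw [e1]
        have hm0 : 0 < m := by linarith
        have hmg : 0 < m * γ := mul_pos hm0 hγ
        have hq : 0 ≤ m / (m - 1) := by positivity
        exact mul_le_mul (Real.rpow_le_rpow he.le e2 hq)
          (Real.exp_le_exp.2 (mul_le_mul_of_nonneg_left e3 hmg.le)) (Real.exp_pos _).le
          (Real.rpow_nonneg (xx_pos _ _ _ _).le _)
      have := min_le_right (1/2) (e ^ (m / (m - 1)) * Real.exp (m * γ * Real.log r))
      linarith
  rw [tendsto_order]
  refine ⟨fun z hz => Eventually.of_forall fun t => hz.trans (xx_pos _ _ _ _), fun e he => ?_⟩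
  obtain ⟨t, ht, hte⟩ := key e he
  filter_upwards [Ioo_mem_nhdsLT ht] with z hz
  exact (hT.x_anti P hc hs.1 hz.1.le hz.2).trans_lt hte

lemma mu_spec {s θ : ℝ} (hs : 0 < s) (hθ : θ < 1) :
    0 < s ^ (-(1 / (2 - θ))) ∧ s * (s ^ (-(1 / (2 - θ)))) ^ (2 - θ) = 1 := by
  have h2 : (2 - θ) ≠ 0 := by linarith
  refine ⟨by positivity, ?_⟩
  rw [← Real.rpow_mul hs.le]
  have : -(1 / (2 - θ)) * (2 - θ) = -1 := by field_simp
  rw [this, Real.rpow_neg_one, mul_inv_cancel₀ hs.ne']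

lemma psi_mul (μ c β t : ℝ) : psi (μ * c) β t = μ * psi c β t := by unfold psi; ring

lemma traj_scale1 {κ c T : ℝ} {x Y : ℝ → ℝ} (hκ : 0 < κ) (hθ : θ < 1)
    (h : Traj m a b β θ κ c T x Y) :
    Traj m a b β θ 1 (κ ^ (-(1 / (2 - θ))) * c) T (fun t => κ ^ (-(1 / (2 - θ))) * x t)
      (fun t => κ ^ (-(1 / (2 - θ))) * Y t) := by
  obtain ⟨h1, h2⟩ := mu_spec hκ hθ
  have := h.scale h1
  rwa [h2] at this

/-- nonnegativity of `W` forces extinction -/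
lemma Shoot.extinct (Sh : Shoot n m p σ α β D u v) (C : Con n m p σ α β γ θ a b)
    (P : Par m a b β θ) (hγ : 0 < γ) (hq1 : (m - 1) * (1 - θ) ≤ 1) {s : ℝ} (hs0 : 0 < s) (hs : s ≤ 1)
    (hW : ∀ t, D s (Real.exp t) →
      0 ≤ psi ((1 - s) * β) β t + a * xx m γ (u s) t - YY m γ (u s) (v s) t) :
    ∃ ξ0, 0 < ξ0 ∧ (∀ ξ, 0 < ξ → ξ < ξ0 → D s ξ) ∧ ¬ D s ξ0 ∧
      Tendsto (xx m γ (u s)) (𝓝[<] (Real.log ξ0)) (𝓝 0) := by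
  have hs' : s ∈ Icc (0:ℝ) 1 := ⟨hs0.le, hs⟩
  have hc : 0 ≤ (1 - s) * β := mul_nonneg (by linarith) C.hβ.le
  rcases Sh.maximal hs' with h | ⟨ξ0, h0, h1, h2⟩
  · exfalso
    obtain ⟨hμ, hμ2⟩ := mu_spec hs0 P.hθ1
    refine no_global P (c := s ^ (-(1 / (2 - θ))) * ((1 - s) * β)) (by positivity) hq1
      (x := fun t => s ^ (-(1 / (2 - θ))) * xx m γ (u s) t)
      (Y := fun t => s ^ (-(1 / (2 - θ))) * YY m γ (u s) (v s) t) ?_ ?_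
    · intro T
      have := Sh.traj C hs' (Real.exp_pos T) (fun ξ h3 _ => h ξ h3)
      rw [Real.log_exp] at this
      exact traj_scale1 hs0 P.hθ1 this
    · intro t
      have := hW t (h _ (Real.exp_pos t))
      rw [psi_mul]
      have := mul_nonneg hμ.le this
      linarith
  · exact ⟨ξ0, h0, h1, h2, Sh.x_zero C P hγ hs' h0 h1 h2⟩

lemma Shoot.contx (Sh : Shoot n m p σ α β D u v) {s t : ℝ} (hs : s ∈ Icc (0:ℝ) 1)
    (h : D s (Real.exp t)) :
    Tendsto (fun s' => xx m γ (u s') t) (𝓝[Icc (0:ℝ) 1] s) (𝓝 (xx m γ (u s) t)) := by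
  have h1 := Sh.contu s hs _ (Real.exp_pos t) h
  have h2 := Sh.upos hs (Real.exp_pos t) h
  unfold xx
  exact (((h1.log h2.ne').const_mul _).sub_const _).rexp

lemma Shoot.contY (Sh : Shoot n m p σ α β D u v) {s t : ℝ} (hs : s ∈ Icc (0:ℝ) 1)
    (h : D s (Real.exp t)) :
    Tendsto (fun s' => YY m γ (u s') (v s') t) (𝓝[Icc (0:ℝ) 1] s) (𝓝 (YY m γ (u s) (v s) t)) := by
  have h1 := Sh.contu s hs _ (Real.exp_pos t) h
  have h2 := Sh.upos hs (Real.exp_pos t) h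
  have h3 := Sh.contv s hs _ (Real.exp_pos t) h
  unfold YY
  exact (Sh.contx hs h).mul (tendsto_const_nhds.sub ((h3.const_mul _).div h1 h2.ne'))

lemma contc (s β : ℝ) (F : Set ℝ) : Tendsto (fun s' => (1 - s') * β) (𝓝[F] s) (𝓝 ((1 - s) * β)) :=
  ((by fun_prop : Continuous fun s' : ℝ => (1 - s') * β).tendsto s).mono_left nhdsWithin_le_nhds

lemma contpsi (s β t : ℝ) (F : Set ℝ) :
    Tendsto (fun s' => psi ((1 - s') * β) β t) (𝓝[F] s) (𝓝 (psi ((1 - s) * β) β t)) := by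
  unfold psi; exact (contc s β F).mul_const _

end

end SSP

namespace SSP

section
variable {n m p σ α β γ θ a b δ M : ℝ} {D : ℝ → ℝ → Prop} {u v : ℝ → ℝ → ℝ}

/-- first shooting set -/
def AOne (m a β γ : ℝ) (D : ℝ → ℝ → Prop) (u v : ℝ → ℝ → ℝ) : Set ℝ :=
  {s | s ∈ Ioo (0:ℝ) 1 ∧ ∃ t, D s (Real.exp t) ∧
    psi ((1 - s) * β) β t + a * xx m γ (u s) t - YY m γ (u s) (v s) t < 0}

/-- second shooting set -/
def ATwo (m b β γ θ δ : ℝ) (D : ℝ → ℝ → Prop) (u v : ℝ → ℝ → ℝ) : Set ℝ :=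
  {s | s ∈ Ioo (0:ℝ) 1 ∧ ∃ t, D s (Real.exp t) ∧
    Trap m b β θ δ (s ^ (-(1 / (2 - θ))) * ((1 - s) * β)) (s ^ (-(1 / (2 - θ))) * xx m γ (u s) t)
      (s ^ (-(1 / (2 - θ))) * YY m γ (u s) (v s) t) t}

lemma nhds_int {s : ℝ} (hs : s ∈ Ioo (0:ℝ) 1) : 𝓝[Icc (0:ℝ) 1] s = 𝓝 s :=
  nhdsWithin_eq_nhds.2 (Icc_mem_nhds hs.1 hs.2)

lemma contmu {s θ : ℝ} (hs : 0 < s) : Tendsto (fun s' : ℝ => s' ^ (-(1 / (2 - θ)))) (𝓝 s)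
    (𝓝 (s ^ (-(1 / (2 - θ))))) :=
  (Real.continuousAt_rpow_const s _ (Or.inl hs.ne')).tendsto

lemma Shoot.evW (Sh : Shoot n m p σ α β D u v) {s t : ℝ} (hs : s ∈ Icc (0:ℝ) 1)
    (h : D s (Real.exp t))
    (hW : psi ((1 - s) * β) β t + a * xx m γ (u s) t - YY m γ (u s) (v s) t < 0) :
    ∀ᶠ s' in 𝓝[Icc (0:ℝ) 1] s, D s' (Real.exp t) ∧
      psi ((1 - s') * β) β t + a * xx m γ (u s') t - YY m γ (u s') (v s') t < 0 :=
  (Sh.opens s hs _ (Real.exp_pos t) h).and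
    ((((contpsi s β t _).add ((Sh.contx hs h).const_mul a)).sub (Sh.contY hs h)).eventually_lt_const hW)

lemma Shoot.open1 (Sh : Shoot n m p σ α β D u v) : IsOpen (AOne m a β γ D u v) := by
  rw [isOpen_iff_mem_nhds]
  rintro s ⟨hs, t, h, hW⟩
  have := Sh.evW (Ioo_subset_Icc_self hs) h hW
  rw [nhds_int hs] at this
  filter_upwards [this, Ioo_mem_nhds hs.1 hs.2] with s' h1 h2 using ⟨h2, t, h1⟩

lemma Shoot.open2 (Sh : Shoot n m p σ α β D u v) (hβ : 0 < β) : IsOpen (ATwo m b β γ θ δ D u v) := by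
  rw [isOpen_iff_mem_nhds]
  rintro s ⟨hs, t, h, hW⟩
  have hs' := Ioo_subset_Icc_self hs
  have h1 := Sh.opens s hs' _ (Real.exp_pos t) h
  have h2 := Sh.contx (γ := γ) hs' h
  have h3 := Sh.contY (γ := γ) hs' h
  have h4 := contc s β (Icc 0 1)
  rw [nhds_int hs] at h1 h2 h3 h4
  have h5 := contmu (θ := θ) hs.1
  have hμ : 0 < s ^ (-(1 / (2 - θ))) := Real.rpow_pos_of_pos hs.1 _
  have hc : 0 < (1 - s) * β := mul_pos (by linarith [hs.2]) hβ
  have h6 := Trap.eventually (h5.mul h4) (h5.mul h2) (h5.mul h3) (mul_pos hμ hc)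
    (mul_pos hμ (xx_pos _ _ _ _)) hW
  filter_upwards [h1, h6, Ioo_mem_nhds hs.1 hs.2] with s' g1 g2 g3 using ⟨g3, t, g1, g2⟩

lemma Shoot.disj (Sh : Shoot n m p σ α β D u v) (C : Con n m p σ α β γ θ a b)
    (P : Small m a b β θ δ) {s : ℝ} (h1 : s ∈ AOne m a β γ D u v)
    (h2 : s ∈ ATwo m b β γ θ δ D u v) : False := by
  obtain ⟨hs, t1, hD1, hW⟩ := h1
  obtain ⟨-, t2, hD2, k1, k2, k3, k4⟩ := h2
  have hs' := Ioo_subset_Icc_self hs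
  have hD : D s (Real.exp (max t1 t2)) := by
    rcases max_cases t1 t2 with h | h <;> rw [h.1] <;> assumption
  obtain ⟨T, hT, tr⟩ := Sh.traj' C hs' hD
  obtain ⟨hμ, hμ2⟩ := mu_spec hs.1 P.hθ1
  have hc : 0 < (1 - s) * β := mul_pos (by linarith [hs.2]) C.hβ
  have e1 := tr.W_neg P.toPar hc.le hs.1.le hW _ (le_max_left t1 t2) hT
  have e2 := (traj_scale1 hs.1 P.hθ1 tr).upper P (mul_pos hμ hc)
    ((le_max_right t1 t2).trans_lt hT) k1 k2 k3 k4 _ (le_max_right t1 t2) hT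
  rw [psi_mul] at e2
  have e3 : 2 * YY m γ (u s) (v s) (max t1 t2) < psi ((1 - s) * β) β (max t1 t2) := by
    by_contra hcon
    push Not at hcon
    have := mul_le_mul_of_nonneg_left hcon hμ.le
    linarith
  have e4 := tr.xpos _ hT
  have e5 := tr.Ypos P.toPar hc.le hs.1.le _ hT
  have e6 := mul_pos P.ha e4
  linarith

lemma Shoot.nonempty1 (Sh : Shoot n m p σ α β D u v) (C : Con n m p σ α β γ θ a b)
    (P : Par m a b β θ) (hγ : 0 < γ) (hq1 : (m - 1) * (1 - θ) ≤ 1) :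
    (AOne m a β γ D u v).Nonempty := by
  have h1 : (1:ℝ) ∈ Icc (0:ℝ) 1 := ⟨zero_le_one, le_rfl⟩
  have hex : ∃ t, D 1 (Real.exp t) ∧
      psi ((1 - 1) * β) β t + a * xx m γ (u 1) t - YY m γ (u 1) (v 1) t < 0 := by
    by_contra hcon
    push Not at hcon
    obtain ⟨ξ0, h0, hD, -, hx⟩ := Sh.extinct C P hγ hq1 zero_lt_one le_rfl hcon
    have tr := Sh.traj C h1 h0 hD
    set T := Real.log ξ0
    set k := (m - 1) / m * a with hk
    have hm := P.hm
    have hmm : 0 < (m - 1) / m := div_pos (by linarith) (by linarith)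
    have hlow : ∀ t, T - 1 ≤ t → t < T →
        xx m γ (u 1) (T - 1) * Real.exp (k * (T - 1)) ≤ xx m γ (u 1) t * Real.exp (k * t) := by
      intro t ht htT
      refine mono_of_deriv (g := fun t => xx m γ (u 1) t * Real.exp (k * t)) ht
        (fun r _ h2 => (tr.dx r (h2.trans_lt htT)).mul
          (((hasDerivAt_id r).const_mul k).exp)) ?_
      intro r _ h2
      have hr := h2.trans_lt htT
      have := hcon r (hD _ (Real.exp_pos r) ((Real.lt_log_iff_exp_lt h0).1 hr))
      have e0 : psi ((1 - 1) * β) β r = 0 := by unfold psi; ring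
      rw [e0] at this
      have e2 : (m - 1) / m * YY m γ (u 1) (v 1) r ≤ (m - 1) / m * (a * xx m γ (u 1) r) :=
        mul_le_mul_of_nonneg_left (by linarith) hmm.le
      have e3 := Real.exp_pos (k * r)
      simp only [id]
      have : 0 ≤ (-((m - 1) / m * YY m γ (u 1) (v 1) r) + (m - 1) / m * (a * xx m γ (u 1) r)) *
        Real.exp (k * r) := mul_nonneg (by linarith) e3.le
      calc (0:ℝ) ≤ _ := this
        _ = _ := by rw [hk]; ring
    have hlim : Tendsto (fun t => xx m γ (u 1) t * Real.exp (k * t)) (𝓝[<] T)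
        (𝓝 (0 * Real.exp (k * T))) :=
      hx.mul (((by fun_prop : Continuous fun t => Real.exp (k * t)).tendsto T).mono_left
        nhdsWithin_le_nhds)
    have := ge_of_tendsto hlim (by
      filter_upwards [Ioo_mem_nhdsLT (sub_one_lt T)] with t ht using hlow t ht.1.le ht.2)
    have h3 := mul_pos (xx_pos m γ (u 1) (T - 1)) (Real.exp_pos (k * (T - 1)))
    linarith
  obtain ⟨t, hD, hW⟩ := hex
  have h2 := Sh.evW h1 hD hW
  have h3 : 𝓝[Ioo (0:ℝ) 1] 1 ≤ 𝓝[Icc (0:ℝ) 1] 1 := nhdsWithin_mono _ Ioo_subset_Icc_self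
  have h4 : (𝓝[Ioo (0:ℝ) 1] 1).NeBot := by
    rw [← mem_closure_iff_nhdsWithin_neBot, closure_Ioo (by norm_num)]; exact h1
  obtain ⟨s, g1, g2⟩ := ((h2.filter_mono h3).and self_mem_nhdsWithin).exists
  exact ⟨s, g2, t, g1⟩

end
end SSP

namespace SSP

section
variable {n m p σ α β γ θ a b δ M : ℝ} {D : ℝ → ℝ → Prop} {u v : ℝ → ℝ → ℝ}

/-- smallness of the trap parameter for small reaction -/
lemma trap_small (P : Small m a b β θ δ) {c x Y s t : ℝ} (hs : 0 < s) (hx : 0 < x) (hc : 0 < c)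
    (h1 : x < δ * psi c β t) (h2 : m * (b * x ^ 2 + s * x ^ θ) < 2 * (psi c β t * Y))
    (h3 : 2 * Y < psi c β t) (h4 : 32 * m * (s ^ (1 / (2 - θ)) / psi c β t) < 1) :
    Trap m b β θ δ (s ^ (-(1 / (2 - θ))) * c) (s ^ (-(1 / (2 - θ))) * x)
      (s ^ (-(1 / (2 - θ))) * Y) t := by
  obtain ⟨hμ, hμ2⟩ := mu_spec hs P.hθ1
  have hinv : s ^ (1 / (2 - θ)) = (s ^ (-(1 / (2 - θ))))⁻¹ := by
    rw [Real.rpow_neg hs.le, inv_inv]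
  rw [hinv] at h4
  set μ := s ^ (-(1 / (2 - θ))) with hμd
  have hψ := psi_pos (β := β) hc t
  have hm := P.hm
  refine ⟨?_, ?_, ?_, Or.inl ?_⟩
  · rw [psi_mul]; have := mul_lt_mul_of_pos_left h1 hμ; linarith
  · rw [psi_mul, Real.mul_rpow hμ.le hx.le]
    have e : μ ^ θ = s * μ ^ 2 := by
      have e2 : μ ^ (2 - θ) * μ ^ θ = μ ^ 2 := by
        rw [← Real.rpow_add hμ, ← Real.rpow_natCast]; congr 1; push_cast; ring
      calc μ ^ θ = (s * μ ^ (2 - θ)) * μ ^ θ := by rw [hμ2, one_mul]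
        _ = _ := by rw [mul_assoc, e2]
    rw [e]
    have := mul_lt_mul_of_pos_left h2 (by positivity : 0 < μ ^ 2)
    linarith
  · rw [psi_mul]; have := mul_lt_mul_of_pos_left h3 hμ; linarith
  · unfold SS
    rw [psi_mul]
    have hG := GG_le_one (θ := θ) (mul_pos hμ hx).le
    have hβ := P.hβθ
    have hq : 0 < (m - 1) * (1 - θ) := mul_pos (by linarith) (by linarith [P.hθ1])
    have hβ1 := P.hβ
    have hk : 0 < 8 / ((m - 1) * (1 - θ)) / β := by positivity
    have e1 : 8 / ((m - 1) * (1 - θ)) / β * GG θ (μ * x) ≤ 8 / ((m - 1) * (1 - θ)) / β :=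
      mul_le_of_le_one_right hk.le hG
    have e2 : 32 * m * (8 / ((m - 1) * (1 - θ)) / β) < 1 := by
      rw [div_div, mul_div_assoc', div_lt_one (by positivity)]; linarith
    have e3 : 1 / (μ * psi c β t) = μ⁻¹ / psi c β t := by field_simp
    rw [e3]
    have e4 := mul_le_mul_of_nonneg_left e1 (by linarith : 0 ≤ 16 * m)
    linarith

lemma Shoot.zero_regime (Sh : Shoot n m p σ α β D u v) (C : Con n m p σ α β γ θ a b)
    (P : Small2 m a b β θ δ (m * γ) M) (hγ : 0 < γ) (hn : 0 < n) :
    ∃ t, D 0 (Real.exp t) ∧ xx m γ (u 0) t < δ * psi ((1 - 0) * β) β t ∧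
      m * (b * xx m γ (u 0) t ^ 2) < 2 * (psi ((1 - 0) * β) β t * YY m γ (u 0) (v 0) t) ∧
      2 * YY m γ (u 0) (v 0) t < psi ((1 - 0) * β) β t := by
  have h0 : (0:ℝ) ∈ Icc (0:ℝ) 1 := ⟨le_rfl, zero_le_one⟩
  have hm := C.hm
  have hα : 0 < α := by rw [C.hα]; exact mul_pos hγ C.hβ
  have hg : 0 < m * γ := P.hg
  have hc : 0 < (1 - 0) * β := by rw [sub_zero, one_mul]; exact C.hβ
  have hv := Sh.vorig 0 h0
  have hu := Sh.uorig 0 h0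
  have hlim : 0 < (1 - 0) * α / n := by rw [sub_zero, one_mul]; positivity
  have ev1 : ∀ᶠ ξ in 𝓝[>] (0:ℝ), 0 < v 0 ξ := by
    filter_upwards [hv.eventually_const_lt hlim, self_mem_nhdsWithin] with ξ h1 h2
    have h2 : 0 < ξ := h2
    exact (div_pos_iff_of_pos_right h2).1 h1
  have ev2 : ∀ᶠ ξ in 𝓝[>] (0:ℝ), 1 / 2 < u 0 ξ := hu.eventually_const_lt (by norm_num)
  have hid : Tendsto (fun ξ : ℝ => ξ) (𝓝[>] (0:ℝ)) (𝓝 0) := nhdsWithin_le_nhds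
  have ev3 : ∀ᶠ ξ in 𝓝[>] (0:ℝ), ξ * v 0 ξ / u 0 ξ < m * γ / 2 := by
    have l1 : Tendsto (fun ξ => v 0 ξ / ξ * (ξ * ξ) / u 0 ξ) (𝓝[>] (0:ℝ))
        (𝓝 ((1 - 0) * α / n * (0 * 0) / 1)) := (hv.mul (hid.mul hid)).div hu one_ne_zero
    rw [zero_mul, mul_zero, zero_div] at l1
    filter_upwards [l1.eventually_lt_const (by linarith : 0 < m * γ / 2), self_mem_nhdsWithin]
      with ξ h1 h2
    have h2 : 0 < ξ := h2
    have : v 0 ξ / ξ * (ξ * ξ) = ξ * v 0 ξ := by field_simp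
    rwa [this] at h1
  have hev1 : ∀ᶠ t in atBot, YY m γ (u 0) (v 0) t < m * γ * xx m γ (u 0) t := by
    filter_upwards [exp_tendsto_right.eventually ev1, exp_tendsto_right.eventually ev2] with t h1 h2
    have hx := xx_pos m γ (u 0) t
    have : 0 < Real.exp t * v 0 (Real.exp t) / u 0 (Real.exp t) := by
      have := Real.exp_pos t
      have : 0 < u 0 (Real.exp t) := by linarith
      positivity
    unfold YY
    have := mul_pos hx this
    linarith
  have hev2 : ∀ᶠ t in atBot, m * γ / 2 * xx m γ (u 0) t < YY m γ (u 0) (v 0) t := by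
    filter_upwards [exp_tendsto_right.eventually ev3] with t h1
    have hx := xx_pos m γ (u 0) t
    unfold YY
    have := mul_lt_mul_of_pos_left h1 hx
    linarith
  have hglob : ∀ ξ, 0 < ξ → D 0 ξ := by
    rcases Sh.maximal h0 with h | ⟨ξ0, k0, k1, k2⟩
    · exact h
    exfalso
    have tr := Sh.traj C h0 k0 k1
    have us := Sh.sol 0 h0 ξ0 k1
    have hy := tr.y_lt P.toSmall.toPar hg P.hbg hc hev1
    have hvp : ∀ ξ, 0 < ξ → ξ < ξ0 → 0 < v 0 ξ := by
      intro ξ h1 h2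
      have h3 := hy (Real.log ξ) (Real.log_lt_log h1 h2)
      have hx := xx_pos m γ (u 0) (Real.log ξ)
      have hup := us.upos ξ h1 h2
      unfold YY at h3
      rw [mul_div_cancel_left₀ _ hx.ne', Real.exp_log h1] at h3
      have h4 : 0 < ξ * v 0 ξ / u 0 ξ := by linarith
      rw [div_pos_iff_of_pos_right hup] at h4
      exact (mul_pos_iff_of_pos_left h1).1 h4
    refine k2 (Sh.ext 0 h0 ξ0 (1 / 2) k0 (by norm_num) k1 ?_)
    intro ξ h1 h2
    obtain ⟨r, hr, hr2⟩ := mem_nhdsGT_iff_exists_Ioo_subset.1 ev2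
    have hr : 0 < r := hr
    have hz : 0 < min (r / 2) ξ := lt_min (by linarith) h1
    have e1 : 1 / 2 < u 0 (min (r / 2) ξ) := hr2 ⟨hz, (min_le_left _ _).trans_lt (by linarith)⟩
    have e2 := mono_of_deriv (min_le_right (r / 2) ξ)
      (fun t g1 g2 => us.du t (hz.trans_le g1) (g2.trans_lt h2))
      (fun t g1 g2 => (hvp t (hz.trans_le g1) (g2.trans_lt h2)).le)
    linarith
  have htr : ∀ T, Traj m a b β θ 0 ((1 - 0) * β) T (xx m γ (u 0)) (YY m γ (u 0) (v 0)) := by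
    intro T
    have := Sh.traj C h0 (Real.exp_pos T) (fun ξ h3 _ => hglob ξ h3)
    rwa [Real.log_exp] at this
  obtain ⟨t, ht⟩ := regime1 P hc htr hev1 hev2
  exact ⟨t, hglob _ (Real.exp_pos t), ht⟩

lemma Shoot.nonempty2 (Sh : Shoot n m p σ α β D u v) (C : Con n m p σ α β γ θ a b)
    (P : Small2 m a b β θ δ (m * γ) M) (hγ : 0 < γ) (hn : 0 < n) :
    (ATwo m b β γ θ δ D u v).Nonempty := by
  obtain ⟨t, hD, h1, h2, h3⟩ := Sh.zero_regime C P hγ hn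
  have h0 : (0:ℝ) ∈ Icc (0:ℝ) 1 := ⟨le_rfl, zero_le_one⟩
  have hc : 0 < (1 - 0) * β := by rw [sub_zero, one_mul]; exact C.hβ
  have hψ0 := psi_pos (β := β) hc t
  have hx0 := xx_pos m γ (u 0) t
  have hψ := contpsi 0 β t (Icc 0 1)
  have hx := Sh.contx (γ := γ) h0 hD
  have hY := Sh.contY (γ := γ) h0 hD
  have hθ2 : 0 < 1 / (2 - θ) := by have := P.hθ1; positivity [(by linarith : 0 < 2 - θ)]
  have hid : Tendsto (fun s : ℝ => s) (𝓝[Icc (0:ℝ) 1] 0) (𝓝 0) := nhdsWithin_le_nhds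
  have hsr : Tendsto (fun s : ℝ => s ^ (1 / (2 - θ))) (𝓝[Icc (0:ℝ) 1] 0) (𝓝 0) := by
    have := ((Real.continuousAt_rpow_const 0 (1 / (2 - θ)) (Or.inr hθ2.le)).tendsto).comp hid
    rwa [Real.zero_rpow hθ2.ne'] at this
  have e1 := hx.eventually_lt (hψ.const_mul δ) h1
  have e2 := Tendsto.eventually_lt (((((hx.pow 2).const_mul b).add
    (hid.mul (hx.rpow_const (p := θ) (Or.inl hx0.ne')))).const_mul m)) ((hψ.mul hY).const_mul 2)
    (by simpa using h2)
  have e3 := (hY.const_mul 2).eventually_lt hψ h3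
  have e4 := ((hsr.div hψ hψ0.ne').const_mul (32 * m)).eventually_lt_const
    (by simp : 32 * m * (0 / psi ((1 - 0) * β) β t) < 1)
  have e5 := Sh.opens 0 h0 _ (Real.exp_pos t) hD
  have hle : 𝓝[Ioo (0:ℝ) 1] 0 ≤ 𝓝[Icc (0:ℝ) 1] 0 := nhdsWithin_mono _ Ioo_subset_Icc_self
  have hnb : (𝓝[Ioo (0:ℝ) 1] 0).NeBot := by
    rw [← mem_closure_iff_nhdsWithin_neBot, closure_Ioo (by norm_num)]; exact h0
  obtain ⟨s, ⟨g1, g2, g3, g4, g5⟩, hs⟩ := (((e1.and (e2.and (e3.and (e4.and e5)))).filter_mono hle).and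
    self_mem_nhdsWithin).exists
  exact ⟨s, hs, t, g5, trap_small P.toSmall hs.1 (xx_pos _ _ _ _)
    (mul_pos (by linarith [hs.2]) C.hβ) g1 g2 g3 g4⟩

end
end SSP

namespace SSP

section
variable {n m p σ α β γ θ a b δ M : ℝ} {D : ℝ → ℝ → Prop} {u v : ℝ → ℝ → ℝ}

lemma Shoot.critical (Sh : Shoot n m p σ α β D u v) (C : Con n m p σ α β γ θ a b)
    (P : Small2 m a b β θ δ (m * γ) M) (hγ : 0 < γ) (hn : 0 < n) (hq1 : (m - 1) * (1 - θ) ≤ 1) :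
    ∃ s ∈ Ioo (0:ℝ) 1, s ∉ AOne m a β γ D u v ∧ s ∉ ATwo m b β γ θ δ D u v := by
  by_contra hcon
  push Not at hcon
  have hcov : Ioo (0:ℝ) 1 ⊆ AOne m a β γ D u v ∪ ATwo m b β γ θ δ D u v := by
    intro s hs
    by_cases h : s ∈ AOne m a β γ D u v
    · exact Or.inl h
    · exact Or.inr (hcon s hs h)
  obtain ⟨s1, h1⟩ := Sh.nonempty1 C P.toSmall.toPar hγ hq1
  obtain ⟨s2, h2⟩ := Sh.nonempty2 C P hγ hn
  obtain ⟨s, hs, h3, h4⟩ := isPreconnected_Ioo _ _ Sh.open1 (Sh.open2 C.hβ) hcov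
    ⟨s1, h1.1, h1⟩ ⟨s2, h2.1, h2⟩
  exact Sh.disj C P.toSmall h3 h4

/-- the outcome of the shooting argument -/
lemma Shoot.outcome (Sh : Shoot n m p σ α β D u v) (C : Con n m p σ α β γ θ a b)
    (P : Small2 m a b β θ δ (m * γ) M) (hγ : 0 < γ) (hn : 0 < n) (hq1 : (m - 1) * (1 - θ) ≤ 1) :
    ∃ s ∈ Ioo (0:ℝ) 1, ∃ ξ0, 0 < ξ0 ∧ (∀ ξ, 0 < ξ → ξ < ξ0 → D s ξ) ∧ ¬ D s ξ0 ∧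
      Tendsto (u s) (𝓝[<] ξ0) (𝓝 0) ∧ Tendsto (v s) (𝓝[<] ξ0) (𝓝 0) ∧
      ∃ k, 0 < k ∧ Tendsto (fun t => xx m γ (u s) t / (Real.log ξ0 - t)) (𝓝[<] (Real.log ξ0)) (𝓝 k) := by
  obtain ⟨s, hs, hA1, hA2⟩ := Sh.critical C P hγ hn hq1
  have hs' := Ioo_subset_Icc_self hs
  have hW : ∀ t, D s (Real.exp t) →
      0 ≤ psi ((1 - s) * β) β t + a * xx m γ (u s) t - YY m γ (u s) (v s) t := by
    intro t ht
    by_contra hcon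
    push Not at hcon
    exact hA1 ⟨hs, t, ht, hcon⟩
  have PP := P.toSmall.toPar
  have hm := C.hm
  have hm1 : 0 < m - 1 := by linarith
  obtain ⟨ξ0, h0, hD, hnD, hx⟩ := Sh.extinct C PP hγ hq1 hs.1 hs.2.le hW
  refine ⟨s, hs, ξ0, h0, hD, hnD, ?_⟩
  have tr := Sh.traj C hs' h0 hD
  have hDe : ∀ t, t < Real.log ξ0 → D s (Real.exp t) := fun t ht =>
    hD _ (Real.exp_pos t) ((Real.lt_log_iff_exp_lt h0).1 ht)
  set T := Real.log ξ0 with hTd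
  obtain ⟨hμ, hμ2⟩ := mu_spec hs.1 PP.hθ1
  have hc : 0 < (1 - s) * β := mul_pos (by linarith [hs.2]) C.hβ
  have tr1 := traj_scale1 hs.1 PP.hθ1 tr
  set μ := s ^ (-(1 / (2 - θ))) with hμd
  have hx1 : Tendsto (fun t => μ * xx m γ (u s) t) (𝓝[<] T) (𝓝 0) := by
    simpa using hx.const_mul μ
  have hβ0 : 0 ≤ β := C.hβ.le
  obtain ⟨l, hl, hleq⟩ := tr1.Y_conv PP (mul_pos hμ hc) hx1 (sub_one_lt T)
    (M := μ * (psi ((1 - s) * β) β (T - 1) + a * xx m γ (u s) (T - 1))) (by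
      intro t ht htT
      refine mul_le_mul_of_nonneg_left ?_ hμ.le
      have e1 := hW t (hDe t htT)
      have e2 := psi_anti hc.le C.hβ ht
      have e3 := mul_le_mul_of_nonneg_left (tr.x_anti PP hc.le hs.1.le ht htT) PP.ha.le
      linarith)
  have hl0 : 0 ≤ l := ge_of_tendsto hl (by
    filter_upwards [self_mem_nhdsWithin] with t ht
    exact (tr1.Ypos PP (mul_pos hμ hc).le zero_le_one t ht).le)
  have hlne : l ≠ 0 := by
    intro hl'
    rcases PP.hθ0.eq_or_lt with hθ | hθ
    · rw [← hθ, Real.rpow_zero, hl'] at hleq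
      norm_num at hleq
      linarith
    · rw [hl'] at hl
      obtain ⟨t, ht, htrap⟩ := tr1.zero_trap P.toSmall (mul_pos hμ hc) hθ hx1 hl
      exact hA2 ⟨hs, t, hDe t ht, htrap⟩
  have hlp : 0 < l := lt_of_le_of_ne hl0 hlne.symm
  have hY : Tendsto (YY m γ (u s) (v s)) (𝓝[<] T) (𝓝 (μ⁻¹ * l)) := by
    have := hl.const_mul μ⁻¹
    simpa [inv_mul_cancel_left₀ hμ.ne'] using this
  have hlog := log_tendsto_left h0
  have hupos : ∀ ξ, 0 < ξ → ξ < ξ0 → 0 < u s ξ := fun ξ h1 h2 => Sh.upos hs' h1 (hD ξ h1 h2)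
  have hxl := hx.comp hlog
  have hYl := hY.comp hlog
  have hlg : Tendsto Real.log (𝓝[<] ξ0) (𝓝 T) := hlog.mono_right nhdsWithin_le_nhds
  have hq : 0 < m / (m - 1) := by have : 0 < m := by linarith
                                  positivity
  have hq' : 0 < 1 / (m - 1) := by positivity
  have hee : Tendsto (fun ξ => Real.exp (m * γ * Real.log ξ)) (𝓝[<] ξ0) (𝓝 (Real.exp (m * γ * T))) :=
    (hlg.const_mul _).rexp
  have hu0 : Tendsto (u s) (𝓝[<] ξ0) (𝓝 0) := by
    have l1 := (hxl.rpow_const (p := m / (m - 1)) (Or.inr hq.le)).mul hee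
    rw [Real.zero_rpow hq.ne', zero_mul] at l1
    refine l1.congr' ?_
    filter_upwards [Ioo_mem_nhdsLT h0] with ξ hξ
    have := u_of_xx (γ := γ) hm (u := u s) (t := Real.log ξ) (by
      rw [Real.exp_log hξ.1]; exact hupos ξ hξ.1 hξ.2)
    rw [Real.exp_log hξ.1] at this
    simpa using this.symm
  refine ⟨hu0, ?_, _, ?_, tr.typeI PP hx hY⟩
  · have l1 := ((hu0.const_mul (m * γ)).sub (hYl.mul ((hxl.rpow_const (p := 1 / (m - 1))
      (Or.inr hq'.le)).mul hee))).mul (hlg.neg.rexp)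
    rw [Real.zero_rpow hq'.ne', zero_mul, mul_zero, mul_zero, sub_zero, zero_mul] at l1
    refine l1.congr' ?_
    filter_upwards [Ioo_mem_nhdsLT h0] with ξ hξ
    have := v_of_xx (γ := γ) hm (u := u s) (v := v s) (t := Real.log ξ) (by
      rw [Real.exp_log hξ.1]; exact hupos ξ hξ.1 hξ.2)
    rw [Real.exp_log hξ.1] at this
    simpa using this.symm
  · have : 0 < m := by linarith
    positivity

end
end SSP

namespace SSP

lemma solve_scale {m p σ ε κ : ℝ} (hε : 0 < ε) (hκ : 0 < κ) (hL : 0 < σ * (m - 1) + 2 * (p - 1)) :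
    ∃ A l : ℝ, 0 < A ∧ 0 < l ∧ ε * A ^ (m - 1) = l ^ (2:ℝ) ∧ κ * A ^ (m - p) = l ^ (σ + 2) := by
  set x := (2 * Real.log κ - (σ + 2) * Real.log ε) / (σ * (m - 1) + 2 * (p - 1)) with hx
  set y := (Real.log ε + (m - 1) * x) / 2 with hy
  have e : x * (σ * (m - 1) + 2 * (p - 1)) = 2 * Real.log κ - (σ + 2) * Real.log ε := by
    rw [hx]; field_simp
  refine ⟨Real.exp x, Real.exp y, Real.exp_pos _, Real.exp_pos _, ?_, ?_⟩
  · rw [← Real.exp_mul, ← Real.exp_mul]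
    conv_lhs => rw [← Real.exp_log hε]
    rw [← Real.exp_add]; congr 1; rw [hy]; ring
  · rw [← Real.exp_mul, ← Real.exp_mul]
    conv_lhs => rw [← Real.exp_log hκ]
    rw [← Real.exp_add]; congr 1; rw [hy]; linear_combination (-1/2) * e

lemma USol.rescale {n m p σ α β ε κ R A l : ℝ} {u v : ℝ → ℝ} (hm : 1 < m)
    (h : USol n m p σ α β ε κ R u v) (hA : 0 < A) (hl : 0 < l)
    (h1 : ε * A ^ (m - 1) = l ^ (2:ℝ)) (h2 : κ * A ^ (m - p) = l ^ (σ + 2)) :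
    USol n m p σ α β 1 1 (l * R) (fun ξ => A ^ m * u (ξ / l)) (fun ξ => A ^ m / l * v (ξ / l)) := by
  have hAm : 0 < A ^ m := Real.rpow_pos_of_pos hA m
  have hm0 : 0 < m := by linarith
  have base : ∀ ξ, 0 < ξ → ξ < l * R → 0 < ξ / l ∧ ξ / l < R := fun ξ g1 g2 =>
    ⟨div_pos g1 hl, by rw [div_lt_iff₀ hl]; linarith⟩
  have dd : ∀ ξ, HasDerivAt (fun ξ => ξ / l) (1 / l) ξ := fun ξ => (hasDerivAt_id ξ).div_const l
  refine ⟨fun ξ g1 g2 => mul_pos hAm (h.upos _ (base ξ g1 g2).1 (base ξ g1 g2).2),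
    fun ξ g1 g2 => ?_, fun ξ g1 g2 => ?_⟩
  · refine (((h.du _ (base ξ g1 g2).1 (base ξ g1 g2).2).comp ξ (dd ξ)).const_mul (A ^ m)).congr_deriv ?_
    ring
  · refine (((h.dv _ (base ξ g1 g2).1 (base ξ g1 g2).2).comp ξ (dd ξ)).const_mul
      (A ^ m / l)).congr_deriv ?_
    have hu := h.upos _ (base ξ g1 g2).1 (base ξ g1 g2).2
    set U := u (ξ / l)
    set V := v (ξ / l)
    have r1 : (A ^ m * U) ^ (1 / m) = A * U ^ (1 / m) := by
      rw [Real.mul_rpow hAm.le hu.le, ← Real.rpow_mul hA.le]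
      rw [mul_one_div_cancel hm0.ne', Real.rpow_one]
    have r2 : (A ^ m * U) ^ (1 / m - 1) = A / A ^ m * U ^ (1 / m - 1) := by
      rw [Real.mul_rpow hAm.le hu.le, ← Real.rpow_mul hA.le]
      have : m * (1 / m - 1) = 1 - m := by field_simp
      rw [this, Real.rpow_sub hA, Real.rpow_one]
    have r3 : (A ^ m * U) ^ (p / m) = A ^ p * U ^ (p / m) := by
      rw [Real.mul_rpow hAm.le hu.le, ← Real.rpow_mul hA.le]
      rw [mul_div_cancel₀ _ hm0.ne']
    have r4 : (ξ / l) ^ σ = ξ ^ σ / l ^ σ := Real.div_rpow g1.le hl.le σ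
    have k1 : ε * A ^ m = l ^ 2 * A := by
      have : A ^ m = A ^ (m - 1) * A := by rw [← Real.rpow_add_one hA.ne']; congr 1; ring
      rw [this, ← mul_assoc, h1]; norm_num
    have k2 : κ * A ^ m = l ^ σ * l ^ 2 * A ^ p := by
      have : A ^ m = A ^ (m - p) * A ^ p := by rw [← Real.rpow_add hA]; congr 1; ring
      rw [this, ← mul_assoc, h2, Real.rpow_add hl]; norm_num
    have hls : 0 < l ^ σ := Real.rpow_pos_of_pos hl σ
    rw [r1, r2, r3, r4]
    have e1 : ε = l ^ 2 * A / A ^ m := by rw [eq_div_iff hAm.ne']; exact k1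
    have e2 : κ = l ^ σ * l ^ 2 * A ^ p / A ^ m := by rw [eq_div_iff hAm.ne']; exact k2
    rw [e1, e2]
    field_simp

lemma profile_of_usol {N : ℕ} {m p σ R U0 : ℝ} {U V : ℝ → ℝ} (hm : 1 < m) (hR : 0 < R)
    (hN : 1 ≤ N)
    (h : USol (N : ℝ) m p σ (alphaC m p σ) (betaC m p σ) 1 1 R U V)
    (hU0 : 0 < U0) (h0 : U 0 = U0) (h1 : Tendsto U (𝓝[>] 0) (𝓝 U0)) (h2 : U R = 0)
    (h3 : Tendsto U (𝓝[<] R) (𝓝 0)) (h4 : Tendsto V (𝓝[<] R) (𝓝 0))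
    (h5 : Tendsto (fun ξ => V ξ / ξ) (𝓝[>] 0) (𝓝 (alphaC m p σ * U0 ^ (1 / m) / N))) :
    ProfileWithInterface N m p σ (fun ξ => U ξ ^ (1 / m)) R ∧
      BehB1 N m p σ (fun ξ => U ξ ^ (1 / m)) := by
  have hm0 : 0 < m := by linarith
  have hmi : 0 < 1 / m := by positivity
  have hid : ∀ ξ, 0 < ξ → ξ < R → (U ξ ^ (1 / m)) ^ m = U ξ := fun ξ g1 g2 => by
    rw [← Real.rpow_mul (h.upos ξ g1 g2).le, one_div_mul_cancel hm0.ne', Real.rpow_one]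
  have hdf : ∀ ξ, 0 < ξ → ξ < R → HasDerivAt (fun x => (U x ^ (1 / m)) ^ m) (V ξ) ξ := by
    intro ξ g1 g2
    refine (h.du ξ g1 g2).congr_of_eventuallyEq ?_
    filter_upwards [Ioo_mem_nhds g1 g2] with z hz using hid z hz.1 hz.2
  have hdV : ∀ ξ, 0 < ξ → ξ < R →
      deriv (fun x => (U x ^ (1 / m)) ^ m) =ᶠ[𝓝 ξ] V := by
    intro ξ g1 g2
    filter_upwards [Ioo_mem_nhds g1 g2] with z hz using (hdf z hz.1 hz.2).deriv
  have hcU : ContinuousOn U (Icc 0 R) := by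
    intro ξ hξ
    rcases hξ.1.eq_or_lt with g1 | g1
    · rw [← g1]
      refine ContinuousWithinAt.mono (t := Ici 0) ?_ Icc_subset_Ici_self
      rw [← continuousWithinAt_Ioi_iff_Ici]
      unfold ContinuousWithinAt
      rw [h0]; exact h1
    rcases hξ.2.eq_or_lt with g2 | g2
    · rw [g2]
      refine ContinuousWithinAt.mono (t := Iic R) ?_ Icc_subset_Iic_self
      rw [← continuousWithinAt_Iio_iff_Iic]
      unfold ContinuousWithinAt
      rw [h2]; exact h3
    · exact (h.du ξ g1 g2).continuousAt.continuousWithinAt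
  have hC2 : ContDiffOn ℝ 2 U (Ioo 0 R) := by
    have hV1 : ContDiffOn ℝ 1 V (Ioo 0 R) := by
      rw [show (1 : WithTop ℕ∞) = 0 + 1 by norm_num, contDiffOn_succ_iff_deriv_of_isOpen isOpen_Ioo]
      refine ⟨fun ξ hξ => (h.dv ξ hξ.1 hξ.2).differentiableAt.differentiableWithinAt, by simp, ?_⟩
      rw [contDiffOn_zero]
      have hUc : ContinuousOn U (Ioo 0 R) := fun ξ hξ =>
        (h.du ξ hξ.1 hξ.2).continuousAt.continuousWithinAt
      have hVc : ContinuousOn V (Ioo 0 R) := fun ξ hξ =>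
        (h.dv ξ hξ.1 hξ.2).continuousAt.continuousWithinAt
      have hUr : ∀ q : ℝ, ContinuousOn (fun ξ => U ξ ^ q) (Ioo 0 R) := fun q =>
        hUc.rpow_const fun ξ hξ => Or.inl (h.upos ξ hξ.1 hξ.2).ne'
      have hξr : ContinuousOn (fun ξ : ℝ => ξ ^ σ) (Ioo 0 R) :=
        continuousOn_id.rpow_const fun ξ hξ => Or.inl hξ.1.ne'
      have hdiv : ContinuousOn (fun ξ : ℝ => ((N:ℝ) - 1) / ξ) (Ioo 0 R) :=
        continuousOn_const.div continuousOn_id fun ξ hξ => hξ.1.ne'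
      refine ContinuousOn.congr (f := fun ξ => -(((N:ℝ) - 1) / ξ * V ξ) +
        1 * alphaC m p σ * U ξ ^ (1 / m)
        - 1 * betaC m p σ * ξ * (1 / m * U ξ ^ (1 / m - 1) * V ξ) - 1 * ξ ^ σ * U ξ ^ (p / m)) ?_
        fun ξ hξ => (h.dv ξ hξ.1 hξ.2).deriv
      exact (((hdiv.mul hVc).neg.add (continuousOn_const.mul (hUr _))).sub
        ((continuousOn_const.mul continuousOn_id).mul ((continuousOn_const.mul (hUr _)).mul hVc))).sub
        ((continuousOn_const.mul hξr).mul (hUr _))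
    rw [show (2 : WithTop ℕ∞) = 1 + 1 by norm_num, contDiffOn_succ_iff_deriv_of_isOpen isOpen_Ioo]
    refine ⟨fun ξ hξ => (h.du ξ hξ.1 hξ.2).differentiableAt.differentiableWithinAt, by simp, ?_⟩
    exact hV1.congr fun ξ hξ => (h.du ξ hξ.1 hξ.2).deriv
  refine ⟨⟨hR, hcU.rpow_const fun ξ _ => Or.inr hmi.le,
    fun ξ hξ => Real.rpow_pos_of_pos (h.upos ξ hξ.1 hξ.2) _,
    hC2.rpow_const_of_ne fun ξ hξ => (h.upos ξ hξ.1 hξ.2).ne', ?_, ?_, ?_⟩, ?_, ?_⟩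
  · intro ξ hξ
    have hu := h.upos ξ hξ.1 hξ.2
    unfold SSODE
    rw [(hdV ξ hξ.1 hξ.2).deriv_eq, (h.dv ξ hξ.1 hξ.2).deriv, (hdf ξ hξ.1 hξ.2).deriv,
      ((h.du ξ hξ.1 hξ.2).rpow_const (p := 1 / m) (Or.inl hu.ne')).deriv, ← Real.rpow_mul hu.le]
    have : 1 / m * p = p / m := by ring
    rw [this]
    ring
  · simp only [h2]; exact Real.zero_rpow hmi.ne'
  · refine h4.congr' ?_
    filter_upwards [Ioo_mem_nhdsLT hR] with ξ hξ using (hdf ξ hξ.1 hξ.2).deriv.symm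
  · simp only [h0]; positivity
  · have hq : ∀ z : ℝ, 0 ≤ z → (z ^ (1 / m)) ^ (m - 1) = z ^ ((m - 1) / m) := fun z hz => by
      rw [← Real.rpow_mul hz]; congr 1; ring
    have hN0 : (0:ℝ) < N := by exact_mod_cast hN
    have key : Tendsto (fun ξ => (U ξ ^ ((m - 1) / m) - U0 ^ ((m - 1) / m)) / ξ ^ 2) (𝓝[>] 0)
        (𝓝 (alphaC m p σ * (m - 1) / (2 * m * (N : ℝ)))) := by
      refine HasDerivAt.lhopital_zero_nhdsGT
        (f' := fun ξ => V ξ * ((m - 1) / m) * U ξ ^ ((m - 1) / m - 1)) (g' := fun ξ => 2 * ξ) ?_ ?_ ?_ ?_ ?_ ?_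
      · filter_upwards [Ioo_mem_nhdsGT hR] with ξ hξ
        exact ((h.du ξ hξ.1 hξ.2).rpow_const (Or.inl (h.upos ξ hξ.1 hξ.2).ne')).sub_const _
      · filter_upwards with ξ
        simpa using hasDerivAt_pow 2 ξ
      · filter_upwards [self_mem_nhdsWithin] with ξ hξ
        have : 0 < ξ := hξ
        positivity
      · have := (h1.rpow_const (p := (m - 1) / m) (Or.inl hU0.ne')).sub_const (U0 ^ ((m - 1) / m))
        rwa [sub_self] at this
      · have : Tendsto (fun ξ : ℝ => ξ ^ 2) (𝓝 0) (𝓝 (0 ^ 2)) := (continuous_pow 2).tendsto 0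
        rw [zero_pow two_ne_zero] at this
        exact this.mono_left nhdsWithin_le_nhds
      · have l1 := (h5.mul (h1.rpow_const (p := (m - 1) / m - 1) (Or.inl hU0.ne'))).mul_const
          ((m - 1) / m / 2)
        have e : alphaC m p σ * U0 ^ (1 / m) / N * U0 ^ ((m - 1) / m - 1) * ((m - 1) / m / 2) =
            alphaC m p σ * (m - 1) / (2 * m * (N : ℝ)) := by
          have : U0 ^ (1 / m) * U0 ^ ((m - 1) / m - 1) = 1 := by
            rw [← Real.rpow_add hU0]
            have : 1 / m + ((m - 1) / m - 1) = 0 := by field_simp; ring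
            rw [this, Real.rpow_zero]
          calc _ = alphaC m p σ / N * (U0 ^ (1 / m) * U0 ^ ((m - 1) / m - 1)) * ((m - 1) / m / 2) := by ring
            _ = _ := by rw [this]; field_simp
        rw [e] at l1
        refine l1.congr' ?_
        filter_upwards [self_mem_nhdsWithin] with ξ hξ
        have : 0 < ξ := hξ
        field_simp
    refine key.congr' ?_
    filter_upwards [Ioo_mem_nhdsGT hR] with ξ hξ
    simp only [h0]
    rw [hq _ (h.upos ξ hξ.1 hξ.2).le, hq _ hU0.le]

end SSP

namespace SSP

lemma div_tendsto_right {l : ℝ} (hl : 0 < l) : Tendsto (fun ξ : ℝ => ξ / l) (𝓝[>] 0) (𝓝[>] 0) := by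
  refine tendsto_nhdsWithin_iff.2 ⟨?_, ?_⟩
  · have := ((by fun_prop : Continuous fun ξ : ℝ => ξ / l).tendsto 0).mono_left
      (nhdsWithin_le_nhds (s := Ioi 0))
    rwa [zero_div] at this
  · filter_upwards [self_mem_nhdsWithin] with ξ hξ
    exact div_pos hξ hl

lemma div_tendsto_left {l r : ℝ} (hl : 0 < l) :
    Tendsto (fun ξ : ℝ => ξ / l) (𝓝[<] (l * r)) (𝓝[<] r) := by
  refine tendsto_nhdsWithin_iff.2 ⟨?_, ?_⟩
  · have := ((by fun_prop : Continuous fun ξ : ℝ => ξ / l).tendsto (l * r)).mono_left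
      (nhdsWithin_le_nhds (s := Iio (l * r)))
    rwa [mul_div_cancel_left₀ _ hl.ne'] at this
  · filter_upwards [self_mem_nhdsWithin] with ξ hξ
    have hξ : ξ < l * r := hξ
    change ξ / l < r
    rw [div_lt_iff₀ hl]; linarith

lemma sub_tendsto_left (d r : ℝ) :
    Tendsto (fun t : ℝ => t - d) (𝓝[<] (r + d)) (𝓝[<] r) := by
  refine tendsto_nhdsWithin_iff.2 ⟨?_, ?_⟩
  · have := ((by fun_prop : Continuous fun t : ℝ => t - d).tendsto (r + d)).mono_left
      (nhdsWithin_le_nhds (s := Iio (r + d)))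
    rwa [add_sub_cancel_right] at this
  · filter_upwards [self_mem_nhdsWithin] with ξ hξ
    have hξ : ξ < r + d := hξ
    change ξ - d < r
    linarith

theorem part_two {N : ℕ} {m p σ γ θ a b δ M : ℝ} (hp0 : 0 < p) (hp1 : p < 1) (hN : 1 ≤ N)
    (hL : 0 < σ * (m - 1) + 2 * (p - 1))
    (C : Con (N : ℝ) m p σ (alphaC m p σ) (betaC m p σ) γ θ a b)
    (P : Small2 m a b (betaC m p σ) θ δ (m * γ) M) (hθ : (m - 1) * (1 - θ) = 1 - p) (hγ : 0 < γ) :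
    ∃ f : ℝ → ℝ, ∃ ξ0 : ℝ, ProfileWithInterface N m p σ f ξ0 ∧ TypeI m f ξ0 ∧ BehB1 N m p σ f := by
  have hm := C.hm
  have hm0 : 0 < m := by linarith
  have hm1 : 0 < m - 1 := by linarith
  have hN0 : (0:ℝ) < N := by exact_mod_cast hN
  have hσ : 0 < σ := by
    by_contra hcon
    push Not at hcon
    have := mul_nonneg (neg_nonneg.2 hcon) hm1.le
    linarith
  have hα : 0 < alphaC m p σ := by rw [C.hα]; exact mul_pos hγ C.hβ
  obtain ⟨D, u, v, Sh⟩ := shoot_exists hN (⟨hm, hp0, hp1, hσ, hα, C.hβ⟩ : GP m p σ _ _)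
  obtain ⟨s, hs, r, hr, hD, hnD, hu0, hv0, k, hk, hx⟩ := Sh.outcome C P hγ hN0 (by linarith)
  have hs' := Ioo_subset_Icc_self hs
  have us := Sh.sol s hs' r hD
  obtain ⟨A, l, hA, hl, e1, e2⟩ := solve_scale (m := m) (p := p) (σ := σ)
    (by linarith [hs.2] : 0 < 1 - s) hs.1 hL
  have US := us.rescale hm hA hl e1 e2
  have hAm : 0 < A ^ m := Real.rpow_pos_of_pos hA m
  have hR : 0 < l * r := mul_pos hl hr
  have hprof := profile_of_usol hm hR hN US hAm (by simp [Sh.u0 s hs'])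
    (by simpa using ((Sh.uorig s hs').comp (div_tendsto_right hl)).const_mul (A ^ m))
    (by simp [mul_div_cancel_left₀ r hl.ne', Sh.zero s r hnD])
    (by simpa using (hu0.comp (div_tendsto_left hl)).const_mul (A ^ m))
    (by simpa using (hv0.comp (div_tendsto_left hl)).const_mul (A ^ m / l))
    (by
      have l1 := ((Sh.vorig s hs').comp (div_tendsto_right hl)).const_mul (A ^ m / l ^ 2)
      have e : A ^ m / l ^ 2 * ((1 - s) * alphaC m p σ / N) =
          alphaC m p σ * (A ^ m) ^ (1 / m) / N := by
        rw [← Real.rpow_mul hA.le, mul_one_div_cancel hm0.ne', Real.rpow_one]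
        have h1 : A ^ m = A ^ (m - 1) * A := by rw [← Real.rpow_add_one hA.ne']; congr 1; ring
        have h2 : l ^ 2 = (1 - s) * A ^ (m - 1) := by rw [e1]; norm_num
        have h3 : 0 < A ^ (m - 1) := Real.rpow_pos_of_pos hA _
        have h4 : 0 < 1 - s := by linarith [hs.2]
        rw [h1, h2]; field_simp
      rw [e] at l1
      refine l1.congr' ?_
      filter_upwards [self_mem_nhdsWithin] with ξ hξ
      have : 0 < ξ := hξ
      simp only [Function.comp]
      field_simp)
  refine ⟨_, _, hprof.1, ?_, hprof.2⟩
  have hlog : Real.log (l * r) = Real.log r + Real.log l := by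
    rw [Real.log_mul hl.ne' hr.ne']; ring
  set c := A ^ (m - 1) * Real.exp (-(γ * (m - 1) * Real.log l)) with hc
  have hcp : 0 < c := mul_pos (Real.rpow_pos_of_pos hA _) (Real.exp_pos _)
  refine type_conv (γ := γ) hR hm1 (mul_pos hcp hk) hprof.1.2.2.1 ?_
  have l1 := (hx.comp (sub_tendsto_left (Real.log l) (Real.log r))).const_mul c
  rw [hlog]
  refine l1.congr' ?_
  filter_upwards [self_mem_nhdsWithin] with t ht
  have ht : t < Real.log r + Real.log l := ht
  simp only [Function.comp]
  have hexp : Real.exp t / l = Real.exp (t - Real.log l) := by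
    rw [Real.exp_sub, Real.exp_log hl]
  have hup : 0 < u s (Real.exp (t - Real.log l)) :=
    us.upos _ (Real.exp_pos _) ((Real.lt_log_iff_exp_lt hr).1 (by linarith))
  rw [hexp]
  set z := u s (Real.exp (t - Real.log l)) with hz
  have hxx : xx m γ (u s) (t - Real.log l) =
      z ^ ((m - 1) / m) * Real.exp (-(γ * (m - 1) * (t - Real.log l))) := by
    unfold xx
    rw [← hz, Real.rpow_def_of_pos hup, ← Real.exp_add]; congr 1; ring
  have hpow : ((A ^ m * z) ^ (1 / m)) ^ (m - 1) = A ^ (m - 1) * z ^ ((m - 1) / m) := by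
    rw [← Real.rpow_mul (mul_pos hAm hup).le, Real.mul_rpow hAm.le hup.le, ← Real.rpow_mul hA.le]
    have g1 : m * (1 / m * (m - 1)) = m - 1 := by field_simp
    have g2 : 1 / m * (m - 1) = (m - 1) / m := by ring
    rw [g1, g2]
  have hE : Real.exp (-(γ * (m - 1) * Real.log l)) * Real.exp (-(γ * (m - 1) * (t - Real.log l))) =
      Real.exp (-(γ * (m - 1) * t)) := by
    rw [← Real.exp_add]; congr 1; ring
  have hden : Real.log r - (t - Real.log l) = Real.log r + Real.log l - t := by ring
  rw [hxx, hpow, hden, hc, ← hE]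
  ring

end SSP

theorem classification_sigma_small (m p : ℝ) (N : ℕ) (hm : 1 < m) (hp0 : 0 < p) (hp1 : p < 1) (hN : 1 ≤ N)
    (hmp : 2 ≤ m + p) :
    ∃ σ0 : ℝ, 2 * (1 - p) / (m - 1) < σ0 ∧
      ∀ σ : ℝ, 2 * (1 - p) / (m - 1) < σ → σ < σ0 →
        (∀ f : ℝ → ℝ, ∀ ξ0 : ℝ, GoodProfile N m p σ f ξ0 →
          (BehB2 N m f ∨ BehB3 m p σ f) → TypeII p f ξ0) ∧
        (∃ f : ℝ → ℝ, ∃ ξ0 : ℝ, ProfileWithInterface N m p σ f ξ0 ∧ TypeI m f ξ0 ∧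
          BehB1 N m p σ f) := by
  obtain ⟨σ0, h0, h⟩ := SSP.constants m p N hm hp0 hp1 hN hmp
  refine ⟨σ0, h0, fun σ h1 h2 => ?_⟩
  obtain ⟨γ, θ, a, b, δ, M, C, S, hθ, hγ, hγe⟩ := h σ h1 h2
  have hL : 0 < σ * (m - 1) + 2 * (p - 1) := by
    rw [div_lt_iff₀ (by linarith)] at h1; linarith
  exact ⟨fun f ξ0 hP hB => SSP.part_one hp1 hN C S hθ hγe f ξ0 hP.1 hB,
    SSP.part_two hp0 hp1 hN hL C S hθ hγ⟩
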